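/- arXiv:math/9407215 — 2 statements merged into one kernel-verified Lean document; each statement's English description precedes it below -/
import Mathlib

section
/- Let E ⊆ Γ be a Carleson set, let α > 1/2, and let f ∈ Λ_α(D) ∩ I⁺(E). Then f ∈ J₀⁺(E). -/
noncomputable section

/-- An invertible contraction on a (complex) Banach space. -/
structure BanachContraction where
  X : Type
  [grp : NormedAddCommGroup X]
  [mod : NormedSpace ℂ X]
  [cpl : CompleteSpace X]
  T : X →L[ℂ] X
  Tinv : X →L[ℂ] X
  norm_le : ‖T‖ ≤ 1
  mul_inv : T * Tinv = 1
  inv_mul : Tinv * T = 1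

attribute [instance] BanachContraction.grp BanachContraction.mod BanachContraction.cpl

open Complex MeasureTheory Metric Set Filter

/-- The `n`-th Taylor coefficient of `f` at `0`, i.e. `f⁽ⁿ⁾(0)/n!`. -/
def taylorCoeff (f : ℂ → ℂ) (n : ℕ) : ℂ := iteratedDeriv n f 0 / (n.factorial : ℂ)

/-- `A⁺`, the algebra of absolutely convergent Taylor series: functions which, on the
closed unit disk, are sums of a power series with absolutely summable coefficients. -/
def APlus : Set (ℂ → ℂ) :=
  {f | ∃ a : ℕ → ℂ, Summable (fun n => ‖a n‖) ∧
    ∀ z ∈ Metric.closedBall (0 : ℂ) 1, HasSum (fun n => a n * z ^ n) (f z)}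

/-- The norm `‖f‖₁ = ∑ₙ |f⁽ⁿ⁾(0)/n!|` on `A⁺`. -/
def APlusNorm (f : ℂ → ℂ) : ℝ := ∑' n : ℕ, ‖taylorCoeff f n‖

/-- The `n`-th Fourier coefficient of (the boundary values of) `f` on the unit circle. -/
def fcoeff (f : ℂ → ℂ) (n : ℤ) : ℂ :=
  (1 / (2 * Real.pi)) * ∫ θ in (0:ℝ)..(2 * Real.pi),
    f (Complex.exp ((θ : ℂ) * Complex.I)) * Complex.exp (-(n : ℂ) * (θ : ℂ) * Complex.I)

/-- The Wiener algebra `A(Γ)` of absolutely convergent Fourier series on the unit circle,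
viewed as functions `ℂ → ℂ` (only the values on the unit circle are relevant). -/
def WienerAlg : Set (ℂ → ℂ) :=
  {f | Summable (fun n : ℤ => ‖fcoeff f n‖) ∧
    ∀ z ∈ Metric.sphere (0 : ℂ) 1, HasSum (fun n : ℤ => fcoeff f n * z ^ n) (f z)}

/-- The norm `‖f‖₁ = ∑_{n ∈ ℤ} |f̂(n)|` on `A(Γ)`. -/
def WienerNorm (f : ℂ → ℂ) : ℝ := ∑' n : ℤ, ‖fcoeff f n‖

/-- `I` is a closed ideal of `A⁺` (closedness w.r.t. the norm `APlusNorm`). -/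
def IsClosedIdealAPlus (I : Set (ℂ → ℂ)) : Prop :=
  I ⊆ APlus ∧
  (∀ f ∈ I, ∀ g ∈ I, f + g ∈ I) ∧
  (∀ f ∈ APlus, ∀ g ∈ I, f * g ∈ I) ∧
  (∀ f ∈ APlus, (∀ ε > 0, ∃ g ∈ I, APlusNorm (f - g) < ε) → f ∈ I)

/-- `J` is a closed ideal of the Wiener algebra `A(Γ)`. -/
def IsClosedIdealW (J : Set (ℂ → ℂ)) : Prop :=
  J ⊆ WienerAlg ∧
  (∀ f ∈ J, ∀ g ∈ J, f + g ∈ J) ∧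
  (∀ f ∈ WienerAlg, ∀ g ∈ J, f * g ∈ J) ∧
  (∀ f ∈ WienerAlg, (∀ ε > 0, ∃ g ∈ J, WienerNorm (f - g) < ε) → f ∈ J)

/-- `I^A` : the closed ideal generated by `I` in the Wiener algebra `A(Γ)`. -/
def IdealGenW (I : Set (ℂ → ℂ)) : Set (ℂ → ℂ) := ⋂₀ {J | IsClosedIdealW J ∧ I ⊆ J}

/-- The hull `h(I)`: common zeros in the closed unit disk of all elements of `I`. -/
def hull (I : Set (ℂ → ℂ)) : Set ℂ :=
  {z ∈ Metric.closedBall (0 : ℂ) 1 | ∀ f ∈ I, f z = 0}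

/-- `I ≠ {0}`: `I` contains an element not identically zero on the unit disk. -/
def NontrivialIdeal (I : Set (ℂ → ℂ)) : Prop :=
  ∃ f ∈ I, ∃ z ∈ Metric.ball (0 : ℂ) 1, f z ≠ 0

/-- `H^∞(D)`: bounded holomorphic functions on the open unit disk. -/
def Hinf : Set (ℂ → ℂ) :=
  {f | DifferentiableOn ℂ f (Metric.ball (0 : ℂ) 1) ∧
    ∃ C : ℝ, ∀ z ∈ Metric.ball (0 : ℂ) 1, ‖f z‖ ≤ C}

/-- An inner function: a bounded-by-one holomorphic function on the unit disk whose
radial limits have modulus `1` at almost every boundary point. -/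
def IsInnerFunction (u : ℂ → ℂ) : Prop :=
  DifferentiableOn ℂ u (Metric.ball (0 : ℂ) 1) ∧
  (∀ z ∈ Metric.ball (0 : ℂ) 1, ‖u z‖ ≤ 1) ∧
  ∀ᵐ (θ : ℝ) ∂(MeasureTheory.volume.restrict (Set.Ioc (0 : ℝ) (2 * Real.pi))),
    Filter.Tendsto (fun r : ℝ => ‖u ((r : ℂ) * Complex.exp ((θ : ℂ) * Complex.I))‖)
      (nhdsWithin 1 (Set.Iio 1)) (nhds 1)

/-- `S` divides (the inner factor of) `f`, i.e. `f ∈ S·H^∞`. -/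
def InnerDivides (S f : ℂ → ℂ) : Prop :=
  ∃ g ∈ Hinf, ∀ z ∈ Metric.ball (0 : ℂ) 1, f z = S z * g z

/-- `S` is a greatest common divisor of the inner factors of the nonzero elements of `I`:
`S` is inner, divides every nonzero element of `I`, and every inner function with this
property divides `S`. -/
def IsGcdInner (I : Set (ℂ → ℂ)) (S : ℂ → ℂ) : Prop :=
  IsInnerFunction S ∧
  (∀ f ∈ I, (∃ z ∈ Metric.ball (0 : ℂ) 1, f z ≠ 0) → InnerDivides S f) ∧
  ∀ S' : ℂ → ℂ, IsInnerFunction S' →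
    (∀ f ∈ I, (∃ z ∈ Metric.ball (0 : ℂ) 1, f z ≠ 0) → InnerDivides S' f) →
    InnerDivides S' S

/-- The perfect symmetric set `E_ξ` of constant ratio `ξ` on the unit circle. -/
def Eset (ξ : ℝ) : Set ℂ :=
  {z | ∃ ε : ℕ → ℕ, (∀ k, ε k ≤ 1) ∧
    z = Complex.exp (2 * Real.pi * Complex.I *
      (((1 - ξ) * ∑' k : ℕ, (ε k : ℝ) * ξ ^ k : ℝ) : ℂ))}

/-- A Carleson set: a closed subset of the unit circle with
`∫_{-π}^{π} log (2 / dist(e^{iθ}, E)) dθ < ∞`. -/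
def IsCarleson (E : Set ℂ) : Prop :=
  IsClosed E ∧ E ⊆ Metric.sphere (0 : ℂ) 1 ∧
  MeasureTheory.IntegrableOn
    (fun θ : ℝ => Real.log (2 / Metric.infDist (Complex.exp ((θ : ℂ) * Complex.I)) E))
    (Set.Ioc (-Real.pi) Real.pi)

/-- The division ideal `I(f) = {g ∈ A⁺ : fg ∈ I}`. -/
def Idiv (I : Set (ℂ → ℂ)) (f : ℂ → ℂ) : Set (ℂ → ℂ) := {g ∈ APlus | f * g ∈ I}

/-- `f` belongs to `A^∞(D)` and vanishes on `E` together with all its derivatives: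
`f` is holomorphic on the disk, and each derivative extends continuously to the closed
disk with the extension vanishing on `E`. -/
def VanishAllDeriv (E : Set ℂ) (f : ℂ → ℂ) : Prop :=
  ContinuousOn f (Metric.closedBall (0 : ℂ) 1) ∧
  DifferentiableOn ℂ f (Metric.ball (0 : ℂ) 1) ∧
  (∀ z ∈ E, f z = 0) ∧
  ∀ n : ℕ, ∃ g : ℂ → ℂ, ContinuousOn g (Metric.closedBall (0 : ℂ) 1) ∧
    Set.EqOn g (iteratedDeriv n f) (Metric.ball (0 : ℂ) 1) ∧ ∀ z ∈ E, g z = 0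

/-- `J₀⁺(E)`: the closure in `A⁺` of the set of elements of `A^∞(D)` vanishing on `E`
together with all their derivatives. -/
def J0Plus (E : Set ℂ) : Set (ℂ → ℂ) :=
  {f | f ∈ APlus ∧ ∀ ε > 0, ∃ g ∈ APlus, VanishAllDeriv E g ∧ APlusNorm (f - g) < ε}

/-- `I⁺(E) = {f ∈ A⁺ : f ≡ 0 on E}`. -/
def IPlus (E : Set ℂ) : Set (ℂ → ℂ) := {f ∈ APlus | ∀ z ∈ E, f z = 0}

/-- The pairing of `f ∈ A⁺ ≅ ℓ¹(ℕ)` with an element `c ∈ c₀`. -/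
def pairing (f : ℂ → ℂ) (c : ℕ → ℂ) : ℂ := ∑' n : ℕ, taylorCoeff f n * c n

/-- `S` is dense in `A⁺` for the weak-star topology `σ(ℓ¹, c₀)`. -/
def WStarDense (S : Set (ℂ → ℂ)) : Prop :=
  ∀ f ∈ APlus, ∀ (m : ℕ) (c : Fin m → ℕ → ℂ),
    (∀ i, Filter.Tendsto (c i) Filter.atTop (nhds 0)) →
    ∀ ε > 0, ∃ g ∈ S, ∀ i, ‖pairing f (c i) - pairing g (c i)‖ < ε

/-- `S` is closed in `A⁺` for the weak-star topology `σ(ℓ¹, c₀)`. -/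
def WStarClosed (S : Set (ℂ → ℂ)) : Prop :=
  S ⊆ APlus ∧
  ∀ f ∈ APlus,
    (∀ (m : ℕ) (c : Fin m → ℕ → ℂ),
      (∀ i, Filter.Tendsto (c i) Filter.atTop (nhds 0)) →
      ∀ ε > 0, ∃ g ∈ S, ∀ i, ‖pairing f (c i) - pairing g (c i)‖ < ε) → f ∈ S

/-- A Kronecker set: a compact subset of the unit circle on which every continuous
unimodular function is a uniform limit of characters `z ↦ zⁿ`, `n ∈ ℤ`. -/
def IsKronecker (K : Set ℂ) : Prop :=
  IsCompact K ∧ K ⊆ Metric.sphere (0 : ℂ) 1 ∧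
  ∀ f : ℂ → ℂ, ContinuousOn f K → (∀ z ∈ K, ‖f z‖ = 1) →
    ∀ ε > 0, ∃ n : ℤ, ∀ z ∈ K, ‖f z - z ^ n‖ < ε

/-- A Helson set: a compact subset of the unit circle on which every continuous function
is the restriction of an element of the Wiener algebra. -/
def IsHelson (K : Set ℂ) : Prop :=
  IsCompact K ∧ K ⊆ Metric.sphere (0 : ℂ) 1 ∧
  ∀ f : ℂ → ℂ, ContinuousOn f K → ∃ g ∈ WienerAlg, ∀ z ∈ K, f z = g z

/-- The little Lipschitz class `Λ_α(D)`: disc-algebra functions with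
`|f(e^{it₁}) - f(e^{it₂})| / |t₁-t₂|^α → 0` uniformly as `|t₁-t₂| → 0`. -/
def LittleLip (α : ℝ) (f : ℂ → ℂ) : Prop :=
  ContinuousOn f (Metric.closedBall (0 : ℂ) 1) ∧
  DifferentiableOn ℂ f (Metric.ball (0 : ℂ) 1) ∧
  ∀ ε > 0, ∃ δ > 0, ∀ t₁ t₂ : ℝ, t₁ ≠ t₂ → |t₁ - t₂| < δ →
    ‖f (Complex.exp ((t₁ : ℂ) * Complex.I)) - f (Complex.exp ((t₂ : ℂ) * Complex.I))‖ ≤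
      ε * |t₁ - t₂| ^ α

/-- The perfect part of a set: the union of all its perfect subsets. -/
def perfectPart (C : Set ℂ) : Set ℂ := ⋃₀ {P | Perfect P ∧ P ⊆ C}

/-- A distribution on the unit circle, encoded by its sequence of Fourier coefficients
`μ̂(n) = μ(e^{-int})`, which has polynomial growth. -/
structure CircleDistribution where
  coeff : ℤ → ℂ
  growth : ∃ (C : ℝ) (k : ℕ), ∀ n : ℤ, ‖coeff n‖ ≤ C * (1 + (n.natAbs : ℝ)) ^ k

/-- A smooth `2π`-periodic function (test function on the circle). -/
def PeriodicSmooth (φ : ℝ → ℂ) : Prop :=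
  ContDiff ℝ (⊤ : ℕ∞) φ ∧ ∀ θ : ℝ, φ (θ + 2 * Real.pi) = φ θ

/-- Fourier coefficients of a test function. -/
def testCoeff (φ : ℝ → ℂ) (n : ℤ) : ℂ :=
  (1 / (2 * Real.pi)) * ∫ θ in (0:ℝ)..(2 * Real.pi),
    φ θ * Complex.exp (-(n : ℂ) * (θ : ℂ) * Complex.I)

/-- The action of a distribution on a test function: `μ(φ) = ∑ₙ μ̂(n) φ̂(-n)`. -/
def distAct (μ : CircleDistribution) (φ : ℝ → ℂ) : ℂ := ∑' n : ℤ, μ.coeff n * testCoeff φ (-n)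

/-- The support of a distribution on the circle: the points of the circle having no open
neighbourhood `U` such that `μ` kills every test function supported in `U`. -/
def distSupport (μ : CircleDistribution) : Set ℂ :=
  {z ∈ Metric.sphere (0 : ℂ) 1 | ∀ U : Set ℂ, IsOpen U → z ∈ U →
    ∃ φ : ℝ → ℂ, PeriodicSmooth φ ∧
      (∀ θ : ℝ, Complex.exp ((θ : ℂ) * Complex.I) ∉ U → φ θ = 0) ∧ distAct μ φ ≠ 0}

/-- A set of multiplicity: a closed subset of the circle supporting a nonzero
pseudofunction (distribution whose Fourier coefficients tend to `0` as `|n| → ∞`). -/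
def IsMSet (E : Set ℂ) : Prop :=
  IsClosed E ∧ E ⊆ Metric.sphere (0 : ℂ) 1 ∧
  ∃ μ : CircleDistribution, μ.coeff ≠ 0 ∧ distSupport μ ⊆ E ∧
    Filter.Tendsto μ.coeff Filter.cofinite (nhds 0)

/-- A Dirichlet set: `sup_{z ∈ E} |z^{n_k} - 1| → 0` for some sequence `n_k → ∞`. -/
def IsDirichletSet (E : Set ℂ) : Prop :=
  ∃ n : ℕ → ℕ, Filter.Tendsto n Filter.atTop Filter.atTop ∧
    ∀ ε > 0, ∀ᶠ k in Filter.atTop, ∀ z ∈ E, ‖z ^ (n k) - 1‖ < ε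



open scoped Topology

lemma hasSum_taylorCoeff {F : ℂ → ℂ} (hF : DifferentiableOn ℂ F (ball 0 1)) {z : ℂ}
    (hz : z ∈ ball (0 : ℂ) 1) : HasSum (fun n => taylorCoeff F n * z ^ n) (F z) := by
  have h := Complex.hasSum_taylorSeries_on_ball hF hz
  have he : (fun n => taylorCoeff F n * z ^ n) =
      fun n => (n.factorial : ℂ)⁻¹ • (z - 0) ^ n • iteratedDeriv n F 0 := by
    funext n
    simp only [taylorCoeff, sub_zero, smul_eq_mul]
    ring
  rw [he]
  exact h

/-- Bessel's inequality for the Taylor coefficients of a holomorphic function. -/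
lemma sum_sq_taylorCoeff_le {P : ℂ → ℂ} (hP : DifferentiableOn ℂ P (ball 0 1)) {r B : ℝ}
    (hr0 : 0 < r) (hr1 : r < 1) (hB : ∀ z : ℂ, ‖z‖ = r → ‖P z‖ ≤ B) (s : Finset ℕ) :
    ∑ n ∈ s, (‖taylorCoeff P n‖ * r ^ n) ^ 2 ≤ B ^ 2 := by
  have hB0 : 0 ≤ B := (norm_nonneg _).trans (hB (r : ℂ) (by simp [abs_of_pos hr0]))
  have hmem : ∀ z : ℂ, ‖z‖ = r → z ∈ ball (0 : ℂ) 1 := fun z hz => by simpa [hz] using hr1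
  have hS : Summable (fun n => ‖taylorCoeff P n‖ * r ^ n) := by
    have h := (hasSum_taylorCoeff hP (hmem r (by simp [abs_of_pos hr0]))).summable.norm
    simpa [abs_of_pos hr0] using h
  have key : ∀ ε > 0, ∑ n ∈ s, (‖taylorCoeff P n‖ * r ^ n) ^ 2 ≤ (B + ε) ^ 2 := by
    intro ε hε
    have h1 := (tendsto_sum_nat_add (fun n => ‖taylorCoeff P n‖ * r ^ n)).eventually
      (gt_mem_nhds hε)
    obtain ⟨N, hN, hsN⟩ := (h1.and (eventually_ge_atTop (s.sup id + 1))).exists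
    have hsub : s ⊆ Finset.range N := fun n hn => by
      have : n ≤ s.sup id := Finset.le_sup (f := id) hn
      simp; omega
    let p : Polynomial ℂ := ∑ n ∈ Finset.range N, Polynomial.monomial n (taylorCoeff P n * r ^ n)
    have hcoeff : ∀ n ∈ Finset.range N, p.coeff n = taylorCoeff P n * r ^ n := by
      intro n hn
      simp only [p, Polynomial.finsetSum_coeff, Polynomial.coeff_monomial]
      rw [Finset.sum_ite_eq' (Finset.range N) n]
      simp [hn]
    have heval : ∀ ζ : ℂ, ‖ζ‖ = 1 → ‖p.eval ζ‖ ≤ B + ε := by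
      intro ζ hζ
      have hz : ‖(r : ℂ) * ζ‖ = r := by simp [hζ, abs_of_pos hr0]
      have hsum := hasSum_taylorCoeff hP (hmem _ hz)
      have hsplit := hsum.summable.sum_add_tsum_nat_add N
      rw [hsum.tsum_eq] at hsplit
      have hp : p.eval ζ = ∑ i ∈ Finset.range N, taylorCoeff P i * (r * ζ) ^ i := by
        simp only [p, Polynomial.eval_finsetSum, Polynomial.eval_monomial]
        refine Finset.sum_congr rfl fun i _ => ?_
        rw [mul_pow]; ring
      have htail : ‖∑' i, taylorCoeff P (i + N) * (r * ζ) ^ (i + N)‖ ≤ ε := by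
        have hnorm : ∀ i, ‖taylorCoeff P (i + N) * (r * ζ) ^ (i + N)‖ =
            ‖taylorCoeff P (i + N)‖ * r ^ (i + N) := fun i => by
          rw [norm_mul, norm_pow, hz]
        refine (norm_tsum_le_tsum_norm ?_).trans ?_
        · simp_rw [hnorm]; exact (summable_nat_add_iff N).2 hS
        · simp_rw [hnorm]; exact hN.le
      have : p.eval ζ = P (r * ζ) - ∑' i, taylorCoeff P (i + N) * (r * ζ) ^ (i + N) := by
        rw [hp, ← hsplit]; ring
      rw [this]
      exact (norm_sub_le _ _).trans (add_le_add (hB _ hz) htail)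
    have hpars := p.sum_sq_norm_coeff_eq_circleAverage
    have havg : Real.circleAverage (fun θ ↦ ‖p.eval θ‖ ^ 2) 0 1 ≤ (B + ε) ^ 2 := by
      refine Real.circleAverage_mono_on_of_le_circle ?_ ?_
      · apply ContinuousOn.circleIntegrable'
        fun_prop
      · intro ζ hζ
        have : ‖ζ‖ = 1 := by simpa using hζ
        exact pow_le_pow_left₀ (norm_nonneg _) (heval ζ this) 2
    calc ∑ n ∈ s, (‖taylorCoeff P n‖ * r ^ n) ^ 2
        ≤ ∑ n ∈ Finset.range N, (‖taylorCoeff P n‖ * r ^ n) ^ 2 :=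
          Finset.sum_le_sum_of_subset_of_nonneg hsub fun _ _ _ => sq_nonneg _
      _ = ∑ n ∈ Finset.range N, ‖p.coeff n‖ ^ 2 := by
          refine Finset.sum_congr rfl fun n hn => ?_
          rw [hcoeff n hn]; simp [abs_of_pos hr0]
      _ = ∑ n ∈ p.support, ‖p.coeff n‖ ^ 2 := by
          symm
          refine Finset.sum_subset ?_ ?_
          · intro n hn
            by_contra hcon
            apply Polynomial.mem_support_iff.1 hn
            simp only [p, Polynomial.finsetSum_coeff, Polynomial.coeff_monomial]
            exact Finset.sum_eq_zero fun m hm => if_neg (by rintro rfl; exact hcon hm)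
          · intro n _ hn
            simp [Polynomial.notMem_support_iff.1 hn]
      _ ≤ (B + ε) ^ 2 := hpars ▸ havg
  have hlim : Tendsto (fun ε : ℝ => (B + ε) ^ 2) (𝓝[>] 0) (𝓝 (B ^ 2)) := by
    have : Tendsto (fun ε : ℝ => (B + ε) ^ 2) (𝓝 0) (𝓝 ((B + 0) ^ 2)) :=
      (by fun_prop : Continuous fun ε : ℝ => (B + ε) ^ 2).tendsto 0
    rw [add_zero] at this
    exact this.mono_left nhdsWithin_le_nhds
  exact ge_of_tendsto hlim (eventually_nhdsWithin_of_forall fun ε hε => key ε hε)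

lemma taylorCoeff_succ (F : ℂ → ℂ) (n : ℕ) :
    taylorCoeff F (n + 1) = taylorCoeff (deriv F) n / (n + 1) := by
  simp only [taylorCoeff, iteratedDeriv_succ', Nat.factorial_succ]
  push_cast
  field_simp

lemma sum_block_taylorCoeff_le {β C : ℝ} (hβ : 1 / 2 < β) (hC : 0 ≤ C) {F : ℂ → ℂ}
    (hF : DifferentiableOn ℂ F (ball 0 1))
    (hF' : ∀ z ∈ ball (0 : ℂ) 1, ‖deriv F z‖ ≤ C * (1 - ‖z‖) ^ (β - 1)) (k : ℕ) :
    ∑ n ∈ Finset.Ico (2 ^ k) (2 ^ (k + 1)), ‖taylorCoeff F n‖ ≤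
      8 * C * ((2 : ℝ) ^ (1 / 2 - β)) ^ k := by
  set δ : ℝ := 1 / 2 ^ (k + 1) with hδ
  have hδ0 : 0 < δ := by positivity
  have hδ1 : δ ≤ 1 / 2 := by
    rw [hδ, pow_succ]
    have : (1 : ℝ) ≤ 2 ^ k := one_le_pow₀ (by norm_num)
    exact one_div_le_one_div_of_le (by norm_num) (by linarith)
  set r : ℝ := 1 - δ with hr
  have hr0 : 0 < r := by linarith
  have hr1 : r < 1 := by linarith
  have hd : DifferentiableOn ℂ (deriv F) (ball 0 1) := hF.deriv isOpen_ball
  have hB : ∀ z : ℂ, ‖z‖ = r → ‖deriv F z‖ ≤ C * δ ^ (β - 1) := fun z hz => by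
    have := hF' z (by simpa [hz] using hr1)
    rwa [hz, hr, sub_sub_cancel] at this
  have hhalf : (1 : ℝ) / 2 ≤ r ^ (2 ^ k) := by
    have h := one_add_mul_le_pow (a := -δ) (by linarith) (2 ^ k)
    have he : ((2 ^ k : ℕ) : ℝ) * δ = 1 / 2 := by
      rw [hδ, pow_succ]; push_cast; field_simp
    have : 1 + ((2 ^ k : ℕ) : ℝ) * -δ = 1 / 2 := by linarith
    rw [this] at h
    simpa [hr, sub_eq_add_neg] using h
  have hquart : ∀ m, m < 2 ^ (k + 1) → (1 : ℝ) / 4 ≤ r ^ m := fun m hm => by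
    calc (1 : ℝ) / 4 = (1 / 2) * (1 / 2) := by norm_num
      _ ≤ r ^ (2 ^ k) * r ^ (2 ^ k) := by gcongr
      _ = r ^ (2 ^ (k + 1)) := by rw [← pow_add]; congr 1; ring
      _ ≤ r ^ m := pow_le_pow_of_le_one hr0.le hr1.le hm.le
  have hterm : ∀ n ∈ Finset.Ico (2 ^ k) (2 ^ (k + 1)), ‖taylorCoeff F n‖ ^ 2 ≤
      (4 / 2 ^ k) ^ 2 * (‖taylorCoeff (deriv F) (n - 1)‖ * r ^ (n - 1)) ^ 2 := by
    intro n hn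
    rw [Finset.mem_Ico] at hn
    have hpos : 0 < n := lt_of_lt_of_le (by positivity) hn.1
    obtain ⟨m, rfl⟩ : ∃ m, n = m + 1 := ⟨n - 1, by omega⟩
    rw [← mul_pow]
    refine pow_le_pow_left₀ (norm_nonneg _) ?_ 2
    rw [taylorCoeff_succ, norm_div, Nat.add_sub_cancel]
    have h1 : ‖((m : ℂ) + 1)‖ = (m : ℝ) + 1 := by
      have : ((m : ℂ) + 1) = ((m + 1 : ℕ) : ℂ) := by push_cast; ring
      rw [this, Complex.norm_natCast]; push_cast; ring
    rw [h1]
    have h2 : (2 : ℝ) ^ k ≤ m + 1 := by exact_mod_cast hn.1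
    have h3 := hquart m (by omega)
    have h4 : (0 : ℝ) < 2 ^ k := by positivity
    calc ‖taylorCoeff (deriv F) m‖ / (m + 1) ≤ ‖taylorCoeff (deriv F) m‖ / 2 ^ k := by gcongr
      _ = 4 / 2 ^ k * (‖taylorCoeff (deriv F) m‖ * (1 / 4)) := by ring
      _ ≤ _ := by gcongr
  have hsq : (∑ n ∈ Finset.Ico (2 ^ k) (2 ^ (k + 1)), ‖taylorCoeff F n‖) ^ 2 ≤
      2 ^ k * ((4 / 2 ^ k) ^ 2 * (C * δ ^ (β - 1)) ^ 2) := by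
    refine sq_sum_le_card_mul_sum_sq.trans ?_
    have hcard : ((Finset.Ico (2 ^ k) (2 ^ (k + 1))).card : ℝ) = 2 ^ k := by
      rw [Nat.card_Ico, pow_succ, Nat.cast_sub (by omega)]; push_cast; ring
    rw [hcard]
    gcongr
    refine (Finset.sum_le_sum hterm).trans ?_
    rw [← Finset.mul_sum]
    gcongr
    have hinj : Set.InjOn (fun n => n - 1) (Finset.Ico (2 ^ k) (2 ^ (k + 1)) : Set ℕ) := by
      intro a ha b hb hab
      simp only [Finset.coe_Ico, Set.mem_Ico] at ha hb
      have : 0 < 2 ^ k := by positivity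
      simp only at hab
      omega
    have := sum_sq_taylorCoeff_le hd hr0 hr1 hB
      ((Finset.Ico (2 ^ k) (2 ^ (k + 1))).image (fun n => n - 1))
    rwa [Finset.sum_image hinj] at this
  refine le_of_sq_le_sq (hsq.trans ?_) (by positivity)
  have e0 : (2 : ℝ) ^ k = 2 ^ (k : ℝ) := by rw [Real.rpow_natCast]
  have e1 : δ ^ (β - 1) = (2 : ℝ) ^ (((k : ℝ) + 1) * (1 - β)) := by
    have : δ = (2 : ℝ) ^ (-((k : ℝ) + 1)) := by
      rw [Real.rpow_neg (by norm_num), hδ, one_div]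
      congr 1
      exact_mod_cast (Real.rpow_natCast 2 (k + 1)).symm
    rw [this, ← Real.rpow_mul (by norm_num)]
    congr 1; ring
  have e2 : ((2 : ℝ) ^ (1 / 2 - β)) ^ k = (2 : ℝ) ^ ((1 / 2 - β) * k) := by
    rw [← Real.rpow_natCast, ← Real.rpow_mul (by norm_num)]
  have e3 : ((2 : ℝ) ^ (((k : ℝ) + 1) * (1 - β))) ^ 2 =
      2 ^ (k : ℝ) * (2 ^ ((1 / 2 - β) * k)) ^ 2 * 2 ^ (2 - 2 * β) := by
    rw [← Real.rpow_natCast, ← Real.rpow_natCast, ← Real.rpow_mul (by norm_num),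
      ← Real.rpow_mul (by norm_num), ← Real.rpow_add (by norm_num), ← Real.rpow_add (by norm_num)]
    congr 1; push_cast; ring
  have e4 : (2 : ℝ) ^ (2 - 2 * β) ≤ 2 := by
    calc (2 : ℝ) ^ (2 - 2 * β) ≤ 2 ^ (1 : ℝ) :=
          Real.rpow_le_rpow_of_exponent_le (by norm_num) (by linarith)
      _ = 2 := by norm_num
  rw [e1, e2, e0, mul_pow C, e3]
  have h2k : (0 : ℝ) < 2 ^ (k : ℝ) := by positivity
  calc (2 : ℝ) ^ (k : ℝ) * ((4 / 2 ^ (k : ℝ)) ^ 2 * (C ^ 2 * (2 ^ (k : ℝ) *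
        (2 ^ ((1 / 2 - β) * k)) ^ 2 * 2 ^ (2 - 2 * β))))
      = 16 * C ^ 2 * (2 ^ ((1 / 2 - β) * (k : ℝ))) ^ 2 * 2 ^ (2 - 2 * β) := by
        field_simp
        ring
    _ ≤ 16 * C ^ 2 * (2 ^ ((1 / 2 - β) * (k : ℝ))) ^ 2 * 2 := by gcongr
    _ ≤ (8 * C * 2 ^ ((1 / 2 - β) * (k : ℝ))) ^ 2 := by
        have : 0 ≤ C ^ 2 * ((2 : ℝ) ^ ((1 / 2 - β) * (k : ℝ))) ^ 2 := by positivity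
        nlinarith

lemma norm_taylorCoeff_le {F : ℂ → ℂ} (hF : DifferentiableOn ℂ F (ball 0 1)) {η : ℝ}
    (h : ∀ z : ℂ, ‖z‖ = 1 / 2 → ‖F z‖ ≤ η) (n : ℕ) : ‖taylorCoeff F n‖ ≤ 2 ^ n * η := by
  have hd : DiffContOnCl ℂ F (ball 0 (1 / 2)) :=
    hF.diffContOnCl_ball (closedBall_subset_ball (by norm_num))
  have h1 := Complex.norm_iteratedDeriv_le_of_forall_mem_sphere_norm_le n (by norm_num) hd
    (C := η) (fun z hz => h z (by simpa using hz))
  have hn : (0 : ℝ) < n.factorial := by positivity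
  rw [taylorCoeff, norm_div, Complex.norm_natCast, div_le_iff₀ hn]
  refine h1.trans (le_of_eq ?_)
  rw [div_pow, one_pow]
  field_simp

/-- A growth bound of order `β - 1 > -1/2` on the derivative forces absolutely summable Taylor
coefficients, whose sum is small if moreover the function is small on a fixed circle. -/
lemma exists_tsum_taylorCoeff_le {β C ε : ℝ} (hβ : 1 / 2 < β) (hC : 0 ≤ C) (hε : 0 < ε) :
    ∃ η > 0, ∀ F : ℂ → ℂ, DifferentiableOn ℂ F (ball 0 1) →
      (∀ z ∈ ball (0 : ℂ) 1, ‖deriv F z‖ ≤ C * (1 - ‖z‖) ^ (β - 1)) →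
      Summable (fun n => ‖taylorCoeff F n‖) ∧
      ((∀ z : ℂ, ‖z‖ = 1 / 2 → ‖F z‖ ≤ η) → ∑' n, ‖taylorCoeff F n‖ ≤ ε) := by
  set q : ℝ := (2 : ℝ) ^ (1 / 2 - β) with hq
  have hq0 : 0 < q := by positivity
  have hq1 : q < 1 := Real.rpow_lt_one_of_one_lt_of_neg (by norm_num) (by linarith)
  have hsum : ∀ F : ℂ → ℂ, DifferentiableOn ℂ F (ball 0 1) →
      (∀ z ∈ ball (0 : ℂ) 1, ‖deriv F z‖ ≤ C * (1 - ‖z‖) ^ (β - 1)) → ∀ M n : ℕ,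
      ∑ i ∈ Finset.range n, ‖taylorCoeff F i‖ ≤
        ∑ i ∈ Finset.range (2 ^ M), ‖taylorCoeff F i‖ + 8 * C * (q ^ M / (1 - q)) := by
    intro F hF hF' M n
    have hind : ∀ N, M ≤ N → ∑ i ∈ Finset.range (2 ^ N), ‖taylorCoeff F i‖ ≤
        ∑ i ∈ Finset.range (2 ^ M), ‖taylorCoeff F i‖ +
          8 * C * ∑ k ∈ Finset.Ico M N, q ^ k := by
      intro N hN
      induction N, hN using Nat.le_induction with
      | base => simp
      | succ N hN ih =>
        have hle : (2 : ℕ) ^ N ≤ 2 ^ (N + 1) := Nat.pow_le_pow_right (by norm_num) (by omega)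
        rw [← Finset.sum_range_add_sum_Ico _ hle, Finset.sum_Ico_succ_top hN, mul_add,
          ← add_assoc]
        exact add_le_add ih (sum_block_taylorCoeff_le hβ hC hF hF' N)
    have hsub : Finset.range n ⊆ Finset.range (2 ^ (max M n)) := by
      rw [Finset.range_subset_range]
      exact (Nat.lt_two_pow_self).le.trans
        (Nat.pow_le_pow_right (by norm_num) (le_max_right _ _))
    refine (Finset.sum_le_sum_of_subset_of_nonneg hsub fun _ _ _ => norm_nonneg _).trans ?_
    refine (hind _ (le_max_left _ _)).trans ?_
    gcongr
    exact geom_sum_Ico_le_of_lt_one hq0.le hq1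
  have hlim : Tendsto (fun M : ℕ => 8 * C * (q ^ M / (1 - q))) atTop (𝓝 (8 * C * (0 / (1 - q)))) :=
    ((tendsto_pow_atTop_nhds_zero_of_lt_one hq0.le hq1).div_const _).const_mul _
  rw [zero_div, mul_zero] at hlim
  obtain ⟨M, hM⟩ := (hlim.eventually (gt_mem_nhds (half_pos hε))).exists
  have hS : (0 : ℝ) < ∑ i ∈ Finset.range (2 ^ M), (2 : ℝ) ^ i :=
    Finset.sum_pos (fun _ _ => by positivity) ⟨0, by simp⟩
  refine ⟨ε / 2 / ∑ i ∈ Finset.range (2 ^ M), (2 : ℝ) ^ i, by positivity, fun F hF hF' => ⟨?_, ?_⟩⟩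
  · exact summable_of_sum_range_le (fun _ => norm_nonneg _) (hsum F hF hF' 0)
  · intro h
    refine Real.tsum_le_of_sum_range_le (fun _ => norm_nonneg _) fun n => ?_
    refine (hsum F hF hF' M n).trans ?_
    have : ∑ i ∈ Finset.range (2 ^ M), ‖taylorCoeff F i‖ ≤ ε / 2 := by
      refine (Finset.sum_le_sum fun i _ => norm_taylorCoeff_le hF h i).trans ?_
      rw [← Finset.sum_mul]
      exact (mul_div_cancel₀ _ hS.ne').le
    linarith

lemma mem_APlus_of_summable {F : ℂ → ℂ} (hc : ContinuousOn F (closedBall 0 1))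
    (hF : DifferentiableOn ℂ F (ball 0 1)) (hs : Summable (fun n => ‖taylorCoeff F n‖)) :
    F ∈ APlus := by
  refine ⟨taylorCoeff F, hs, ?_⟩
  have hb : ∀ n, ∀ z ∈ closedBall (0 : ℂ) 1, ‖taylorCoeff F n * z ^ n‖ ≤ ‖taylorCoeff F n‖ := by
    intro n z hz
    rw [norm_mul, norm_pow]
    exact mul_le_of_le_one_right (norm_nonneg _)
      (pow_le_one₀ (norm_nonneg _) (by simpa using hz))
  have hG : ContinuousOn (fun z => ∑' n, taylorCoeff F n * z ^ n) (closedBall 0 1) :=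
    continuousOn_tsum (fun n => by fun_prop) hs hb
  have heq : Set.EqOn F (fun z => ∑' n, taylorCoeff F n * z ^ n) (closedBall 0 1) := by
    have h1 : Set.EqOn F (fun z => ∑' n, taylorCoeff F n * z ^ n) (ball 0 1) :=
      fun z hz => (hasSum_taylorCoeff hF hz).tsum_eq.symm
    refine h1.of_subset_closure hc hG ball_subset_closedBall ?_
    rw [closure_ball _ one_ne_zero]
  intro z hz
  rw [heq hz]
  exact (Summable.of_norm_bounded hs (fun n => hb n z hz)).hasSum

lemma taylorCoeff_sub {F G : ℂ → ℂ} (hF : DifferentiableOn ℂ F (ball 0 1))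
    (hG : DifferentiableOn ℂ G (ball 0 1)) (n : ℕ) :
    taylorCoeff (F - G) n = taylorCoeff F n - taylorCoeff G n := by
  have h0 : ball (0 : ℂ) 1 ∈ 𝓝 (0 : ℂ) := ball_mem_nhds _ one_pos
  have h1 : ContDiffAt ℂ n F 0 := (hF.analyticAt h0).contDiffAt
  have h2 : ContDiffAt ℂ n G 0 := (hG.analyticAt h0).contDiffAt
  simp only [taylorCoeff]
  rw [iteratedDeriv_sub h1 h2, sub_div]

lemma exists_norm_mul_eq (z : ℂ) : ∃ ζ : ℂ, ‖ζ‖ = 1 ∧ z = ‖z‖ * ζ :=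
  ⟨exp (arg z * I), norm_exp_ofReal_mul_I _, (norm_mul_exp_arg_mul_I z).symm⟩

lemma abs_le_mul_norm_exp_sub_one {x : ℝ} (hx : |x| ≤ Real.pi) :
    |x| ≤ Real.pi / 2 * ‖exp (x * I) - 1‖ := by
  have h1 : ‖exp (x * I) - 1‖ = 2 * |Real.sin (x / 2)| := by
    rw [mul_comm, Complex.norm_exp_I_mul_ofReal_sub_one, norm_mul]
    simp
  have h2 := Real.mul_abs_le_abs_sin (x := x / 2) (by rw [abs_div]; simp; linarith)
  have hpi := Real.pi_pos
  rw [h1]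
  rw [abs_div, abs_two] at h2
  calc |x| = Real.pi / 2 * (2 * (2 / Real.pi * (|x| / 2))) := by field_simp
    _ ≤ _ := by gcongr

lemma norm_exp_sub_one_le (x : ℝ) : ‖exp (x * I) - 1‖ ≤ |x| := by
  have := Real.norm_exp_I_mul_ofReal_sub_one_le (x := x)
  rwa [mul_comm, Real.norm_eq_abs] at this

/-- Two points of the circle are joined by an arc comparable to the chord. -/
lemma exists_exp_mul_eq {ζ₁ ζ₂ : ℂ} (h₁ : ‖ζ₁‖ = 1) (h₂ : ‖ζ₂‖ = 1) :
    ∃ t x : ℝ, ζ₁ = exp (t * I) ∧ ζ₂ = exp ((t + x : ℝ) * I) ∧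
      |x| ≤ Real.pi / 2 * ‖ζ₁ - ζ₂‖ := by
  have hz₁ : ζ₁ ≠ 0 := by rintro rfl; simp at h₁
  have e1 : ζ₁ = exp (arg ζ₁ * I) := by
    have := (norm_mul_exp_arg_mul_I ζ₁).symm
    rwa [h₁, ofReal_one, one_mul] at this
  have e2 : ζ₂ / ζ₁ = exp (arg (ζ₂ / ζ₁) * I) := by
    have := (norm_mul_exp_arg_mul_I (ζ₂ / ζ₁)).symm
    rwa [norm_div, h₁, h₂, div_one, ofReal_one, one_mul] at this
  refine ⟨arg ζ₁, arg (ζ₂ / ζ₁), e1, ?_, ?_⟩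
  · rw [ofReal_add, add_mul, Complex.exp_add, ← e1, ← e2, mul_div_cancel₀ _ hz₁]
  · have h := abs_le_mul_norm_exp_sub_one (Complex.abs_arg_le_pi (ζ₂ / ζ₁))
    rw [← e2] at h
    have : ‖ζ₂ / ζ₁ - 1‖ = ‖ζ₁ - ζ₂‖ := by
      rw [div_sub_one hz₁, norm_div, h₁, div_one, norm_sub_rev]
    rwa [this] at h

lemma LittleLip.exists_holder {α : ℝ} (hα : 1 / 2 < α) {f : ℂ → ℂ} (hf : LittleLip α f) :
    ∃ a C : ℝ, 1 / 2 < a ∧ a < 1 ∧ 0 < C ∧ ∀ ζ₁ ζ₂ : ℂ, ‖ζ₁‖ = 1 → ‖ζ₂‖ = 1 →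
      ‖f ζ₁ - f ζ₂‖ ≤ C * ‖ζ₁ - ζ₂‖ ^ a := by
  obtain ⟨hc, -, hl⟩ := hf
  obtain ⟨δ, hδ, hl⟩ := hl 1 one_pos
  obtain ⟨M, hM⟩ := (isCompact_closedBall (0 : ℂ) 1).exists_bound_of_continuousOn hc
  set a := min α (3 / 4) with ha
  have ha1 : 1 / 2 < a := lt_min hα (by norm_num)
  have ha2 : a ≤ 3 / 4 := min_le_right _ _
  have ha0 : 0 < a := by linarith
  have hM0 : 0 ≤ M := (norm_nonneg _).trans (hM 0 (by simp))
  set δ' := min δ 1 with hδ'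
  have hδ'0 : 0 < δ' := lt_min hδ one_pos
  have hpi := Real.pi_pos
  set A := (Real.pi / 2) ^ a with hA
  have hA0 : 0 < A := by positivity
  refine ⟨a, A + 2 * M * (A / δ' ^ a), ha1, by linarith, by positivity, fun ζ₁ ζ₂ h₁ h₂ => ?_⟩
  obtain ⟨t, x, e1, e2, hx⟩ := exists_exp_mul_eq h₁ h₂
  have hxa : |x| ^ a ≤ A * ‖ζ₁ - ζ₂‖ ^ a := by
    rw [hA, ← Real.mul_rpow (by positivity) (norm_nonneg _)]
    gcongr
  have hnn : 0 ≤ ‖ζ₁ - ζ₂‖ ^ a := by positivity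
  by_cases hx0 : x = 0
  · have : ζ₁ = ζ₂ := by rw [e1, e2, hx0, add_zero]
    rw [this, sub_self, norm_zero]
    positivity
  rcases lt_or_ge |x| δ' with hlt | hge
  · have h := hl t (t + x) (by simpa using hx0)
      (by simpa using hlt.trans_le (min_le_left _ _))
    rw [← e1, ← e2] at h
    have h3 : |t - (t + x)| = |x| := by simp
    rw [h3, one_mul] at h
    have h4 : |x| ^ α ≤ |x| ^ a :=
      Real.rpow_le_rpow_of_exponent_ge (abs_pos.2 hx0) (hlt.le.trans (min_le_right _ _))
        (min_le_left _ _)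
    have : 0 ≤ 2 * M * (A / δ' ^ a) * ‖ζ₁ - ζ₂‖ ^ a := by positivity
    linarith
  · have h5 : δ' ^ a ≤ A * ‖ζ₁ - ζ₂‖ ^ a := (Real.rpow_le_rpow hδ'0.le hge ha0.le).trans hxa
    have h6 : 1 ≤ A / δ' ^ a * ‖ζ₁ - ζ₂‖ ^ a := by
      rw [div_mul_eq_mul_div, le_div_iff₀ (by positivity), one_mul]
      exact h5
    have h7 : ‖f ζ₁ - f ζ₂‖ ≤ 2 * M := by
      have b1 := hM ζ₁ (by simp [h₁])
      have b2 := hM ζ₂ (by simp [h₂])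
      have := norm_sub_le (f ζ₁) (f ζ₂)
      linarith
    calc ‖f ζ₁ - f ζ₂‖ ≤ 2 * M * 1 := by linarith
      _ ≤ 2 * M * (A / δ' ^ a * ‖ζ₁ - ζ₂‖ ^ a) := by gcongr
      _ ≤ _ := by nlinarith [mul_nonneg hA0.le hnn]

lemma norm_one_sub_le_norm_offset {u : ℂ} (hu : ‖u‖ ≤ 1) {s : ℝ} (hs : 0 ≤ s) :
    ‖1 - u‖ ≤ ‖(1 + s : ℂ) - u‖ := by
  have hre : u.re ≤ 1 := (re_le_norm u).trans hu
  rw [← sq_le_sq₀ (norm_nonneg _) (norm_nonneg _), ← normSq_eq_norm_sq, ← normSq_eq_norm_sq,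
    normSq_apply, normSq_apply]
  simp only [sub_re, one_re, sub_im, one_im, add_re, ofReal_re, add_im, ofReal_im]
  nlinarith

lemma le_norm_offset {u : ℂ} (hu : ‖u‖ ≤ 1) {s : ℝ} :
    s ≤ ‖(1 + s : ℂ) - u‖ := by
  have hre : u.re ≤ 1 := (re_le_norm u).trans hu
  refine le_trans ?_ (re_le_norm _)
  simp only [sub_re, one_re, add_re, ofReal_re]
  linarith

section Holder

variable {f : ℂ → ℂ} {a C : ℝ}

/-- A Hölder condition on the boundary propagates to the disc. -/
lemma norm_sub_le_of_holder_sphere (hc : ContinuousOn f (closedBall 0 1))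
    (hd : DifferentiableOn ℂ f (ball 0 1)) (ha : 0 < a) (hC : 0 < C)
    (h : ∀ ζ₁ ζ₂ : ℂ, ‖ζ₁‖ = 1 → ‖ζ₂‖ = 1 → ‖f ζ₁ - f ζ₂‖ ≤ C * ‖ζ₁ - ζ₂‖ ^ a)
    {z ζ : ℂ} (hz : ‖z‖ ≤ 1) (hζ : ‖ζ‖ = 1) : ‖f z - f ζ‖ ≤ C * ‖z - ζ‖ ^ a := by
  have hu : ∀ w : ℂ, ‖w‖ ≤ 1 → ‖w * (starRingEnd ℂ) ζ‖ ≤ 1 := fun w hw => by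
    rw [norm_mul, RCLike.norm_conj, hζ, mul_one]; exact hw
  have hnorm : ∀ w : ℂ, ‖1 - w * (starRingEnd ℂ) ζ‖ = ‖w - ζ‖ := fun w => by
    have h1 : ζ * (starRingEnd ℂ) ζ = 1 := by
      rw [mul_conj, normSq_eq_norm_sq, hζ]; simp
    rw [← h1, ← sub_mul, norm_mul, RCLike.norm_conj, hζ, mul_one, norm_sub_rev]
  have key : ∀ η : ℝ, 0 < η →
      ‖f z - f ζ‖ ≤ C * ‖(1 + η : ℂ) - z * (starRingEnd ℂ) ζ‖ ^ a := by
    intro η hη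
    have hslit : ∀ w : ℂ, ‖w‖ ≤ 1 → (1 + η : ℂ) - w * (starRingEnd ℂ) ζ ∈ slitPlane := by
      intro w hw
      left
      have : (w * (starRingEnd ℂ) ζ).re ≤ 1 := (re_le_norm _).trans (hu w hw)
      simp only [sub_re, one_re, add_re, ofReal_re]
      linarith
    have hpos : ∀ w : ℂ, ‖w‖ ≤ 1 → 0 < ‖(1 + η : ℂ) - w * (starRingEnd ℂ) ζ‖ := fun w hw =>
      hη.trans_le (le_norm_offset (hu w hw))
    have hbase : ∀ w : ℂ, DifferentiableAt ℂ
        (fun w => (1 + η : ℂ) - w * (starRingEnd ℂ) ζ) w := fun w => by fun_prop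
    let g : ℂ → ℂ := fun w => (f w - f ζ) / ((1 + η : ℂ) - w * (starRingEnd ℂ) ζ) ^ (a : ℂ)
    have hgn : ∀ w, ‖g w‖ = ‖f w - f ζ‖ / ‖(1 + η : ℂ) - w * (starRingEnd ℂ) ζ‖ ^ a := fun w => by
      simp only [g]
      rw [norm_div, Complex.norm_cpow_real]
    have hg : DiffContOnCl ℂ g (ball 0 1) := by
      constructor
      · intro w hw
        have hw' : ‖w‖ ≤ 1 := by simpa using (mem_ball_zero_iff.1 hw).le
        refine DifferentiableWithinAt.div ((hd w hw).sub_const _) ?_ ?_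
        · exact ((hbase w).cpow (differentiableAt_const _)
            (hslit w hw')).differentiableWithinAt
        · rw [← norm_ne_zero_iff, Complex.norm_cpow_real]
          exact (Real.rpow_pos_of_pos (hpos w hw') _).ne'
      · rw [closure_ball _ one_ne_zero]
        intro w hw
        have hw' : ‖w‖ ≤ 1 := by simpa using hw
        refine ContinuousWithinAt.div ((hc w hw).sub continuousWithinAt_const) ?_ ?_
        · exact ((hbase w).cpow (differentiableAt_const _)
            (hslit w hw')).continuousAt.continuousWithinAt
        · rw [← norm_ne_zero_iff, Complex.norm_cpow_real]
          exact (Real.rpow_pos_of_pos (hpos w hw') _).ne'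
    have hb := Complex.norm_le_of_forall_mem_frontier_norm_le isBounded_ball hg (C := C)
      (fun w hw => by
        rw [frontier_ball _ one_ne_zero, mem_sphere_zero_iff_norm] at hw
        rw [hgn, div_le_iff₀ (Real.rpow_pos_of_pos (hpos w hw.le) _)]
        refine (h w ζ hw hζ).trans ?_
        rw [← hnorm w]
        gcongr
        exact norm_one_sub_le_norm_offset (hu w hw.le) hη.le)
      (z := z) (by rw [closure_ball _ one_ne_zero]; simpa using hz)
    rwa [hgn, div_le_iff₀ (Real.rpow_pos_of_pos (hpos z hz) _)] at hb
  have hlim : Tendsto (fun η : ℝ => C * ‖(1 + η : ℂ) - z * (starRingEnd ℂ) ζ‖ ^ a) (𝓝[>] 0)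
      (𝓝 (C * ‖z - ζ‖ ^ a)) := by
    have hcont : Continuous fun η : ℝ => C * ‖(1 + η : ℂ) - z * (starRingEnd ℂ) ζ‖ ^ a := by
      refine continuous_const.mul (Continuous.rpow_const (by fun_prop) fun _ => Or.inr ha.le)
    have := hcont.tendsto 0
    rw [ofReal_zero, add_zero, hnorm] at this
    exact this.mono_left nhdsWithin_le_nhds
  exact ge_of_tendsto hlim (eventually_nhdsWithin_of_forall fun η hη => key η hη)

lemma norm_le_infDist_rpow
    (h : ∀ z ζ : ℂ, ‖z‖ ≤ 1 → ‖ζ‖ = 1 → ‖f z - f ζ‖ ≤ C * ‖z - ζ‖ ^ a)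
    {E : Set ℂ} (hE : IsClosed E) (hEs : E ⊆ sphere 0 1) (hne : E.Nonempty)
    (hfE : ∀ z ∈ E, f z = 0) {z : ℂ} (hz : ‖z‖ ≤ 1) : ‖f z‖ ≤ C * infDist z E ^ a := by
  obtain ⟨p, hp, hpd⟩ := hE.exists_infDist_eq_dist hne z
  have := h z p hz (by simpa using hEs hp)
  rwa [hfE p hp, sub_zero, ← dist_eq_norm, ← hpd] at this

lemma norm_sub_unit {z ζ : ℂ} (hζ : ‖ζ‖ = 1) (r : ℝ) (hz : z = r * ζ) (hr : r ≤ 1) :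
    ‖z - ζ‖ = 1 - r := by
  have : z - ζ = ((r - 1 : ℝ) : ℂ) * ζ := by rw [hz]; push_cast; ring
  rw [this, norm_mul, hζ, mul_one, norm_real, Real.norm_eq_abs, abs_of_nonpos (by linarith)]
  ring

lemma norm_deriv_le_of_holder (hd : DifferentiableOn ℂ f (ball 0 1)) (ha : 0 < a) (ha1 : a < 1)
    (hC : 0 < C) (h : ∀ z ζ : ℂ, ‖z‖ ≤ 1 → ‖ζ‖ = 1 → ‖f z - f ζ‖ ≤ C * ‖z - ζ‖ ^ a)
    {z : ℂ} (hz : ‖z‖ < 1) : ‖deriv f z‖ ≤ 4 * C * (1 - ‖z‖) ^ (a - 1) := by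
  obtain ⟨ζ, hζ, hzζ⟩ := exists_norm_mul_eq z
  set ρ := 1 - ‖z‖ with hρ
  have hρ0 : 0 < ρ := by linarith
  have hdist : ‖z - ζ‖ = ρ := norm_sub_unit hζ _ hzζ hz.le
  have hin : ∀ w ∈ closedBall z (ρ / 2), ‖w‖ < 1 := fun w hw => by
    have h1 : ‖w - z‖ ≤ ρ / 2 := by simpa [dist_eq_norm] using hw
    have h2 := norm_le_norm_add_norm_sub z w
    rw [norm_sub_rev] at h2
    linarith
  have hdc : DiffContOnCl ℂ (fun w => f w - f ζ) (ball z (ρ / 2)) :=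
    (hd.sub_const (f ζ)).diffContOnCl_ball fun w hw => by simpa using hin w hw
  have hb := Complex.norm_deriv_le_of_forall_mem_sphere_norm_le (half_pos hρ0) hdc
    (C := C * (2 * ρ) ^ a) (fun w hw => by
      have h1 : ‖w - z‖ = ρ / 2 := by simpa [dist_eq_norm] using hw
      refine (h w ζ (hin w (sphere_subset_closedBall hw)).le hζ).trans ?_
      have : ‖w - ζ‖ ≤ 2 * ρ := by
        have := norm_sub_le_norm_sub_add_norm_sub w z ζ
        linarith
      gcongr)
  rw [deriv_sub_const] at hb
  refine hb.trans ?_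
  rw [Real.mul_rpow (by norm_num) hρ0.le, Real.rpow_sub_one hρ0.ne']
  have h2 : (2 : ℝ) ^ a ≤ 2 := by
    calc (2 : ℝ) ^ a ≤ 2 ^ (1 : ℝ) := Real.rpow_le_rpow_of_exponent_le (by norm_num) ha1.le
      _ = 2 := by norm_num
  have h3 : 0 ≤ ρ ^ a := by positivity
  calc C * (2 ^ a * ρ ^ a) / (ρ / 2) = 2 * C * 2 ^ a * (ρ ^ a / ρ) := by field_simp
    _ ≤ 2 * C * 2 * (ρ ^ a / ρ) := by gcongr
    _ = _ := by ring

end Holder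

/-- Normalised Lebesgue measure on one period, without the factor `1 / (2π)`. -/
def arcMeasure : Measure ℝ := volume.restrict (Ioc (-Real.pi) Real.pi)

instance : IsFiniteMeasure arcMeasure := by
  unfold arcMeasure; infer_instance

/-- The point `z e^{-it}` seen from the pole `1 + s`. -/
def poleDiff (s t : ℝ) (z : ℂ) : ℂ := (1 + s : ℂ) - z * exp (-(t * I))

/-- The Herglotz kernel with pole at `(1 + s) e^{it}`. -/
def hergKernel (s t : ℝ) (z : ℂ) : ℂ := ((1 + s : ℂ) + z * exp (-(t * I))) / poleDiff s t z

/-- The derivative of `hergKernel` in the disc variable. -/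
def hergKernelDeriv (s t : ℝ) (z : ℂ) : ℂ := 2 * (1 + s : ℂ) * exp (-(t * I)) / poleDiff s t z ^ 2

/-- The superposition of Herglotz kernels with weight `W` and poles `(1 + S t) e^{it}`. -/
def herg (W S : ℝ → ℝ) (z : ℂ) : ℂ := ∫ t, (W t : ℂ) * hergKernel (S t) t z ∂arcMeasure

lemma norm_exp_neg_mul_I (t : ℝ) : ‖exp (-(t * I))‖ = 1 := by
  have := norm_exp_ofReal_mul_I (-t)
  simpa using this

lemma norm_mul_exp_neg (z : ℂ) (t : ℝ) : ‖z * exp (-(t * I))‖ = ‖z‖ := by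
  rw [norm_mul, norm_exp_neg_mul_I, mul_one]

lemma le_norm_poleDiff {z : ℂ} (hz : ‖z‖ ≤ 1) (s t : ℝ) : s ≤ ‖poleDiff s t z‖ :=
  le_norm_offset (by rwa [norm_mul_exp_neg])

lemma one_sub_le_norm_poleDiff (z : ℂ) {s : ℝ} (hs : 0 ≤ s) (t : ℝ) :
    1 - ‖z‖ ≤ ‖poleDiff s t z‖ := by
  have h1 := re_le_norm (z * exp (-(t * I)))
  rw [norm_mul_exp_neg] at h1
  refine le_trans ?_ (re_le_norm _)
  simp only [poleDiff, sub_re, one_re, add_re, ofReal_re]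
  linarith

lemma norm_one_sub_mul_exp (z : ℂ) (t : ℝ) : ‖1 - z * exp (-(t * I))‖ = ‖z - exp (t * I)‖ := by
  have h : (1 : ℂ) - z * exp (-(t * I)) = (exp (t * I) - z) * exp (-(t * I)) := by
    rw [sub_mul, ← Complex.exp_add, add_neg_cancel, Complex.exp_zero]
  rw [h, norm_mul_exp_neg, norm_sub_rev]

lemma dist_le_norm_poleDiff {z : ℂ} (hz : ‖z‖ ≤ 1) {s : ℝ} (hs : 0 ≤ s) (t : ℝ) :
    ‖z - exp (t * I)‖ ≤ ‖poleDiff s t z‖ := by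
  rw [← norm_one_sub_mul_exp]
  exact norm_one_sub_le_norm_offset (by rwa [norm_mul_exp_neg]) hs

lemma norm_poleDiff_sub (s t : ℝ) (z w : ℂ) : ‖poleDiff s t z - poleDiff s t w‖ = ‖z - w‖ := by
  have : poleDiff s t z - poleDiff s t w = (w - z) * exp (-(t * I)) := by
    simp only [poleDiff]; ring
  rw [this, norm_mul_exp_neg, norm_sub_rev]

lemma norm_poleDiff_le (z : ℂ) {s : ℝ} (hs : 0 ≤ s) (t : ℝ) :
    ‖poleDiff s t z‖ ≤ 1 + s + ‖z‖ := by
  refine (norm_sub_le _ _).trans ?_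
  rw [norm_mul_exp_neg]
  have : ‖(1 + s : ℂ)‖ = 1 + s := by
    rw [← ofReal_one, ← ofReal_add, norm_real, Real.norm_of_nonneg (by linarith)]
  rw [this]

lemma norm_one_add_ofReal {s : ℝ} (hs : 0 ≤ s) : ‖(1 + s : ℂ)‖ = 1 + s := by
  rw [← ofReal_one, ← ofReal_add, norm_real, Real.norm_of_nonneg (by linarith)]

lemma re_hergKernel (s t : ℝ) (z : ℂ) :
    (hergKernel s t z).re = ((1 + s) ^ 2 - ‖z‖ ^ 2) / ‖poleDiff s t z‖ ^ 2 := by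
  rw [hergKernel, poleDiff, ← norm_mul_exp_neg z t]
  set u := z * exp (-(t * I))
  rw [div_re, ← normSq_eq_norm_sq, ← normSq_eq_norm_sq, ← add_div]
  congr 1
  simp only [normSq_apply, sub_re, one_re, add_re, ofReal_re, sub_im, add_im, one_im, ofReal_im]
  ring

lemma norm_hergKernel_le (z : ℂ) {s : ℝ} (hs : 0 ≤ s) (t : ℝ) :
    ‖hergKernel s t z‖ ≤ (1 + s + ‖z‖) / ‖poleDiff s t z‖ := by
  rw [hergKernel, norm_div]
  gcongr
  refine (norm_add_le _ _).trans ?_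
  rw [norm_mul_exp_neg, norm_one_add_ofReal hs]

lemma norm_hergKernelDeriv (z : ℂ) {s : ℝ} (hs : 0 ≤ s) (t : ℝ) :
    ‖hergKernelDeriv s t z‖ = 2 * (1 + s) / ‖poleDiff s t z‖ ^ 2 := by
  rw [hergKernelDeriv, norm_div, norm_pow, norm_mul, norm_mul, norm_exp_neg_mul_I,
    norm_one_add_ofReal hs]
  simp

lemma hasDerivAt_hergKernel {s t : ℝ} {z : ℂ} (h : poleDiff s t z ≠ 0) :
    HasDerivAt (hergKernel s t) (hergKernelDeriv s t z) z := by
  have h1 : HasDerivAt (fun z : ℂ => (1 + s : ℂ) + z * exp (-(t * I))) (exp (-(t * I))) z := by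
    simpa using ((hasDerivAt_id z).mul_const (exp (-(t * I)))).const_add (1 + s : ℂ)
  have h2 : HasDerivAt (fun z : ℂ => poleDiff s t z) (-exp (-(t * I))) z := by
    simpa [poleDiff] using ((hasDerivAt_id z).mul_const (exp (-(t * I)))).const_sub (1 + s : ℂ)
  refine (h1.div h2 h).congr_deriv ?_
  rw [hergKernelDeriv]
  congr 1
  rw [poleDiff]; ring

section Herg

variable {W S : ℝ → ℝ}

lemma measurable_poleDiff (hS : Measurable S) (z : ℂ) :
    Measurable fun t => poleDiff (S t) t z := by
  unfold poleDiff
  fun_prop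

lemma measurable_hergKernel (hS : Measurable S) (z : ℂ) :
    Measurable fun t => hergKernel (S t) t z := by
  unfold hergKernel
  have := measurable_poleDiff hS z
  fun_prop

lemma measurable_hergKernelDeriv (hS : Measurable S) (z : ℂ) :
    Measurable fun t => hergKernelDeriv (S t) t z := by
  unfold hergKernelDeriv
  have := measurable_poleDiff hS z
  fun_prop

lemma Integrable.ofReal_mul_bdd {W : ℝ → ℝ} (hW : Integrable W arcMeasure) {k : ℝ → ℂ}
    (hk : Measurable k) {B : ℝ} (hB : ∀ t, ‖k t‖ ≤ B) :
    Integrable (fun t => (W t : ℂ) * k t) arcMeasure :=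
  hW.ofReal.mul_bdd (c := B) hk.aestronglyMeasurable (Eventually.of_forall hB)

lemma Integrable.real_mul_bdd {W : ℝ → ℝ} (hW : Integrable W arcMeasure) {k : ℝ → ℝ}
    (hk : Measurable k) {B : ℝ} (hB : ∀ t, ‖k t‖ ≤ B) :
    Integrable (fun t => W t * k t) arcMeasure :=
  hW.mul_bdd (c := B) hk.aestronglyMeasurable (Eventually.of_forall hB)

lemma norm_hergKernel_le_of_le {z : ℂ} {s t m : ℝ} (hs : 0 ≤ s) (hs4 : s ≤ 4) (hm : 0 < m)
    (h : m ≤ ‖poleDiff s t z‖) : ‖hergKernel s t z‖ ≤ (5 + ‖z‖) / m := by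
  refine (norm_hergKernel_le z hs t).trans ?_
  gcongr
  linarith

lemma norm_hergKernelDeriv_le_of_le {z : ℂ} {s t m : ℝ} (hs : 0 ≤ s) (hs4 : s ≤ 4) (hm : 0 < m)
    (h : m ≤ ‖poleDiff s t z‖) : ‖hergKernelDeriv s t z‖ ≤ 10 / m ^ 2 := by
  rw [norm_hergKernelDeriv z hs t]
  gcongr
  linarith

lemma integrable_herg (hW : Integrable W arcMeasure) (hS : Measurable S) (hS0 : ∀ t, 0 ≤ S t)
    (hS4 : ∀ t, S t ≤ 4) {z : ℂ} {m : ℝ} (hm : 0 < m) (h : ∀ t, m ≤ ‖poleDiff (S t) t z‖) :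
    Integrable (fun t => (W t : ℂ) * hergKernel (S t) t z) arcMeasure :=
  Integrable.ofReal_mul_bdd hW (measurable_hergKernel hS z)
    fun t => norm_hergKernel_le_of_le (hS0 t) (hS4 t) hm (h t)

lemma hasDerivAt_herg (hW : Integrable W arcMeasure) (hS : Measurable S) (hS0 : ∀ t, 0 ≤ S t)
    (hS4 : ∀ t, S t ≤ 4) {z : ℂ} {m : ℝ} (hm : 0 < m) (h : ∀ t, m ≤ ‖poleDiff (S t) t z‖) :
    HasDerivAt (herg W S) (∫ t, (W t : ℂ) * hergKernelDeriv (S t) t z ∂arcMeasure) z := by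
  have hnear : ∀ w ∈ ball z (m / 2), ∀ t, m / 2 ≤ ‖poleDiff (S t) t w‖ := by
    intro w hw t
    have h1 : ‖w - z‖ < m / 2 := by simpa [dist_eq_norm] using hw
    have h2 := norm_poleDiff_sub (S t) t z w
    have h3 := norm_sub_norm_le (poleDiff (S t) t z) (poleDiff (S t) t w)
    rw [h2, norm_sub_rev] at h3
    linarith [h t]
  refine (hasDerivAt_integral_of_dominated_loc_of_deriv_le
    (F := fun w t => (W t : ℂ) * hergKernel (S t) t w)
    (F' := fun w t => (W t : ℂ) * hergKernelDeriv (S t) t w)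
    (bound := fun t => |W t| * (10 / (m / 2) ^ 2)) (ball_mem_nhds z (half_pos hm))
    (Eventually.of_forall fun w => ?_) (integrable_herg hW hS hS0 hS4 hm h) ?_ ?_ ?_ ?_).2
  · exact hW.ofReal.aestronglyMeasurable.mul (measurable_hergKernel hS w).aestronglyMeasurable
  · exact hW.ofReal.aestronglyMeasurable.mul (measurable_hergKernelDeriv hS z).aestronglyMeasurable
  · refine Eventually.of_forall fun t w hw => ?_
    rw [norm_mul, norm_real, Real.norm_eq_abs]
    gcongr
    exact norm_hergKernelDeriv_le_of_le (hS0 t) (hS4 t) (half_pos hm) (hnear w hw t)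
  · exact hW.abs.mul_const _
  · refine Eventually.of_forall fun t w hw => ?_
    refine (hasDerivAt_hergKernel ?_).const_mul _
    rw [← norm_pos_iff]
    exact (half_pos hm).trans_le (hnear w hw t)

lemma re_herg (hW : Integrable W arcMeasure) (hS : Measurable S) (hS0 : ∀ t, 0 ≤ S t)
    (hS4 : ∀ t, S t ≤ 4) {z : ℂ} {m : ℝ} (hm : 0 < m) (h : ∀ t, m ≤ ‖poleDiff (S t) t z‖) :
    (herg W S z).re =
      ∫ t, W t * (((1 + S t) ^ 2 - ‖z‖ ^ 2) / ‖poleDiff (S t) t z‖ ^ 2) ∂arcMeasure := by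
  have hi := integrable_herg hW hS hS0 hS4 hm h
  rw [herg]
  refine (integral_re hi).symm.trans ?_
  refine integral_congr_ae (Eventually.of_forall fun t => ?_)
  simp only [← re_hergKernel]
  exact re_ofReal_mul _ _

lemma integrable_re_herg (hW : Integrable W arcMeasure) (hS : Measurable S) (hS0 : ∀ t, 0 ≤ S t)
    (hS4 : ∀ t, S t ≤ 4) {z : ℂ} {m : ℝ} (hm : 0 < m) (h : ∀ t, m ≤ ‖poleDiff (S t) t z‖) :
    Integrable (fun t => W t * (((1 + S t) ^ 2 - ‖z‖ ^ 2) / ‖poleDiff (S t) t z‖ ^ 2))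
      arcMeasure := by
  have := (integrable_herg hW hS hS0 hS4 hm h).re
  refine this.congr (Eventually.of_forall fun t => ?_)
  simp only [← re_hergKernel]
  exact re_ofReal_mul _ _

end Herg

lemma sq_add_sq_div_four_le_norm_poleDiff {s : ℝ} (hs : 0 ≤ s) (θ : ℝ) {t : ℝ}
    (ht : |t| ≤ Real.pi) :
    s ^ 2 + t ^ 2 / 4 ≤ ‖poleDiff s (θ + t) (exp (θ * I))‖ ^ 2 := by
  have h1 : exp (θ * I) * exp (-((θ + t : ℝ) * I)) = exp ((-t : ℝ) * I) := by
    rw [← Complex.exp_add]; congr 1; push_cast; ring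
  have h2 := Real.cos_le_one_sub_mul_cos_sq ht
  have h3 : 1 / 4 * t ^ 2 ≤ 4 / Real.pi ^ 2 * t ^ 2 := by
    gcongr ?_ * _
    rw [div_le_div_iff₀ (by norm_num) (by positivity)]
    nlinarith [Real.pi_pos, Real.pi_le_four]
  rw [poleDiff, h1, ← normSq_eq_norm_sq, normSq_apply]
  simp only [sub_re, one_re, add_re, ofReal_re, sub_im, add_im, one_im, ofReal_im,
    exp_ofReal_mul_I_re, exp_ofReal_mul_I_im, Real.cos_neg, Real.sin_neg]
  have h4 := Real.sin_sq_add_cos_sq t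
  have h5 := Real.cos_le_one t
  have h6 : 4 / Real.pi ^ 2 * t ^ 2 = 2 * (2 / Real.pi ^ 2 * t ^ 2) := by ring
  nlinarith [mul_nonneg hs (sub_nonneg.2 h5)]

lemma integral_inv_abs_add_le {b : ℝ} (hb : 0 < b) :
    ∫ t in (-Real.pi)..Real.pi, 1 / (|t| + b) = 2 * Real.log ((Real.pi + b) / b) := by
  have hcont : Continuous fun t : ℝ => 1 / (|t| + b) :=
    continuous_const.div (by fun_prop) fun t => by positivity
  have h1 : ∫ t in (0 : ℝ)..Real.pi, 1 / (|t| + b) = Real.log ((Real.pi + b) / b) := by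
    have : ∫ t in (0 : ℝ)..Real.pi, 1 / (|t| + b) = ∫ t in (0 : ℝ)..Real.pi, 1 / (t + b) := by
      refine intervalIntegral.integral_congr fun t ht => ?_
      rw [uIcc_of_le Real.pi_pos.le] at ht
      simp only [abs_of_nonneg ht.1]
    rw [this, intervalIntegral.integral_comp_add_right (fun x => 1 / x), zero_add,
      integral_one_div_of_pos hb (by positivity)]
  have h2 : ∫ t in (-Real.pi)..0, 1 / (|t| + b) = Real.log ((Real.pi + b) / b) := by
    rw [← h1]
    have := intervalIntegral.integral_comp_neg (a := 0) (b := Real.pi)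
      (fun t : ℝ => 1 / (|t| + b))
    simp only [abs_neg, neg_zero] at this
    exact this.symm
  rw [← intervalIntegral.integral_add_adjacent_intervals (b := 0)
    (hcont.intervalIntegrable _ _) (hcont.intervalIntegrable _ _), h1, h2]
  ring

lemma integral_poisson_le {a : ℝ} (ha : 0 < a) :
    ∫ t in (-Real.pi)..Real.pi, a / (a ^ 2 + t ^ 2) ≤ Real.pi := by
  have hd : ∀ t ∈ uIcc (-Real.pi) Real.pi,
      HasDerivAt (fun t => Real.arctan (t / a)) (a / (a ^ 2 + t ^ 2)) t := by
    intro t _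
    refine ((hasDerivAt_id t).div_const a).arctan.congr_deriv ?_
    simp only [id]
    field_simp
  have hcont : Continuous fun t : ℝ => a / (a ^ 2 + t ^ 2) :=
    continuous_const.div (by fun_prop) fun t => by positivity
  rw [intervalIntegral.integral_eq_sub_of_hasDerivAt hd (hcont.intervalIntegrable _ _)]
  have h1 := Real.arctan_lt_pi_div_two (Real.pi / a)
  have h2 := Real.neg_pi_div_two_lt_arctan (-Real.pi / a)
  linarith

/-- Pointwise domination of the weighted Poisson kernel. -/
lemma log_mul_poisson_le {x D t p : ℝ} (hx0 : 0 < x) (hx2 : x ≤ 2) (hD0 : 0 < D)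
    (hD2 : D ≤ 2) (hxD : |x - D| ≤ |t|) (hp : (x ^ 2) ^ 2 + t ^ 2 / 4 ≤ p) :
    Real.log (2 / x) * (((1 + x ^ 2) ^ 2 - 1) / p) ≤
      288 * (1 / (|t| + D / 2)) +
        216 * Real.log (4 / D) * (D ^ 2 / 4 / ((D ^ 2 / 4) ^ 2 + t ^ 2)) := by
  have hlog0 : 0 ≤ Real.log (2 / x) := Real.log_nonneg (by rw [le_div_iff₀ hx0]; linarith)
  have hlogD : 0 ≤ Real.log (4 / D) := Real.log_nonneg (by rw [le_div_iff₀ hD0]; linarith)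
  have hp0 : 0 < p := lt_of_lt_of_le (by positivity) hp
  have hq0 : 0 < (x ^ 2) ^ 2 + t ^ 2 := by positivity
  have hP : ((1 + x ^ 2) ^ 2 - 1) / p ≤ 24 * x ^ 2 / ((x ^ 2) ^ 2 + t ^ 2) := by
    rw [div_le_div_iff₀ hp0 hq0]
    have h0 : x ^ 2 ≤ 4 := by nlinarith
    have h1 : (1 + x ^ 2) ^ 2 - 1 ≤ 6 * x ^ 2 := by nlinarith [sq_nonneg x]
    have h2 : (x ^ 2) ^ 2 + t ^ 2 ≤ 4 * p := by nlinarith [sq_nonneg (x ^ 2)]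
    calc ((1 + x ^ 2) ^ 2 - 1) * ((x ^ 2) ^ 2 + t ^ 2) ≤ 6 * x ^ 2 * (4 * p) := by gcongr
      _ = _ := by ring
  have hnn1 : 0 ≤ 288 * (1 / (|t| + D / 2)) := by positivity
  have hnn2 : 0 ≤ 216 * Real.log (4 / D) * (D ^ 2 / 4 / ((D ^ 2 / 4) ^ 2 + t ^ 2)) := by positivity
  refine (mul_le_mul_of_nonneg_left hP hlog0).trans ?_
  have hxD' := abs_le.1 hxD
  rcases le_or_gt (D / 2) |t| with hfar | hnear
  · refine le_trans ?_ (le_add_of_nonneg_right hnn2)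
    have ht0 : 0 < |t| := by linarith
    have hxt : x ≤ 3 * |t| := by linarith
    have hlx : Real.log (2 / x) * x ≤ 2 := by
      have := Real.log_le_sub_one_of_pos (x := 2 / x) (by positivity)
      calc Real.log (2 / x) * x ≤ (2 / x - 1) * x := by gcongr
        _ = 2 - x := by field_simp
        _ ≤ 2 := by linarith
    have ht2 : t ^ 2 = |t| ^ 2 := (sq_abs t).symm
    calc Real.log (2 / x) * (24 * x ^ 2 / ((x ^ 2) ^ 2 + t ^ 2))
        ≤ Real.log (2 / x) * (24 * x ^ 2 / |t| ^ 2) := by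
          rw [ht2]; gcongr; nlinarith [sq_nonneg (x ^ 2)]
      _ = 24 * (Real.log (2 / x) * x) * x / |t| ^ 2 := by ring
      _ ≤ 24 * 2 * (3 * |t|) / |t| ^ 2 := by gcongr
      _ = 144 / |t| := by field_simp; norm_num
      _ ≤ 288 * (1 / (|t| + D / 2)) := by
          rw [mul_one_div, div_le_div_iff₀ ht0 (by linarith)]
          nlinarith
  · refine le_trans ?_ (le_add_of_nonneg_left hnn1)
    have hx1 : D / 2 ≤ x := by linarith
    have hx3 : x ≤ 3 / 2 * D := by linarith
    have hl : Real.log (2 / x) ≤ Real.log (4 / D) := by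
      apply Real.log_le_log (by positivity)
      rw [div_le_div_iff₀ hx0 hD0]; linarith
    have hs1 : D ^ 2 / 4 ≤ x ^ 2 := by nlinarith
    have hs2 : x ^ 2 ≤ 9 / 4 * D ^ 2 := by nlinarith
    calc Real.log (2 / x) * (24 * x ^ 2 / ((x ^ 2) ^ 2 + t ^ 2))
        ≤ Real.log (4 / D) * (24 * (9 / 4 * D ^ 2) / ((D ^ 2 / 4) ^ 2 + t ^ 2)) := by gcongr
      _ = _ := by ring

/-- Upper bound at the circle for the weighted Poisson integral of `log (2 / D)` when the poles
are at height `D ^ 2`. -/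
lemma integral_log_mul_poisson_le {D : ℝ → ℝ} {η : ℝ} (hη : 0 < η) (hDη : ∀ t, η ≤ D t)
    (hD2 : ∀ t, D t ≤ 2) (hlip : ∀ t x, |D (t + x) - D t| ≤ |x|)
    (hper : Function.Periodic D (2 * Real.pi)) (θ : ℝ) :
    ∫ t, Real.log (2 / D t) * (((1 + D t ^ 2) ^ 2 - 1) /
      ‖poleDiff (D t ^ 2) t (exp (θ * I))‖ ^ 2) ∂arcMeasure ≤
      3000 * (1 + Real.log (2 / D θ)) := by
  have hD0 : ∀ t, 0 < D t := fun t => hη.trans_le (hDη t)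
  have hDc : Continuous D := by
    have : LipschitzWith 1 D := LipschitzWith.of_dist_le_mul fun x y => by
      have := hlip y (x - y)
      rw [add_sub_cancel] at this
      simpa [Real.dist_eq] using this
    exact this.continuous
  set G : ℝ → ℝ := fun t => Real.log (2 / D t) * (((1 + D t ^ 2) ^ 2 - 1) /
      ‖poleDiff (D t ^ 2) t (exp (θ * I))‖ ^ 2) with hG
  have hGc : Continuous G := by
    refine Continuous.mul ?_ ?_
    · exact Continuous.log (continuous_const.div hDc fun t => (hD0 t).ne')
        fun t => (div_pos two_pos (hD0 t)).ne'
    · refine Continuous.div (by fun_prop) (by unfold poleDiff; fun_prop) fun t => ?_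
      have := le_norm_poleDiff (z := exp (θ * I)) (norm_exp_ofReal_mul_I θ).le (D t ^ 2) t
      have h0 := hD0 t
      exact (pow_pos (lt_of_lt_of_le (by positivity) this) 2).ne'
  have hGper : Function.Periodic G (2 * Real.pi) := by
    intro t
    have : exp (-(((t + 2 * Real.pi : ℝ) : ℂ) * I)) = exp (-((t : ℂ) * I)) := by
      have h := Complex.exp_periodic.sub_eq (-((t : ℂ) * I))
      rw [← h]; congr 1; push_cast; ring
    simp only [hG, poleDiff, this, hper t]
  have hpi := Real.pi_pos
  have hshift : ∫ t, G t ∂arcMeasure = ∫ t in (-Real.pi)..Real.pi, G (θ + t) := by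
    rw [intervalIntegral.integral_comp_add_left, arcMeasure,
      ← intervalIntegral.integral_of_le (by linarith)]
    have := hGper.intervalIntegral_add_eq (-Real.pi) (θ + -Real.pi)
    have e1 : -Real.pi + 2 * Real.pi = Real.pi := by ring
    have e2 : θ + -Real.pi + 2 * Real.pi = θ + Real.pi := by ring
    rwa [e1, e2] at this
  rw [hshift]
  set d := D θ with hd
  have hd0 : 0 < d := hD0 θ
  have hd2 : d ≤ 2 := hD2 θ
  have hc1 : Continuous fun t : ℝ => 1 / (|t| + d / 2) :=
    continuous_const.div (by fun_prop) fun t => by positivity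
  have hc2 : Continuous fun t : ℝ => d ^ 2 / 4 / ((d ^ 2 / 4) ^ 2 + t ^ 2) :=
    continuous_const.div (by fun_prop) fun t => by positivity
  have hle : ∫ t in (-Real.pi)..Real.pi, G (θ + t) ≤ ∫ t in (-Real.pi)..Real.pi,
      (288 * (1 / (|t| + d / 2)) +
        216 * Real.log (4 / d) * (d ^ 2 / 4 / ((d ^ 2 / 4) ^ 2 + t ^ 2))) := by
    refine intervalIntegral.integral_mono_on (by linarith)
      ((hGc.comp (continuous_const.add continuous_id)).intervalIntegrable _ _)
      (((hc1.const_mul _).add (hc2.const_mul _)).intervalIntegrable _ _) fun t ht => ?_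
    exact log_mul_poisson_le (hD0 _) (hD2 _) hd0 hd2 (hlip θ t)
      (sq_add_sq_div_four_le_norm_poleDiff (by positivity) θ (abs_le.2 ht))
  refine hle.trans ?_
  rw [intervalIntegral.integral_add ((hc1.const_mul _).intervalIntegrable _ _)
    ((hc2.const_mul _).intervalIntegrable _ _), intervalIntegral.integral_const_mul,
    intervalIntegral.integral_const_mul, integral_inv_abs_add_le (by positivity)]
  have hl0 : 0 ≤ Real.log (2 / d) := Real.log_nonneg (by rw [le_div_iff₀ hd0]; linarith)
  have hl4 : Real.log (4 / d) ≤ 1 + Real.log (2 / d) := by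
    have : (4 : ℝ) / d = 2 * (2 / d) := by ring
    rw [this, Real.log_mul (by norm_num) (by positivity)]
    linarith [Real.log_two_lt_d9]
  have hl40 : 0 ≤ Real.log (4 / d) := Real.log_nonneg (by rw [le_div_iff₀ hd0]; linarith)
  have hl8 : Real.log ((Real.pi + d / 2) / (d / 2)) ≤ 3 + Real.log (2 / d) := by
    have h1 : Real.log ((Real.pi + d / 2) / (d / 2)) ≤ Real.log (2 ^ 3 * (2 / d)) := by
      apply Real.log_le_log (by positivity)
      have := Real.pi_le_four
      rw [div_le_iff₀ (by positivity)]
      field_simp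
      linarith
    rw [Real.log_mul (by norm_num) (by positivity), Real.log_pow] at h1
    have := Real.log_two_lt_d9
    push_cast at h1
    linarith
  have hp := integral_poisson_le (a := d ^ 2 / 4) (by positivity)
  have hp4 : ∫ t in (-Real.pi)..Real.pi, d ^ 2 / 4 / ((d ^ 2 / 4) ^ 2 + t ^ 2) ≤ 4 :=
    hp.trans Real.pi_le_four
  have := mul_le_mul_of_nonneg_left hp4 (by positivity : 0 ≤ 216 * Real.log (4 / d))
  linarith

/-- Distance to `E` of the point `e^{it}`. -/
def arcDist (E : Set ℂ) (t : ℝ) : ℝ := infDist (exp (t * I)) E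

/-- The Carleson weight `log (2 / dist(e^{it}, E))`. -/
def arcLog (E : Set ℂ) (t : ℝ) : ℝ := Real.log (2 / arcDist E t)

/-- The weighted Poisson-type energy controlling the size of functions vanishing on `E`. -/
def arcEnergy (E : Set ℂ) (z : ℂ) : ℝ :=
  ∫ t, arcLog E t * (1 / ‖poleDiff (arcDist E t) t z‖ ^ 2) ∂arcMeasure

section ArcDist

variable {E : Set ℂ}

lemma arcDist_nonneg (t : ℝ) : 0 ≤ arcDist E t := infDist_nonneg

lemma infDist_le_norm_add_one (hEs : E ⊆ sphere 0 1) (hne : E.Nonempty) (z : ℂ) :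
    infDist z E ≤ ‖z‖ + 1 := by
  obtain ⟨p, hp⟩ := hne
  refine (infDist_le_dist_of_mem hp).trans ?_
  rw [dist_eq_norm]
  have : ‖p‖ = 1 := by simpa using hEs hp
  exact this ▸ norm_sub_le z p

lemma one_sub_norm_le_infDist (hEs : E ⊆ sphere 0 1) (hne : E.Nonempty) (z : ℂ) :
    1 - ‖z‖ ≤ infDist z E := by
  refine (le_infDist hne).2 fun {p} hp => ?_
  have : ‖p‖ = 1 := by simpa using hEs hp
  rw [dist_eq_norm, ← this, norm_sub_rev]
  exact norm_sub_norm_le p z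

lemma arcDist_le_two (hEs : E ⊆ sphere 0 1) (hne : E.Nonempty) (t : ℝ) : arcDist E t ≤ 2 := by
  have := infDist_le_norm_add_one hEs hne (exp (t * I))
  rw [norm_exp_ofReal_mul_I] at this
  unfold arcDist
  linarith

lemma abs_infDist_sub_arcDist_le (z : ℂ) (t : ℝ) :
    |infDist z E - arcDist E t| ≤ ‖z - exp (t * I)‖ := by
  rw [← dist_eq_norm, abs_le]
  have h1 := infDist_le_infDist_add_dist (s := E) (x := z) (y := exp (t * I))
  have h2 := infDist_le_infDist_add_dist (s := E) (x := exp (t * I)) (y := z)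
  rw [dist_comm] at h2
  unfold arcDist
  constructor <;> linarith

lemma norm_exp_add_sub_le (t x : ℝ) : ‖exp ((t + x : ℝ) * I) - exp (t * I)‖ ≤ |x| := by
  have h : exp ((t + x : ℝ) * I) - exp (t * I) = (exp (x * I) - 1) * exp (t * I) := by
    rw [ofReal_add, add_mul, Complex.exp_add]; ring
  rw [h, norm_mul, norm_exp_ofReal_mul_I, mul_one]
  exact norm_exp_sub_one_le x

lemma abs_arcDist_add_sub_le (t x : ℝ) : |arcDist E (t + x) - arcDist E t| ≤ |x| :=
  (abs_infDist_sub_arcDist_le (exp ((t + x : ℝ) * I)) t).trans (norm_exp_add_sub_le t x)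

lemma continuous_arcDist : Continuous (arcDist E) :=
  (continuous_infDist_pt E).comp (by fun_prop)

lemma periodic_arcDist : Function.Periodic (arcDist E) (2 * Real.pi) := by
  intro t
  have : exp (((t + 2 * Real.pi : ℝ) : ℂ) * I) = exp ((t : ℂ) * I) := by
    rw [← Complex.exp_periodic ((t : ℂ) * I)]; congr 1; push_cast; ring
  simp only [arcDist, this]

lemma arcLog_nonneg (hEs : E ⊆ sphere 0 1) (hne : E.Nonempty) (t : ℝ) : 0 ≤ arcLog E t := by
  rcases (arcDist_nonneg (E := E) t).eq_or_lt with h | h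
  · simp [arcLog, ← h]
  · exact Real.log_nonneg (by rw [le_div_iff₀ h]; linarith [arcDist_le_two hEs hne t])

lemma measurable_arcDist : Measurable (arcDist E) := continuous_arcDist.measurable

lemma infDist_le_two_mul_norm_poleDiff {z : ℂ} (hz : ‖z‖ ≤ 1) (t : ℝ) :
    infDist z E ≤ 2 * ‖poleDiff (arcDist E t) t z‖ := by
  have h1 := (abs_le.1 (abs_infDist_sub_arcDist_le (E := E) z t)).2
  have h2 := dist_le_norm_poleDiff hz (arcDist_nonneg (E := E) t) t
  have h3 := le_norm_poleDiff hz (arcDist E t) t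
  linarith

lemma measurable_norm_poleDiff_arcDist (z : ℂ) :
    Measurable fun t => ‖poleDiff (arcDist E t) t z‖ :=
  (measurable_poleDiff measurable_arcDist z).norm

lemma integrable_arcEnergy (hL : Integrable (arcLog E) arcMeasure) {z : ℂ} {m : ℝ}
    (hm : 0 < m) (h : ∀ t, m ≤ ‖poleDiff (arcDist E t) t z‖) :
    Integrable (fun t => arcLog E t * (1 / ‖poleDiff (arcDist E t) t z‖ ^ 2)) arcMeasure := by
  refine Integrable.real_mul_bdd hL ?_ (B := 1 / m ^ 2) fun t => ?_
  · exact ((measurable_norm_poleDiff_arcDist z).pow_const 2).const_div 1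
  · rw [Real.norm_of_nonneg (by positivity)]
    gcongr
    exact h t

/-- The regularised distance `max (dist(e^{it}, E)) η`. -/
def regDist (E : Set ℂ) (η t : ℝ) : ℝ := max (arcDist E t) η

lemma continuous_regDist (η : ℝ) : Continuous (regDist E η) :=
  continuous_arcDist.max continuous_const

lemma abs_regDist_add_sub_le (η t x : ℝ) : |regDist E η (t + x) - regDist E η t| ≤ |x| :=
  (abs_max_sub_max_le_abs _ _ _).trans (abs_arcDist_add_sub_le t x)

lemma regDist_le_two (hEs : E ⊆ sphere 0 1) (hne : E.Nonempty) {η : ℝ} (hη : η ≤ 1) (t : ℝ) :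
    regDist E η t ≤ 2 := max_le (arcDist_le_two hEs hne t) (by linarith)

lemma regDist_pos {η : ℝ} (hη : 0 < η) (t : ℝ) : 0 < regDist E η t :=
  hη.trans_le (le_max_right _ _)

lemma integrable_log_regDist {η : ℝ} (hη : 0 < η) :
    Integrable (fun t => Real.log (2 / regDist E η t)) arcMeasure := by
  have : Continuous fun t => Real.log (2 / regDist E η t) :=
    Continuous.log (continuous_const.div (continuous_regDist η) fun t => (regDist_pos hη t).ne')
      fun t => (div_pos two_pos (regDist_pos hη t)).ne'
  exact this.integrableOn_Ioc

lemma regDist_sq_le_four (hEs : E ⊆ sphere 0 1) (hne : E.Nonempty) {η : ℝ} (hη : 0 < η)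
    (hη1 : η ≤ 1) (t : ℝ) : regDist E η t ^ 2 ≤ 4 := by
  have h1 := regDist_le_two hEs hne hη1 t
  have h2 := regDist_pos (E := E) hη t
  nlinarith

lemma sq_le_norm_poleDiff_regDist {η : ℝ} (hη : 0 < η) {z : ℂ} (hz : ‖z‖ ≤ 1) (t : ℝ) :
    η ^ 2 ≤ ‖poleDiff (regDist E η t ^ 2) t z‖ := by
  refine le_trans ?_ (le_norm_poleDiff hz _ t)
  have : η ≤ regDist E η t := le_max_right _ _
  gcongr

/-- The regularised outer exponent. -/
def regHerg (E : Set ℂ) (η : ℝ) : ℂ → ℂ :=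
  herg (fun t => Real.log (2 / regDist E η t)) (fun t => regDist E η t ^ 2)

lemma re_regHerg (hEs : E ⊆ sphere 0 1) (hne : E.Nonempty) {η : ℝ} (hη : 0 < η)
    (hη1 : η ≤ 1) {z : ℂ} (hz : ‖z‖ ≤ 1) : (regHerg E η z).re =
      ∫ t, Real.log (2 / regDist E η t) * (((1 + regDist E η t ^ 2) ^ 2 - ‖z‖ ^ 2) /
        ‖poleDiff (regDist E η t ^ 2) t z‖ ^ 2) ∂arcMeasure :=
  re_herg (integrable_log_regDist hη) ((continuous_regDist η).pow 2).measurable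
    (fun _ => sq_nonneg _) (regDist_sq_le_four hEs hne hη hη1) (pow_pos hη 2)
    (sq_le_norm_poleDiff_regDist hη hz)

lemma norm_le_exp_neg_regHerg (hEs : E ⊆ sphere 0 1) (hne : E.Nonempty) {f : ℂ → ℂ} {a C : ℝ}
    (ha : 0 < a) (hC : 0 < C) (hc : ContinuousOn f (closedBall 0 1))
    (hd : DifferentiableOn ℂ f (ball 0 1)) (hf : ∀ z : ℂ, ‖z‖ ≤ 1 → ‖f z‖ ≤ C * infDist z E ^ a)
    {η : ℝ} (hη : 0 < η) (hη1 : η ≤ 1) {z : ℂ} (hz : ‖z‖ ≤ 1) :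
    ‖f z‖ ≤ C * (2 ^ a * Real.exp a) * Real.exp (-(a / 3000 * (regHerg E η z).re)) := by
  have hdh : ∀ w : ℂ, ‖w‖ ≤ 1 → DifferentiableAt ℂ (regHerg E η) w := fun w hw =>
    (hasDerivAt_herg (integrable_log_regDist hη) ((continuous_regDist η).pow 2).measurable
      (fun _ => sq_nonneg _) (regDist_sq_le_four hEs hne hη hη1) (pow_pos hη 2)
      (sq_le_norm_poleDiff_regDist hη hw)).differentiableAt
  let c : ℝ := a / 3000
  let g : ℂ → ℂ := fun w => f w * exp (c * regHerg E η w)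
  have hgn : ∀ w, ‖g w‖ = ‖f w‖ * Real.exp (c * (regHerg E η w).re) := fun w => by
    simp only [g]
    rw [norm_mul, Complex.norm_exp, re_ofReal_mul]
  have hg : DiffContOnCl ℂ g (ball 0 1) := by
    constructor
    · intro w hw
      have hw' : ‖w‖ ≤ 1 := (mem_ball_zero_iff.1 hw).le
      exact (hd w hw).mul ((hdh w hw').const_mul _).cexp.differentiableWithinAt
    · rw [closure_ball _ one_ne_zero]
      intro w hw
      have hw' : ‖w‖ ≤ 1 := by simpa using hw
      exact (hc w hw).mul ((hdh w hw').const_mul _).cexp.continuousAt.continuousWithinAt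
  have hb := Complex.norm_le_of_forall_mem_frontier_norm_le isBounded_ball hg
    (C := C * (2 ^ a * Real.exp a)) (fun w hw => by
      rw [frontier_ball _ one_ne_zero, mem_sphere_zero_iff_norm] at hw
      have hwθ : w = exp (arg w * I) := by
        have := (norm_mul_exp_arg_mul_I w).symm
        rwa [hw, ofReal_one, one_mul] at this
      set θ := arg w with hθ
      have hre : (regHerg E η w).re ≤ 3000 * (1 + Real.log (2 / regDist E η θ)) := by
        rw [re_regHerg hEs hne hη hη1 hw.le, hw, one_pow, hwθ]
        exact integral_log_mul_poisson_le hη (fun _ => le_max_right _ _)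
          (regDist_le_two hEs hne hη1) (abs_regDist_add_sub_le η)
          (fun t => by simp only [periodic_arcDist (E := E) t]) θ
      set D := regDist E η θ with hD
      have hD0 : 0 < D := regDist_pos hη θ
      have hfD : ‖f w‖ ≤ C * D ^ a := by
        refine (hf w hw.le).trans ?_
        have : infDist w E ≤ D := by
          rw [hwθ]; exact le_max_left _ _
        have h0 : 0 ≤ infDist w E := infDist_nonneg
        gcongr
      have hexp : Real.exp (c * (regHerg E η w).re) ≤ Real.exp a * (2 / D) ^ a := by
        rw [Real.rpow_def_of_pos (by positivity), ← Real.exp_add, Real.exp_le_exp]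
        calc c * (regHerg E η w).re ≤ c * (3000 * (1 + Real.log (2 / D))) := by
              gcongr
          _ = _ := by simp only [c]; ring
      rw [hgn]
      calc ‖f w‖ * Real.exp (c * (regHerg E η w).re)
          ≤ C * D ^ a * (Real.exp a * (2 / D) ^ a) := by gcongr
        _ = _ := by
          rw [Real.div_rpow (by norm_num) hD0.le]
          have : 0 < D ^ a := by positivity
          field_simp)
    (z := z) (by rw [closure_ball _ one_ne_zero]; simpa using hz)
  rw [hgn] at hb
  rw [Real.exp_neg, ← div_eq_mul_inv, le_div_iff₀ (Real.exp_pos _)]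
  exact hb

end ArcDist

section Decay

variable {E : Set ℂ} {f : ℂ → ℂ} {M c : ℝ}

/-- If the zero set on the circle had positive measure the function would vanish. -/
lemma eq_zero_of_arcMeasure_ne_zero (hEs : E ⊆ sphere 0 1) (hne : E.Nonempty) (hc : 0 < c)
    (h : ∀ η : ℝ, 0 < η → η ≤ 1 → ∀ z : ℂ, ‖z‖ ≤ 1 →
      ‖f z‖ ≤ M * Real.exp (-(c * (regHerg E η z).re)))
    (hM : 0 ≤ M) (hpos : arcMeasure {t | arcDist E t = 0} ≠ 0) {z : ℂ} (hz : ‖z‖ < 1) :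
    f z = 0 := by
  set Z := {t | arcDist E t = 0} with hZ
  have hZm : MeasurableSet Z := measurable_arcDist (measurableSet_singleton 0)
  set v := arcMeasure.real Z with hv
  have hv0 : 0 < v := ENNReal.toReal_pos hpos (measure_ne_top _ _)
  have hρ : 0 < 1 - ‖z‖ ^ 2 := by nlinarith [norm_nonneg z]
  have hre : ∀ η : ℝ, 0 < η → η ≤ 1 →
      Real.log (2 / η) * ((1 - ‖z‖ ^ 2) / 9) * v ≤ (regHerg E η z).re := by
    intro η hη hη1
    have hint : Integrable (fun t => Real.log (2 / regDist E η t) *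
        (((1 + regDist E η t ^ 2) ^ 2 - ‖z‖ ^ 2) / ‖poleDiff (regDist E η t ^ 2) t z‖ ^ 2))
        arcMeasure :=
      integrable_re_herg (integrable_log_regDist hη) ((continuous_regDist η).pow 2).measurable
        (fun _ => sq_nonneg _) (regDist_sq_le_four hEs hne hη hη1) (pow_pos hη 2)
        (sq_le_norm_poleDiff_regDist hη hz.le)
    rw [re_regHerg hEs hne hη hη1 hz.le]
    have : Real.log (2 / η) * ((1 - ‖z‖ ^ 2) / 9) * v =
        ∫ t, Z.indicator (fun _ => Real.log (2 / η) * ((1 - ‖z‖ ^ 2) / 9)) t ∂arcMeasure := by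
      rw [integral_indicator_const _ hZm, smul_eq_mul, mul_comm]
    rw [this]
    refine integral_mono ((integrable_const _).indicator hZm) hint fun t => ?_
    have hD0 := regDist_pos (E := E) hη t
    have hD2 := regDist_le_two hEs hne hη1 t
    have hlog : 0 ≤ Real.log (2 / regDist E η t) :=
      Real.log_nonneg (by rw [le_div_iff₀ hD0]; linarith)
    have hnum : 1 - ‖z‖ ^ 2 ≤ (1 + regDist E η t ^ 2) ^ 2 - ‖z‖ ^ 2 := by
      nlinarith [sq_nonneg (regDist E η t)]
    by_cases ht : t ∈ Z
    · rw [indicator_of_mem ht]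
      have hDη : regDist E η t = η := by
        have : arcDist E t = 0 := ht
        simp only [regDist, this]
        exact max_eq_right hη.le
      simp only [hDη] at *
      have hp : ‖poleDiff (η ^ 2) t z‖ ≤ 3 := by
        have := norm_poleDiff_le z (sq_nonneg η) t
        nlinarith
      have hp0 : 0 < ‖poleDiff (η ^ 2) t z‖ :=
        lt_of_lt_of_le (pow_pos hη 2) (le_norm_poleDiff hz.le _ t)
      have hn0 := hρ.le.trans hnum
      gcongr
      nlinarith
    · rw [indicator_of_notMem ht]
      have : 0 ≤ (1 + regDist E η t ^ 2) ^ 2 - ‖z‖ ^ 2 := hρ.le.trans hnum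
      positivity
  set κ := c * ((1 - ‖z‖ ^ 2) / 9 * v) with hκ
  have hκ0 : 0 < κ := by positivity
  have hbound : ∀ x : ℝ, 1 ≤ x → ‖f z‖ ≤ M * Real.exp (-(κ * x)) := by
    intro x hx
    have he : Real.exp (-x) ≤ 1 / 2 := by
      rw [Real.exp_neg, inv_eq_one_div]
      exact one_div_le_one_div_of_le two_pos (by linarith [Real.add_one_le_exp x])
    have hη0 : 0 < 2 * Real.exp (-x) := by positivity
    refine (h _ hη0 (by linarith) z hz.le).trans ?_
    have h1 := hre _ hη0 (by linarith)
    have h2 : Real.log (2 / (2 * Real.exp (-x))) = x := by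
      rw [Real.exp_neg]
      field_simp
      exact Real.log_exp x
    rw [h2] at h1
    have h3 : κ * x ≤ c * (regHerg E (2 * Real.exp (-x)) z).re := by
      calc κ * x = c * (x * ((1 - ‖z‖ ^ 2) / 9) * v) := by rw [hκ]; ring
        _ ≤ _ := by gcongr
    gcongr
  have hlim : Tendsto (fun x : ℝ => M * Real.exp (-(κ * x))) atTop (𝓝 (M * 0)) :=
    (Real.tendsto_exp_neg_atTop_nhds_zero.comp (tendsto_id.const_mul_atTop hκ0)).const_mul M
  rw [mul_zero] at hlim
  have := ge_of_tendsto hlim ((eventually_ge_atTop 1).mono hbound)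
  exact norm_le_zero_iff.1 this

/-- Exponential decay of `f` governed by the energy of `E`. -/
lemma norm_le_exp_neg_arcEnergy (hEs : E ⊆ sphere 0 1) (hne : E.Nonempty) (hc : 0 < c)
    (hL : Integrable (arcLog E) arcMeasure)
    (h : ∀ η : ℝ, 0 < η → η ≤ 1 → ∀ z : ℂ, ‖z‖ ≤ 1 →
      ‖f z‖ ≤ M * Real.exp (-(c * (regHerg E η z).re)))
    (hM : 0 ≤ M) {z : ℂ} (hz : ‖z‖ < 1) :
    ‖f z‖ ≤ M * Real.exp (-(c / 4 * (1 - ‖z‖) * arcEnergy E z)) := by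
  set ρ := 1 - ‖z‖ with hρ
  have hρ0 : 0 < ρ := by linarith
  let F : ℝ → ℝ := fun t => arcLog E t * (1 / ‖poleDiff (arcDist E t) t z‖ ^ 2)
  have hFi : Integrable F arcMeasure := integrable_arcEnergy hL hρ0
    fun t => one_sub_le_norm_poleDiff z (arcDist_nonneg t) t
  have hF0 : ∀ t, 0 ≤ F t := fun t =>
    mul_nonneg (arcLog_nonneg hEs hne t) (by positivity)
  let A : ℕ → Set ℝ := fun n => {t | 1 / ((n : ℝ) + 1) ≤ arcDist E t}
  have hAm : ∀ n, MeasurableSet (A n) := fun n => measurableSet_le measurable_const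
    measurable_arcDist
  have hlow : ∀ n : ℕ, ρ / 4 * ∫ t, (A n).indicator F t ∂arcMeasure ≤
      (regHerg E (1 / ((n : ℝ) + 1)) z).re := by
    intro n
    set η : ℝ := 1 / ((n : ℝ) + 1) with hηd
    have hη : 0 < η := by positivity
    have hη1 : η ≤ 1 := by
      rw [hηd, div_le_one (by positivity)]; linarith [(Nat.cast_nonneg n : (0 : ℝ) ≤ n)]
    rw [re_regHerg hEs hne hη hη1 hz.le, ← integral_const_mul]
    refine integral_mono ((hFi.indicator (hAm n)).const_mul _)
      (integrable_re_herg (integrable_log_regDist hη) ((continuous_regDist η).pow 2).measurable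
        (fun _ => sq_nonneg _) (regDist_sq_le_four hEs hne hη hη1) (pow_pos hη 2)
        (sq_le_norm_poleDiff_regDist hη hz.le)) fun t => ?_
    have hD0 := regDist_pos (E := E) hη t
    have hD2 := regDist_le_two hEs hne hη1 t
    have hlog : 0 ≤ Real.log (2 / regDist E η t) :=
      Real.log_nonneg (by rw [le_div_iff₀ hD0]; linarith)
    have hnum : ρ ≤ (1 + regDist E η t ^ 2) ^ 2 - ‖z‖ ^ 2 := by
      nlinarith [sq_nonneg (regDist E η t), norm_nonneg z]
    by_cases ht : t ∈ A n
    · simp only [indicator_of_mem ht]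
      have hd : regDist E η t = arcDist E t := max_eq_left ht
      simp only [hd] at *
      set d := arcDist E t with hdd
      have hm0 : d ≤ ‖poleDiff d t z‖ := le_norm_poleDiff hz.le d t
      have hp0 : 0 < ‖poleDiff (d ^ 2) t z‖ :=
        lt_of_lt_of_le (pow_pos hD0 2) (le_norm_poleDiff hz.le _ t)
      have hp : ‖poleDiff (d ^ 2) t z‖ ≤ 2 * ‖poleDiff d t z‖ := by
        have e : poleDiff (d ^ 2) t z = poleDiff d t z + ((d ^ 2 - d : ℝ) : ℂ) := by
          simp only [poleDiff]; push_cast; ring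
        rw [e]
        refine (norm_add_le _ _).trans ?_
        rw [norm_real, Real.norm_eq_abs]
        have : |d ^ 2 - d| ≤ d := abs_le.2 ⟨by nlinarith, by nlinarith⟩
        linarith
      have hmpos : 0 < ‖poleDiff d t z‖ := hD0.trans_le hm0
      show ρ / 4 * (Real.log (2 / d) * (1 / ‖poleDiff d t z‖ ^ 2)) ≤ _
      have hn0 := hρ0.le.trans hnum
      calc ρ / 4 * (Real.log (2 / d) * (1 / ‖poleDiff d t z‖ ^ 2))
          = Real.log (2 / d) * (ρ / (2 * ‖poleDiff d t z‖) ^ 2) := by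
            field_simp; norm_num
        _ ≤ _ := by gcongr
    · simp only [indicator_of_notMem ht, mul_zero]
      have : 0 ≤ (1 + regDist E η t ^ 2) ^ 2 - ‖z‖ ^ 2 := hρ0.le.trans hnum
      positivity
  have hlim : Tendsto (fun n => ∫ t, (A n).indicator F t ∂arcMeasure) atTop
      (𝓝 (∫ t, F t ∂arcMeasure)) := by
    refine tendsto_integral_of_dominated_convergence F
      (fun n => (hFi.indicator (hAm n)).aestronglyMeasurable) hFi (fun n => ?_) ?_
    · refine Eventually.of_forall fun t => ?_
      rw [Real.norm_of_nonneg (indicator_nonneg (fun t _ => hF0 t) t)]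
      exact indicator_le_self' (fun t _ => hF0 t) t
    · refine Eventually.of_forall fun t => ?_
      rcases (arcDist_nonneg (E := E) t).eq_or_lt with hd | hd
      · have hz0 : F t = 0 := by simp [F, arcLog, ← hd]
        have : ∀ n, (A n).indicator F t = 0 := fun n => by
          rw [indicator_apply]; split_ifs <;> simp [hz0]
        simp [this, hz0]
      · obtain ⟨N, hN⟩ := exists_nat_one_div_lt hd
        refine tendsto_const_nhds.congr' ((eventually_ge_atTop N).mono fun n hn => ?_)
        refine (indicator_of_mem (?_ : t ∈ A n) F).symm
        refine le_trans ?_ hN.le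
        gcongr
  have hlim2 : Tendsto (fun n => M * Real.exp (-(c * (ρ / 4 *
      ∫ t, (A n).indicator F t ∂arcMeasure)))) atTop
      (𝓝 (M * Real.exp (-(c * (ρ / 4 * ∫ t, F t ∂arcMeasure))))) :=
    ((Real.continuous_exp.tendsto _).comp ((hlim.const_mul _).const_mul _).neg).const_mul M
  have hfin := ge_of_tendsto' hlim2 (b := ‖f z‖) fun n => by
    have hη1 : 1 / ((n : ℝ) + 1) ≤ 1 := by
      rw [div_le_one (by positivity)]; linarith [(Nat.cast_nonneg n : (0 : ℝ) ≤ n)]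
    refine (h _ (by positivity) hη1 z hz.le).trans ?_
    have := hlow n
    gcongr
  refine hfin.trans (le_of_eq ?_)
  simp only [arcEnergy]
  congr 3
  ring

end Decay

lemma exists_exp_neg_le_rpow {κ : ℝ} (hκ : 0 < κ) (p : ℝ) :
    ∃ K > 0, ∀ x : ℝ, 1 ≤ x → Real.exp (-(κ * x)) ≤ K * x ^ (-p) := by
  obtain ⟨n, hn⟩ := exists_nat_ge p
  refine ⟨n.factorial / κ ^ n, by positivity, fun x hx => ?_⟩
  have hx0 : 0 < x := by linarith
  have h1 := Real.pow_div_factorial_le_exp (κ * x) (by positivity) n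
  have h2 : x ^ p ≤ x ^ n := by
    rw [← Real.rpow_natCast]
    exact Real.rpow_le_rpow_of_exponent_le hx hn
  rw [Real.exp_neg, Real.rpow_neg hx0.le, ← div_eq_mul_inv, inv_eq_one_div,
    div_le_div_iff₀ (Real.exp_pos _) (Real.rpow_pos_of_pos hx0 _), one_mul]
  rw [mul_pow, div_le_iff₀ (by positivity)] at h1
  rw [div_mul_eq_mul_div, le_div_iff₀ (by positivity)]
  calc x ^ p * κ ^ n ≤ x ^ n * κ ^ n := by gcongr
    _ = κ ^ n * x ^ n := mul_comm _ _
    _ ≤ _ := by linarith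

lemma min_mul_rpow_neg_le {ρ Q β : ℝ} (hρ : 0 < ρ) (hQ : 0 < Q) (hβ0 : 0 < β) (hβ1 : β < 1) :
    min (1 / ρ) Q * Q ^ (-β) ≤ ρ ^ (β - 1) := by
  have e : ρ ^ (β - 1) = (1 / ρ) ^ (1 - β) := by
    rw [one_div, Real.inv_rpow hρ.le, ← Real.rpow_neg hρ.le]; congr 1; ring
  rw [e]
  have hi : 0 < 1 / ρ := by positivity
  rcases le_total Q (1 / ρ) with h | h
  · rw [min_eq_right h]
    calc Q * Q ^ (-β) = Q ^ (1 - β) := by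
          rw [sub_eq_add_neg, Real.rpow_add hQ, Real.rpow_one]
      _ ≤ _ := Real.rpow_le_rpow hQ.le h (by linarith)
  · rw [min_eq_left h, sub_eq_add_neg, Real.rpow_add hi, Real.rpow_one]
    gcongr 1 / ρ * ?_
    exact Real.rpow_le_rpow_of_nonpos hi h (by linarith)

section Energy

variable {E : Set ℂ} {f : ℂ → ℂ} {M c C a β : ℝ}

lemma arcEnergy_nonneg (hEs : E ⊆ sphere 0 1) (hne : E.Nonempty) (z : ℂ) : 0 ≤ arcEnergy E z :=
  integral_nonneg fun t => mul_nonneg (arcLog_nonneg hEs hne t) (by positivity)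

lemma arcEnergy_le_of_near (hEs : E ⊆ sphere 0 1) (hne : E.Nonempty)
    (hL : Integrable (arcLog E) arcMeasure) {z z' : ℂ} (hz : ‖z‖ < 1) (hz' : ‖z'‖ < 1)
    (hzz : ‖z - z'‖ ≤ infDist z E) : arcEnergy E z ≤ 9 * arcEnergy E z' := by
  rw [arcEnergy, arcEnergy, ← integral_const_mul]
  have hi : ∀ w : ℂ, ‖w‖ < 1 →
      Integrable (fun t => arcLog E t * (1 / ‖poleDiff (arcDist E t) t w‖ ^ 2)) arcMeasure :=
    fun w hw => integrable_arcEnergy hL (sub_pos.2 hw)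
      fun t => one_sub_le_norm_poleDiff w (arcDist_nonneg t) t
  refine integral_mono (hi z hz) ((hi z' hz').const_mul 9) fun t => ?_
  have h0 : 0 < ‖poleDiff (arcDist E t) t z‖ :=
    (sub_pos.2 hz).trans_le (one_sub_le_norm_poleDiff z (arcDist_nonneg t) t)
  have h0' : 0 < ‖poleDiff (arcDist E t) t z'‖ :=
    (sub_pos.2 hz').trans_le (one_sub_le_norm_poleDiff z' (arcDist_nonneg t) t)
  have h1 : ‖poleDiff (arcDist E t) t z'‖ ≤ 3 * ‖poleDiff (arcDist E t) t z‖ := by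
    have h2 := norm_poleDiff_sub (arcDist E t) t z' z
    have h3 := norm_sub_norm_le (poleDiff (arcDist E t) t z') (poleDiff (arcDist E t) t z)
    rw [h2, norm_sub_rev] at h3
    linarith [infDist_le_two_mul_norm_poleDiff (E := E) hz.le t]
  have hl := arcLog_nonneg hEs hne t
  show arcLog E t * _ ≤ 9 * (arcLog E t * _)
  rw [mul_left_comm]
  gcongr
  rw [mul_one_div, div_le_div_iff₀ (by positivity) (by positivity)]
  nlinarith

lemma norm_mul_min_arcEnergy_le (hEs : E ⊆ sphere 0 1) (hne : E.Nonempty)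
    (hL : Integrable (arcLog E) arcMeasure) (hβ0 : 0 < β) (hβa : β < a) (ha1 : a < 1)
    (hC : 0 < C) (hM : 0 < M) (hc : 0 < c)
    (hf : ∀ z : ℂ, ‖z‖ ≤ 1 → ‖f z‖ ≤ C * infDist z E ^ a)
    (hdecay : ∀ z : ℂ, ‖z‖ < 1 → ‖f z‖ ≤ M * Real.exp (-(c * (1 - ‖z‖) * arcEnergy E z)))
    (hhol : ∀ z ζ : ℂ, ‖z‖ ≤ 1 → ‖ζ‖ = 1 → ‖f z - f ζ‖ ≤ C * ‖z - ζ‖ ^ a) :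
    ∃ C' > 0, ∀ z : ℂ, ‖z‖ < 1 →
      ‖f z‖ * min (1 / (1 - ‖z‖)) (arcEnergy E z) ≤ C' * (1 - ‖z‖) ^ (β - 1) := by
  have ha0 : 0 < a := hβ0.trans hβa
  set γ := β / a with hγ
  have hγ1 : γ < 1 := (div_lt_one ha0).2 hβa
  have hγ0 : 0 < γ := div_pos hβ0 ha0
  obtain ⟨K, hK, hexp⟩ := exists_exp_neg_le_rpow (κ := c / 9) (by positivity) (β / (1 - γ))
  refine ⟨M + (M * K + 2 * C), by positivity, fun z hz => ?_⟩
  set Q := arcEnergy E z with hQ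
  set ρ := 1 - ‖z‖ with hρ
  have hρ0 : 0 < ρ := by linarith
  have hρ1 : ρ ≤ 1 := by linarith [norm_nonneg z]
  have hQ0 : 0 ≤ Q := arcEnergy_nonneg hEs hne z
  have hpow : 0 ≤ ρ ^ (β - 1) := by positivity
  rcases le_or_gt Q 1 with hQ1 | hQ1
  · have h1 : ‖f z‖ ≤ M := by
      refine (hdecay z hz).trans (mul_le_of_le_one_right hM.le ?_)
      rw [Real.exp_le_one_iff]
      have : 0 ≤ c * ρ * Q := by positivity
      linarith
    have h2 : 1 ≤ ρ ^ (β - 1) := Real.one_le_rpow_of_pos_of_le_one_of_nonpos hρ0 hρ1 (by linarith)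
    calc ‖f z‖ * min (1 / ρ) Q ≤ M * 1 := by
          gcongr
          exact (min_le_right _ _).trans hQ1
      _ ≤ (M + (M * K + 2 * C)) * ρ ^ (β - 1) := by
          gcongr
          linarith [mul_pos hM hK]
  have hQp : 0 < Q := by linarith
  set τ := Q ^ (-γ) with hτ
  have hτ0 : 0 < τ := Real.rpow_pos_of_pos hQp _
  have hτ1 : τ < 1 := Real.rpow_lt_one_of_one_lt_of_neg hQ1 (by linarith)
  have hτa : τ ^ a = Q ^ (-β) := by
    rw [hτ, ← Real.rpow_mul hQp.le]; congr 1; rw [hγ]; field_simp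
  have hτQ : τ * Q = Q ^ (1 - γ) := by
    rw [sub_eq_add_neg, Real.rpow_add hQp, Real.rpow_one, mul_comm]
  have hexpQ : Real.exp (-(c / 9 * (τ * Q))) ≤ K * Q ^ (-β) := by
    have h1 := hexp (Q ^ (1 - γ)) (Real.one_le_rpow hQ1.le (by linarith))
    have h2 : (Q ^ (1 - γ)) ^ (-(β / (1 - γ))) = Q ^ (-β) := by
      rw [← Real.rpow_mul hQp.le]; congr 1
      have : 1 - γ ≠ 0 := by linarith
      field_simp
    rwa [h2, ← hτQ] at h1
  have hQβ : 0 < Q ^ (-β) := Real.rpow_pos_of_pos hQp _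
  have key : ‖f z‖ ≤ (M * K + 2 * C) * Q ^ (-β) := by
    rcases le_or_gt τ ρ with h | h
    · have h1 : ‖f z‖ ≤ M * Real.exp (-(c / 9 * (τ * Q))) := by
        refine (hdecay z hz).trans ?_
        gcongr M * Real.exp (-?_)
        have : c / 9 * (τ * Q) ≤ c * (τ * Q) := by
          have : 0 ≤ τ * Q := by positivity
          nlinarith
        refine this.trans ?_
        rw [← mul_assoc]
        gcongr
      calc ‖f z‖ ≤ M * (K * Q ^ (-β)) := h1.trans (by gcongr)
        _ ≤ _ := by nlinarith
    rcases le_or_gt (infDist z E) τ with h' | h'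
    · have h1 : ‖f z‖ ≤ C * τ ^ a := by
        refine (hf z hz.le).trans ?_
        have := infDist_nonneg (x := z) (s := E)
        gcongr
      rw [hτa] at h1
      nlinarith [mul_pos (mul_pos hM hK) hQβ, mul_pos hC hQβ]
    · obtain ⟨ζ, hζ, hzζ⟩ := exists_norm_mul_eq z
      set z' : ℂ := ((1 - τ : ℝ) : ℂ) * ζ with hz'
      have hz'n : ‖z'‖ = 1 - τ := by
        rw [hz', norm_mul, hζ, mul_one, norm_real, Real.norm_of_nonneg (by linarith)]
      have d1 : ‖z - ζ‖ = ρ := norm_sub_unit hζ _ hzζ hz.le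
      have d2 : ‖z' - ζ‖ = τ := by
        rw [norm_sub_unit hζ (1 - τ) hz' (by linarith)]; ring
      have hzz : ‖z - z'‖ ≤ infDist z E := by
        have e : z - z' = ((τ - ρ : ℝ) : ℂ) * ζ := by
          rw [hz']; nth_rewrite 1 [hzζ]; rw [hρ]; push_cast; ring
        rw [e, norm_mul, hζ, mul_one, norm_real, Real.norm_of_nonneg (by linarith)]
        linarith
      have hQ9 := arcEnergy_le_of_near hEs hne hL hz (z' := z') (by linarith) hzz
      have h1 : ‖f z'‖ ≤ M * (K * Q ^ (-β)) := by
        refine (hdecay z' (by linarith)).trans ?_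
        gcongr
        refine le_trans ?_ hexpQ
        gcongr Real.exp (-?_)
        rw [hz'n, sub_sub_cancel]
        calc c / 9 * (τ * Q) ≤ c / 9 * (τ * (9 * arcEnergy E z')) := by gcongr
          _ = _ := by ring
      have h2 := hhol z ζ hz.le hζ
      have h3 := hhol z' ζ (by linarith) hζ
      rw [d1] at h2
      rw [d2, hτa] at h3
      have h4 : ρ ^ a ≤ Q ^ (-β) := by
        rw [← hτa]; gcongr
      have h5 : f z = (f z - f ζ) - (f z' - f ζ) + f z' := by ring
      have h6 : ‖f z‖ ≤ ‖f z - f ζ‖ + ‖f z' - f ζ‖ + ‖f z'‖ := by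
        nth_rewrite 1 [h5]
        exact (norm_add_le _ _).trans (add_le_add_left (norm_sub_le _ _) _)
      have h7 : C * ρ ^ a ≤ C * Q ^ (-β) := by gcongr
      linarith
  have hmin := min_mul_rpow_neg_le hρ0 hQp hβ0 (hβa.trans ha1)
  have hm0 : 0 ≤ min (1 / ρ) Q := le_min (by positivity) hQ0
  calc ‖f z‖ * min (1 / ρ) Q ≤ (M * K + 2 * C) * Q ^ (-β) * min (1 / ρ) Q := by gcongr
    _ = (M * K + 2 * C) * (min (1 / ρ) Q * Q ^ (-β)) := by ring
    _ ≤ (M * K + 2 * C) * ρ ^ (β - 1) := by gcongr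
    _ ≤ _ := by nlinarith

end Energy

section Truncation

variable {α : Type*} [MeasurableSpace α] {μ : Measure α} {L : α → ℝ}

lemma integrable_max_zero_sub (hL : Integrable L μ) (hL0 : ∀ t, 0 ≤ L t) {B : ℝ} (hB : 0 ≤ B) :
    Integrable (fun t => max 0 (L t - B)) μ := by
  refine hL.mono ?_ (Eventually.of_forall fun t => ?_)
  · exact (continuous_const.max (continuous_id.sub continuous_const)).comp_aestronglyMeasurable
      hL.aestronglyMeasurable
  · rw [Real.norm_of_nonneg (le_max_left _ _), Real.norm_of_nonneg (hL0 t)]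
    exact max_le (hL0 t) (by linarith)

lemma exists_integral_max_zero_sub_le (hL : Integrable L μ) (hL0 : ∀ t, 0 ≤ L t) {δ : ℝ}
    (hδ : 0 < δ) (b : ℝ) : ∃ B, 0 ≤ B ∧ b ≤ B ∧ ∫ t, max 0 (L t - B) ∂μ ≤ δ := by
  have hlim : Tendsto (fun n : ℕ => ∫ t, max 0 (L t - n) ∂μ) atTop (𝓝 (∫ _, (0 : ℝ) ∂μ)) := by
    refine tendsto_integral_of_dominated_convergence L
      (fun n => (integrable_max_zero_sub hL hL0 n.cast_nonneg).aestronglyMeasurable) hL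
      (fun n => Eventually.of_forall fun t => ?_) (Eventually.of_forall fun t => ?_)
    · rw [Real.norm_of_nonneg (le_max_left _ _)]
      exact max_le (hL0 t) (by linarith [(Nat.cast_nonneg n : (0 : ℝ) ≤ n)])
    · refine tendsto_const_nhds.congr' ?_
      filter_upwards [eventually_ge_atTop ⌈L t⌉₊] with n hn
      rw [max_eq_left]
      linarith [Nat.le_of_ceil_le hn]
  rw [integral_zero] at hlim
  obtain ⟨n, hn, hb⟩ := ((hlim.eventually (gt_mem_nhds hδ)).and
    (eventually_ge_atTop ⌈b⌉₊)).exists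
  exact ⟨n, n.cast_nonneg, Nat.le_of_ceil_le hb, hn.le⟩

/-- A quantitative de la Vallée-Poussin statement: an integrable nonnegative function is
dominated superlinearly by a function of small integral, up to constants. -/
lemma exists_superlinear (hL : Integrable L μ) (hL0 : ∀ t, 0 ≤ L t) {δ : ℝ} (hδ : 0 < δ) :
    ∃ W : α → ℝ, Integrable W μ ∧ (∀ t, 0 ≤ W t) ∧ ∫ t, W t ∂μ ≤ δ ∧
      ∀ N : ℕ, ∃ B : ℝ, ∀ t, N * L t - B ≤ W t := by
  have h1 : ∀ n : ℕ, ∃ B, 0 ≤ B ∧ (n : ℝ) ≤ B ∧ ∫ t, max 0 (L t - B) ∂μ ≤ δ / 2 / 2 ^ n :=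
    fun n => exists_integral_max_zero_sub_le hL hL0 (by positivity) n
  choose b hb0 hbn hbi using h1
  have hs : ∀ t, Summable fun n => max 0 (L t - b n) := by
    intro t
    refine summable_of_hasFiniteSupport ((Set.finite_lt_nat ⌈L t⌉₊).subset fun n hn => ?_)
    by_contra hlt
    refine hn (max_eq_left ?_)
    linarith [Nat.le_of_ceil_le (not_lt.mp hlt), hbn n]
  have hint : ∀ n, Integrable (fun t => max 0 (L t - b n)) μ :=
    fun n => integrable_max_zero_sub hL hL0 (hb0 n)
  have hWn : ∀ t, 0 ≤ ∑' n, max 0 (L t - b n) := fun t => tsum_nonneg fun n => le_max_left _ _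
  have hsum : ∫⁻ t, ENNReal.ofReal (∑' n, max 0 (L t - b n)) ∂μ ≤ ENNReal.ofReal δ := by
    calc ∫⁻ t, ENNReal.ofReal (∑' n, max 0 (L t - b n)) ∂μ
        = ∫⁻ t, ∑' n, ENNReal.ofReal (max 0 (L t - b n)) ∂μ :=
          lintegral_congr fun t => ENNReal.ofReal_tsum_of_nonneg (fun n => le_max_left _ _) (hs t)
      _ = ∑' n, ∫⁻ t, ENNReal.ofReal (max 0 (L t - b n)) ∂μ :=
          lintegral_tsum fun n => (hint n).aemeasurable.ennreal_ofReal
      _ ≤ ∑' n : ℕ, ENNReal.ofReal (δ / 2 / 2 ^ n) := by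
          refine ENNReal.tsum_le_tsum fun n => ?_
          rw [← ofReal_integral_eq_lintegral_ofReal (hint n)
            (Eventually.of_forall fun t => le_max_left _ _)]
          exact ENNReal.ofReal_le_ofReal (hbi n)
      _ = ENNReal.ofReal δ := by
          rw [← ENNReal.ofReal_tsum_of_nonneg (fun n => by positivity) (summable_geometric_two' δ),
            tsum_geometric_two']
  have hmeas : AEStronglyMeasurable (fun t => ∑' n, max 0 (L t - b n)) μ :=
    aestronglyMeasurable_of_tendsto_ae atTop
      (fun N => (Finset.range N).aestronglyMeasurable_fun_sum fun n _ => (hint n).aestronglyMeasurable)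
      (Eventually.of_forall fun t => (hs t).hasSum.tendsto_sum_nat)
  have hWi : Integrable (fun t => ∑' n, max 0 (L t - b n)) μ := by
    refine ⟨hmeas, ?_⟩
    rw [hasFiniteIntegral_iff_ofReal (Eventually.of_forall hWn)]
    exact hsum.trans_lt ENNReal.ofReal_lt_top
  refine ⟨_, hWi, hWn, ?_, fun N => ⟨∑ n ∈ Finset.range N, b n, fun t => ?_⟩⟩
  · rw [← ENNReal.ofReal_le_ofReal_iff hδ.le,
      ofReal_integral_eq_lintegral_ofReal hWi (Eventually.of_forall hWn)]
    exact hsum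
  · calc N * L t - ∑ n ∈ Finset.range N, b n = ∑ n ∈ Finset.range N, (L t - b n) := by
          rw [Finset.sum_sub_distrib]; simp
      _ ≤ ∑ n ∈ Finset.range N, max 0 (L t - b n) :=
          Finset.sum_le_sum fun n _ => le_max_right _ _
      _ ≤ ∑' n, max 0 (L t - b n) := (hs t).sum_le_tsum _ fun n _ => le_max_left _ _

end Truncation

section Multiplier

variable {E : Set ℂ} {W : ℝ → ℝ}

lemma arcDist_le_four (hEs : E ⊆ sphere 0 1) (hne : E.Nonempty) (t : ℝ) : arcDist E t ≤ 4 :=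
  (arcDist_le_two hEs hne t).trans (by norm_num)

lemma re_hergKernel_ge {s t : ℝ} {z : ℂ} (hs : 0 ≤ s) (hz : ‖z‖ ≤ 1) :
    (1 + s) * (1 - ‖z‖) / ‖poleDiff s t z‖ ^ 2 ≤ (hergKernel s t z).re := by
  rw [re_hergKernel]
  gcongr
  nlinarith [norm_nonneg z, mul_nonneg hs (norm_nonneg z)]

lemma herg_re_nonneg (hEs : E ⊆ sphere 0 1) (hne : E.Nonempty) (hW : Integrable W arcMeasure)
    (hW0 : ∀ t, 0 ≤ W t) {z : ℂ} (hz : ‖z‖ < 1) : 0 ≤ (herg W (arcDist E) z).re := by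
  rw [re_herg hW measurable_arcDist arcDist_nonneg (arcDist_le_four hEs hne) (sub_pos.2 hz)
    fun t => one_sub_le_norm_poleDiff z (arcDist_nonneg t) t]
  refine integral_nonneg fun t => mul_nonneg (hW0 t) (div_nonneg ?_ (sq_nonneg _))
  nlinarith [norm_nonneg z, arcDist_nonneg (E := E) t]

lemma norm_herg_le (hEs : E ⊆ sphere 0 1) (hne : E.Nonempty) (hW : Integrable W arcMeasure)
    (hW0 : ∀ t, 0 ≤ W t) {z : ℂ} (hz : ‖z‖ ≤ 1 / 2) :
    ‖herg W (arcDist E) z‖ ≤ 11 * ∫ t, W t ∂arcMeasure := by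
  rw [← integral_const_mul]
  refine norm_integral_le_of_norm_le (hW.const_mul _) (Eventually.of_forall fun t => ?_)
  rw [norm_mul, norm_real, Real.norm_of_nonneg (hW0 t), mul_comm]
  refine mul_le_mul_of_nonneg_right ?_ (hW0 t)
  have hp : 1 / 2 ≤ ‖poleDiff (arcDist E t) t z‖ :=
    le_trans (by linarith) (one_sub_le_norm_poleDiff z (arcDist_nonneg t) t)
  refine (norm_hergKernel_le_of_le (arcDist_nonneg t) (arcDist_le_four hEs hne t)
    one_half_pos hp).trans ?_
  rw [div_le_iff₀ one_half_pos]
  linarith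

/-- The derivative of the Herglotz integral `herg W (arcDist E)`. -/
def hergDeriv (E : Set ℂ) (W : ℝ → ℝ) (z : ℂ) : ℂ :=
  ∫ t, (W t : ℂ) * hergKernelDeriv (arcDist E t) t z ∂arcMeasure

lemma hasDerivAt_hergDeriv (hEs : E ⊆ sphere 0 1) (hne : E.Nonempty)
    (hW : Integrable W arcMeasure) {z : ℂ} {m : ℝ} (hm : 0 < m)
    (h : ∀ t, m ≤ ‖poleDiff (arcDist E t) t z‖) :
    HasDerivAt (herg W (arcDist E)) (hergDeriv E W z) z :=
  hasDerivAt_herg hW measurable_arcDist arcDist_nonneg (arcDist_le_four hEs hne) hm h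

lemma norm_hergDeriv_le_of_le (hEs : E ⊆ sphere 0 1) (hne : E.Nonempty)
    (hW : Integrable W arcMeasure) (hW0 : ∀ t, 0 ≤ W t) {z : ℂ} {m : ℝ} (hm : 0 < m)
    (h : ∀ t, m ≤ ‖poleDiff (arcDist E t) t z‖) :
    ‖hergDeriv E W z‖ ≤ 10 / m ^ 2 * ∫ t, W t ∂arcMeasure := by
  rw [← integral_const_mul]
  refine norm_integral_le_of_norm_le (hW.const_mul _) (Eventually.of_forall fun t => ?_)
  rw [norm_mul, norm_real, Real.norm_of_nonneg (hW0 t), mul_comm]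
  exact mul_le_mul_of_nonneg_right (norm_hergKernelDeriv_le_of_le (arcDist_nonneg t)
    (arcDist_le_four hEs hne t) hm (h t)) (hW0 t)

lemma norm_hergDeriv_le_arcEnergy (hEs : E ⊆ sphere 0 1) (hne : E.Nonempty)
    (hL : Integrable (arcLog E) arcMeasure) {K : ℝ} (hW0 : ∀ t, 0 ≤ W t)
    (hWK : ∀ t, W t ≤ K * arcLog E t) {z : ℂ} (hz : ‖z‖ < 1) :
    ‖hergDeriv E W z‖ ≤ 6 * K * arcEnergy E z := by
  rw [arcEnergy, ← integral_const_mul]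
  refine norm_integral_le_of_norm_le ((integrable_arcEnergy hL (sub_pos.2 hz) fun t =>
    one_sub_le_norm_poleDiff z (arcDist_nonneg t) t).const_mul _) (Eventually.of_forall fun t => ?_)
  rw [norm_mul, norm_real, Real.norm_of_nonneg (hW0 t), norm_hergKernelDeriv z (arcDist_nonneg t)]
  calc W t * (2 * (1 + arcDist E t) / ‖poleDiff (arcDist E t) t z‖ ^ 2)
      ≤ K * arcLog E t * (6 / ‖poleDiff (arcDist E t) t z‖ ^ 2) := by
        have := arcDist_nonneg (E := E) t
        refine mul_le_mul (hWK t) ?_ (by positivity) ((hW0 t).trans (hWK t))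
        gcongr
        linarith [arcDist_le_two hEs hne t]
    _ = _ := by ring

lemma norm_hergDeriv_le_re (hEs : E ⊆ sphere 0 1) (hne : E.Nonempty)
    (hW : Integrable W arcMeasure) (hW0 : ∀ t, 0 ≤ W t) {z : ℂ} (hz : ‖z‖ < 1) :
    ‖hergDeriv E W z‖ ≤ 2 / (1 - ‖z‖) * (herg W (arcDist E) z).re := by
  have hρ := sub_pos.2 hz
  have hm := fun t => one_sub_le_norm_poleDiff z (arcDist_nonneg (E := E) t) t
  rw [re_herg hW measurable_arcDist arcDist_nonneg (arcDist_le_four hEs hne) hρ hm,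
    ← integral_const_mul]
  refine norm_integral_le_of_norm_le ((integrable_re_herg hW measurable_arcDist arcDist_nonneg
    (arcDist_le_four hEs hne) hρ hm).const_mul _) (Eventually.of_forall fun t => ?_)
  have hd := arcDist_nonneg (E := E) t
  have h1 := re_hergKernel_ge (t := t) hd hz.le
  rw [re_hergKernel] at h1
  rw [norm_mul, norm_real, Real.norm_of_nonneg (hW0 t), norm_hergKernelDeriv z hd]
  calc W t * (2 * (1 + arcDist E t) / ‖poleDiff (arcDist E t) t z‖ ^ 2)
      = 2 / (1 - ‖z‖) * (W t * ((1 + arcDist E t) * (1 - ‖z‖) /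
          ‖poleDiff (arcDist E t) t z‖ ^ 2)) := by field_simp
    _ ≤ _ := by
      gcongr
      exact hW0 t

lemma norm_exp_neg_herg_mul_hergDeriv_le (hEs : E ⊆ sphere 0 1) (hne : E.Nonempty)
    (hL : Integrable (arcLog E) arcMeasure) (hW : Integrable W arcMeasure) {K : ℝ} (hK : 1 ≤ K)
    (hW0 : ∀ t, 0 ≤ W t) (hWK : ∀ t, W t ≤ K * arcLog E t) {z : ℂ} (hz : ‖z‖ < 1) :
    ‖exp (-herg W (arcDist E) z)‖ * ‖hergDeriv E W z‖ ≤
      6 * K * min (1 / (1 - ‖z‖)) (arcEnergy E z) := by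
  have hρ := sub_pos.2 hz
  have hre := herg_re_nonneg hEs hne hW hW0 hz
  have he : ‖exp (-herg W (arcDist E) z)‖ = Real.exp (-(herg W (arcDist E) z).re) := by
    rw [norm_exp, neg_re]
  have he1 : ‖exp (-herg W (arcDist E) z)‖ ≤ 1 := by
    rw [he]; exact Real.exp_le_one_iff.2 (by linarith)
  rw [mul_min_of_nonneg _ _ (by positivity)]
  refine le_min ?_ ?_
  · have h1 : Real.exp (-(herg W (arcDist E) z).re) * (herg W (arcDist E) z).re ≤ 1 := by
      rw [Real.exp_neg, inv_mul_le_iff₀ (Real.exp_pos _)]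
      linarith [Real.add_one_le_exp (herg W (arcDist E) z).re]
    calc _ ≤ Real.exp (-(herg W (arcDist E) z).re) *
          (2 / (1 - ‖z‖) * (herg W (arcDist E) z).re) := by
          rw [he]
          gcongr
          exact norm_hergDeriv_le_re hEs hne hW hW0 hz
      _ = 2 / (1 - ‖z‖) *
          (Real.exp (-(herg W (arcDist E) z).re) * (herg W (arcDist E) z).re) := by ring
      _ ≤ 2 / (1 - ‖z‖) * 1 := by gcongr
      _ = 2 * (1 / (1 - ‖z‖)) := by ring
      _ ≤ 6 * K * (1 / (1 - ‖z‖)) := by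
          gcongr
          linarith
  · calc _ ≤ 1 * ‖hergDeriv E W z‖ := by gcongr
      _ ≤ _ := by
        rw [one_mul]
        exact norm_hergDeriv_le_arcEnergy hEs hne hL hW0 hWK hz

end Multiplier

section LowerBound

variable {E : Set ℂ} {W : ℝ → ℝ} {z w : ℂ}

lemma infDist_div_le_norm_poleDiff (hz : ‖z‖ ≤ 1) (hD2 : infDist z E ≤ 2)
    (hw : ‖w - z‖ ≤ infDist z E ^ 2 / 100) (t : ℝ) :
    12 / 25 * infDist z E ≤ ‖poleDiff (arcDist E t) t w‖ := by
  have h1 := infDist_le_two_mul_norm_poleDiff (E := E) hz t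
  have h2 := norm_poleDiff_sub (arcDist E t) t z w
  have h3 := norm_sub_norm_le (poleDiff (arcDist E t) t z) (poleDiff (arcDist E t) t w)
  rw [h2, norm_sub_rev] at h3
  nlinarith [infDist_nonneg (x := z) (s := E)]

lemma sq_norm_le_of_near (hz : ‖z‖ ≤ 1) (hD2 : infDist z E ≤ 2)
    (hw : ‖w - z‖ ≤ infDist z E ^ 2 / 100) :
    ‖w‖ ^ 2 ≤ ‖z‖ ^ 2 + 204 / 10000 * infDist z E ^ 2 := by
  have h1 : ‖w‖ ≤ ‖z‖ + infDist z E ^ 2 / 100 := by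
    linarith [norm_sub_norm_le w z]
  have h0 : 0 ≤ infDist z E := infDist_nonneg
  have h2 : ‖w‖ ^ 2 ≤ (‖z‖ + infDist z E ^ 2 / 100) ^ 2 := by gcongr
  have h3 : infDist z E ^ 2 ≤ 4 := by nlinarith
  nlinarith [sq_nonneg (infDist z E), norm_nonneg z]

lemma re_kernel_ge_of_near (hz : ‖z‖ ≤ 1) (hD : 0 < infDist z E)
    (hD2 : infDist z E ≤ 2) (hw : ‖w - z‖ ≤ infDist z E ^ 2 / 100) (t : ℝ) :
    -(1 / 10) ≤ ((1 + arcDist E t) ^ 2 - ‖w‖ ^ 2) / ‖poleDiff (arcDist E t) t w‖ ^ 2 := by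
  have h1 := infDist_div_le_norm_poleDiff hz hD2 hw t
  have h2 := sq_norm_le_of_near hz hD2 hw
  have hd := arcDist_nonneg (E := E) t
  have hp : 0 < ‖poleDiff (arcDist E t) t w‖ := by nlinarith
  rw [le_div_iff₀ (by positivity)]
  have h3 : (12 / 25 * infDist z E) ^ 2 ≤ ‖poleDiff (arcDist E t) t w‖ ^ 2 := by gcongr
  nlinarith [norm_nonneg z]

lemma re_kernel_ge_of_close (hEs : E ⊆ sphere 0 1) (hne : E.Nonempty) (hz : ‖z‖ ≤ 1)
    (hD : 0 < infDist z E) (hD2 : infDist z E ≤ 2)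
    (hw : ‖w - z‖ ≤ infDist z E ^ 2 / 100) {t : ℝ}
    (ht : ‖z - exp (t * I)‖ ≤ 1 - ‖z‖ + infDist z E / 4) :
    arcDist E t ≤ 9 / 4 * infDist z E ∧ 1 / (20 * infDist z E) ≤
      ((1 + arcDist E t) ^ 2 - ‖w‖ ^ 2) / ‖poleDiff (arcDist E t) t w‖ ^ 2 := by
  have h1 := infDist_div_le_norm_poleDiff hz hD2 hw t
  have h2 := sq_norm_le_of_near hz hD2 hw
  have hd := arcDist_nonneg (E := E) t
  have hp : 0 < ‖poleDiff (arcDist E t) t w‖ := by nlinarith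
  have hρ := one_sub_norm_le_infDist hEs hne z
  have h3 := abs_le.1 ((abs_infDist_sub_arcDist_le (E := E) z t).trans ht)
  have hup : ‖poleDiff (arcDist E t) t w‖ ≤ 88 / 25 * infDist z E := by
    have h4 := norm_poleDiff_sub (arcDist E t) t z w
    have h5 := norm_sub_norm_le (poleDiff (arcDist E t) t w) (poleDiff (arcDist E t) t z)
    rw [norm_sub_rev, h4, norm_sub_rev] at h5
    have h6 : ‖poleDiff (arcDist E t) t z‖ ≤ ‖z - exp (t * I)‖ + arcDist E t := by
      rw [← norm_one_sub_mul_exp]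
      have e : poleDiff (arcDist E t) t z =
          (1 - z * exp (-(t * I))) + ((arcDist E t : ℝ) : ℂ) := by
        rw [poleDiff]; ring
      rw [e]
      refine (norm_add_le _ _).trans ?_
      rw [norm_real, Real.norm_of_nonneg hd]
    nlinarith
  refine ⟨by linarith, ?_⟩
  rw [div_le_div_iff₀ (by positivity) (by positivity)]
  have h7 : ‖poleDiff (arcDist E t) t w‖ ^ 2 ≤ (88 / 25 * infDist z E) ^ 2 := by gcongr
  have h8 : 7 / 10 * infDist z E ≤ (1 + arcDist E t) ^ 2 - ‖w‖ ^ 2 := by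
    nlinarith [norm_nonneg z]
  nlinarith

lemma re_herg_ge (hEs : E ⊆ sphere 0 1) (hne : E.Nonempty)
    (hnull : ∀ᵐ t ∂arcMeasure, arcDist E t ≠ 0) (hW : Integrable W arcMeasure)
    (hW0 : ∀ t, 0 ≤ W t) {K B : ℝ} (hK : 0 ≤ K) (hWK : ∀ t, K * arcLog E t - B ≤ W t)
    (hz : ‖z‖ ≤ 1) (hD : 0 < infDist z E) (hw : ‖w - z‖ ≤ infDist z E ^ 2 / 100) :
    1 / 80 * (K * Real.log (2 / (9 / 4 * infDist z E)) - B) - 1 / 10 * ∫ t, W t ∂arcMeasure ≤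
      (herg W (arcDist E) w).re := by
  set D := infDist z E with hDd
  have hD2 : D ≤ 2 := (infDist_le_norm_add_one hEs hne z).trans (by linarith)
  have hm : ∀ t, 12 / 25 * D ≤ ‖poleDiff (arcDist E t) t w‖ :=
    infDist_div_le_norm_poleDiff hz hD2 hw
  have hm0 : 0 < 12 / 25 * D := by positivity
  have hint := integrable_re_herg hW measurable_arcDist arcDist_nonneg (arcDist_le_four hEs hne)
    hm0 hm
  rw [re_herg hW measurable_arcDist arcDist_nonneg (arcDist_le_four hEs hne) hm0 hm,
    sub_le_iff_le_add, ← integral_const_mul, ← integral_add hint (hW.const_mul _)]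
  set Λ := K * Real.log (2 / (9 / 4 * D)) - B with hΛ
  have hker := re_kernel_ge_of_near hz hD hD2 hw
  have hnn : ∀ t, 0 ≤ W t * (((1 + arcDist E t) ^ 2 - ‖w‖ ^ 2) /
      ‖poleDiff (arcDist E t) t w‖ ^ 2) + 1 / 10 * W t := fun t => by
    have := mul_nonneg (hW0 t) (sub_nonneg.2 (hker t))
    linarith
  rcases le_or_gt Λ 0 with hΛ0 | hΛ0
  · exact le_trans (by linarith) (integral_nonneg hnn)
  obtain ⟨T, hTm, hTs, hTv, hTn⟩ : ∃ T : Set ℝ, MeasurableSet T ∧ T ⊆ Ioc (-Real.pi) Real.pi ∧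
      volume T = ENNReal.ofReal (D / 4) ∧ ∀ t ∈ T, |t - arg z| ≤ D / 4 := by
    have hpi := Real.pi_gt_three
    rcases le_or_gt (arg z) 0 with h | h
    · refine ⟨Ioc (arg z) (arg z + D / 4), measurableSet_Ioc, fun t ht => ⟨?_, ?_⟩, ?_,
        fun t ht => ?_⟩
      · linarith [ht.1, neg_pi_lt_arg z]
      · linarith [ht.2]
      · rw [Real.volume_Ioc, add_sub_cancel_left]
      · rw [abs_le]; constructor <;> linarith [ht.1, ht.2]
    · refine ⟨Ioc (arg z - D / 4) (arg z), measurableSet_Ioc, fun t ht => ⟨?_, ?_⟩, ?_,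
        fun t ht => ?_⟩
      · linarith [ht.1]
      · linarith [ht.2, arg_le_pi z]
      · rw [Real.volume_Ioc, sub_sub_cancel]
      · rw [abs_le]; constructor <;> linarith [ht.1, ht.2]
  have hTr : arcMeasure.real T = D / 4 := by
    rw [measureReal_def, arcMeasure, Measure.restrict_apply hTm, inter_eq_left.2 hTs, hTv,
      ENNReal.toReal_ofReal (by positivity)]
  have hclose : ∀ t ∈ T, ‖z - exp (t * I)‖ ≤ 1 - ‖z‖ + D / 4 := by
    intro t ht
    have h1 : ‖z - exp (arg z * I)‖ = 1 - ‖z‖ := by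
      nth_rw 1 [← norm_mul_exp_arg_mul_I z]
      rw [← sub_one_mul, norm_mul, norm_exp_ofReal_mul_I, mul_one, norm_sub_rev, ← ofReal_one,
        ← ofReal_sub, norm_real, Real.norm_of_nonneg (by linarith)]
    have h2 := norm_exp_add_sub_le t (arg z - t)
    rw [add_sub_cancel, abs_sub_comm] at h2
    calc ‖z - exp (t * I)‖ ≤ ‖z - exp (arg z * I)‖ + ‖exp (arg z * I) - exp (t * I)‖ :=
          norm_sub_le_norm_sub_add_norm_sub _ _ _
      _ ≤ _ := by
        rw [h1]
        linarith [hTn t ht]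
  calc 1 / 80 * Λ = ∫ t, T.indicator (fun _ => Λ * (1 / (20 * D))) t ∂arcMeasure := by
        rw [integral_indicator hTm, setIntegral_const, hTr, smul_eq_mul]
        field_simp
        norm_num
    _ ≤ _ := by
      refine integral_mono_ae ((integrable_const _).indicator hTm)
        (hint.add (hW.const_mul _)) ?_
      filter_upwards [hnull] with t htd
      by_cases ht : t ∈ T
      · rw [indicator_of_mem ht]
        obtain ⟨h1, h2⟩ := re_kernel_ge_of_close hEs hne hz hD hD2 hw (hclose t ht)
        have hd : 0 < arcDist E t := lt_of_le_of_ne (arcDist_nonneg t) (Ne.symm htd)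
        have h3 : Λ ≤ W t := by
          refine le_trans ?_ (hWK t)
          rw [hΛ, arcLog]
          gcongr
        have h4 := mul_le_mul h3 h2 (by positivity) (hW0 t)
        have := hW0 t
        linarith
      · rw [indicator_of_notMem ht]
        exact hnn t

lemma norm_exp_neg_herg_le (hEs : E ⊆ sphere 0 1) (hne : E.Nonempty)
    (hnull : ∀ᵐ t ∂arcMeasure, arcDist E t ≠ 0) (hW : Integrable W arcMeasure)
    (hW0 : ∀ t, 0 ≤ W t) {N : ℕ} {B : ℝ}
    (hWK : ∀ t, ((80 * N : ℕ) : ℝ) * arcLog E t - B ≤ W t) :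
    ∃ C > 0, ∀ z w : ℂ, ‖z‖ ≤ 1 → 0 < infDist z E → ‖w - z‖ ≤ infDist z E ^ 2 / 100 →
      ‖exp (-herg W (arcDist E) w)‖ ≤ C * infDist z E ^ N := by
  refine ⟨Real.exp (B / 80 + 1 / 10 * ∫ t, W t ∂arcMeasure) * (9 / 8) ^ N, by positivity,
    fun z w hz hD hw => ?_⟩
  have h := re_herg_ge hEs hne hnull hW hW0 (Nat.cast_nonneg _) hWK hz hD hw
  have e : 2 / (9 / 4 * infDist z E) = (9 / 8 * infDist z E)⁻¹ := by
    field_simp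
    norm_num
  rw [e, Real.log_inv] at h
  push_cast at h
  rw [norm_exp, neg_re, mul_assoc, ← mul_pow,
    ← Real.exp_log (show 0 < (9 / 8 * infDist z E) ^ N by positivity), ← Real.exp_add,
    Real.exp_le_exp, Real.log_pow]
  linarith

end LowerBound

lemma continuousAt_iteratedDeriv {F : ℂ → ℂ} {z : ℂ} (h : AnalyticAt ℂ F z) (n : ℕ) :
    ContinuousAt (iteratedDeriv n F) z := by
  rw [iteratedDeriv_eq_iterate]
  exact (h.iterated_deriv n).continuousAt

section Flat

variable {E : Set ℂ} {F : ℂ → ℂ} {c : ℝ}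

lemma exists_norm_iteratedDeriv_le (hc : 0 < c)
    (hd : ∀ z w : ℂ, ‖z‖ ≤ 1 → 0 < infDist z E → ‖w - z‖ ≤ c * infDist z E ^ 2 →
      DifferentiableAt ℂ F w)
    (hN : ∀ N : ℕ, ∃ C > 0, ∀ z w : ℂ, ‖z‖ ≤ 1 → 0 < infDist z E →
      ‖w - z‖ ≤ c * infDist z E ^ 2 → ‖F w‖ ≤ C * infDist z E ^ N) (n : ℕ) :
    ∃ C > 0, ∀ z : ℂ, ‖z‖ ≤ 1 → 0 < infDist z E → ‖iteratedDeriv n F z‖ ≤ C * infDist z E := by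
  obtain ⟨C, hC, hCb⟩ := hN (2 * n + 1)
  refine ⟨n.factorial * C / c ^ n, by positivity, fun z hz hD => ?_⟩
  have hR : 0 < c * infDist z E ^ 2 := by positivity
  have hmem : ∀ w ∈ closedBall z (c * infDist z E ^ 2), ‖w - z‖ ≤ c * infDist z E ^ 2 :=
    fun w hw => by rwa [← dist_eq_norm]
  have h := norm_iteratedDeriv_le_of_forall_mem_sphere_norm_le n hR
    (f := F) (c := z) (C := C * infDist z E ^ (2 * n + 1))
    (DifferentiableOn.diffContOnCl_ball
      (U := closedBall z (c * infDist z E ^ 2))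
      (fun w hw => (hd z w hz hD (hmem w hw)).differentiableWithinAt) subset_rfl)
    (fun w hw => hCb z w hz hD (hmem w (sphere_subset_closedBall hw)))
  refine h.trans_eq ?_
  field_simp
  ring

lemma vanishAllDeriv_of_flat (hE : IsClosed E) (hEs : E ⊆ sphere 0 1) (hne : E.Nonempty)
    (hc : 0 < c)
    (hd : ∀ z w : ℂ, ‖z‖ ≤ 1 → 0 < infDist z E → ‖w - z‖ ≤ c * infDist z E ^ 2 →
      DifferentiableAt ℂ F w)
    (hN : ∀ N : ℕ, ∃ C > 0, ∀ z w : ℂ, ‖z‖ ≤ 1 → 0 < infDist z E →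
      ‖w - z‖ ≤ c * infDist z E ^ 2 → ‖F w‖ ≤ C * infDist z E ^ N)
    (h0 : ∀ z ∈ E, F z = 0) : VanishAllDeriv E F := by
  classical
  have hpos : ∀ z, z ∉ E ↔ 0 < infDist z E := fun z => hE.notMem_iff_infDist_pos hne
  have hdiff : ∀ z : ℂ, ‖z‖ ≤ 1 → 0 < infDist z E → AnalyticAt ℂ F z := by
    intro z hz hD
    have hR : 0 < c * infDist z E ^ 2 := by positivity
    refine DifferentiableOn.analyticAt (s := closedBall z (c * infDist z E ^ 2))
      (fun w hw => (hd z w hz hD (by rwa [← dist_eq_norm])).differentiableWithinAt)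
      (closedBall_mem_nhds z hR)
  have hball : ∀ z ∈ ball (0 : ℂ) 1, z ∉ E := fun z hz hzE => by
    have h1 := hEs hzE
    rw [mem_sphere] at h1
    rw [mem_ball, h1] at hz
    exact lt_irrefl _ hz
  have hg : ∀ n, ContinuousOn (fun z => if z ∈ E then 0 else iteratedDeriv n F z)
      (closedBall 0 1) := by
    intro n z hz
    obtain ⟨C, hC, hCb⟩ := exists_norm_iteratedDeriv_le hc hd hN n
    by_cases hzE : z ∈ E
    · rw [ContinuousWithinAt, if_pos hzE]
      have hlim : Tendsto (fun w => C * infDist w E) (𝓝[closedBall 0 1] z) (𝓝 0) := by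
        have := ((continuous_infDist_pt E).tendsto z).const_mul C
        rw [infDist_zero_of_mem hzE, mul_zero] at this
        exact this.mono_left nhdsWithin_le_nhds
      refine squeeze_zero_norm' ?_ hlim
      filter_upwards [self_mem_nhdsWithin] with w hw
      by_cases hwE : w ∈ E
      · rw [if_pos hwE, norm_zero]
        exact mul_nonneg hC.le infDist_nonneg
      · rw [if_neg hwE]
        exact hCb w (by simpa using hw) ((hpos w).1 hwE)
    · have ha := hdiff z (by simpa using hz) ((hpos z).1 hzE)
      refine ((continuousAt_iteratedDeriv ha n).congr ?_).continuousWithinAt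
      filter_upwards [hE.isOpen_compl.mem_nhds hzE] with w hw
      rw [if_neg hw]
  refine ⟨(hg 0).congr fun z _ => ?_, fun z hz => ?_, h0, fun n => ⟨_, hg n, fun z hz => ?_,
    fun z hz => if_pos hz⟩⟩
  · by_cases hzE : z ∈ E
    · simp only [if_pos hzE, h0 z hzE]
    · simp only [if_neg hzE, iteratedDeriv_zero]
  · exact (hdiff z (by simpa using (mem_ball.1 hz).le)
      ((hpos z).1 (hball z hz))).differentiableAt.differentiableWithinAt
  · exact if_neg (hball z hz)

end Flat

section Dilation

variable {f : ℂ → ℂ} {r : ℝ}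

lemma norm_ofReal_mul_lt {z : ℂ} (hr0 : 0 < r) (hr1 : r < 1) (hz : ‖z‖ ≤ 1) : ‖(r : ℂ) * z‖ < 1 := by
  rw [norm_mul, norm_real, Real.norm_of_nonneg hr0.le]
  nlinarith [norm_nonneg z]

lemma hasDerivAt_dilation (hd : DifferentiableOn ℂ f (ball 0 1)) {z : ℂ} (hz : ‖(r : ℂ) * z‖ < 1) :
    HasDerivAt (fun z => f (r * z)) (r * deriv f (r * z)) z := by
  have h1 : HasDerivAt f (deriv f (r * z)) (r * z) :=
    ((hd _ (by simpa using hz)).differentiableAt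
      (isOpen_ball.mem_nhds (by simpa using hz))).hasDerivAt
  have h2 : HasDerivAt (fun z : ℂ => (r : ℂ) * z) r z := by
    simpa using (hasDerivAt_id z).const_mul (r : ℂ)
  rw [mul_comm]
  exact h1.comp z h2

lemma norm_deriv_dilation_le {C a : ℝ} (hC : 0 ≤ C) (ha : a < 1) (hr0 : 0 < r) (hr1 : r < 1)
    (h : ∀ z : ℂ, ‖z‖ < 1 → ‖deriv f z‖ ≤ C * (1 - ‖z‖) ^ (a - 1)) {z : ℂ} (hz : ‖z‖ < 1) :
    ‖(r : ℂ) * deriv f (r * z)‖ ≤ C * (1 - ‖z‖) ^ (a - 1) := by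
  have hn : ‖(r : ℂ) * z‖ = r * ‖z‖ := by rw [norm_mul, norm_real, Real.norm_of_nonneg hr0.le]
  calc ‖(r : ℂ) * deriv f (r * z)‖ ≤ 1 * (C * (1 - ‖(r : ℂ) * z‖) ^ (a - 1)) := by
        rw [norm_mul, norm_real, Real.norm_of_nonneg hr0.le]
        gcongr
        exact h _ (norm_ofReal_mul_lt hr0 hr1 hz.le)
    _ ≤ C * (1 - ‖z‖) ^ (a - 1) := by
        rw [one_mul]
        refine mul_le_mul_of_nonneg_left ?_ hC
        refine Real.rpow_le_rpow_of_nonpos (by linarith) ?_ (by linarith)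
        rw [hn]
        nlinarith [norm_nonneg z]

lemma exists_dilation_close (hc : ContinuousOn f (closedBall 0 1)) {σ : ℝ} (hσ : 0 < σ) :
    ∃ r : ℝ, 0 < r ∧ r < 1 ∧ ∀ z : ℂ, ‖z‖ ≤ 1 → ‖f z - f (r * z)‖ ≤ σ := by
  have hu := (isCompact_closedBall (0 : ℂ) 1).uniformContinuousOn_of_continuous hc
  obtain ⟨δ, hδ, h⟩ := Metric.uniformContinuousOn_iff.1 hu σ hσ
  obtain ⟨r, hr, hr1⟩ := exists_between (show max 0 (1 - δ) < 1 from max_lt one_pos (by linarith))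
  have hr0 : 0 < r := (le_max_left _ _).trans_lt hr
  have hrδ : 1 - δ < r := (le_max_right _ _).trans_lt hr
  refine ⟨r, hr0, hr1, fun z hz => ?_⟩
  rw [← dist_eq_norm]
  refine (h z (by simpa using hz) _ (by simpa using (norm_ofReal_mul_lt hr0 hr1 hz).le) ?_).le
  have e : z - r * z = ((1 - r : ℝ) : ℂ) * z := by push_cast; ring
  rw [dist_eq_norm, e, norm_mul, norm_real, Real.norm_of_nonneg (by linarith)]
  nlinarith [norm_nonneg z]

lemma vanishAllDeriv_empty_dilation (hd : DifferentiableOn ℂ f (ball 0 1)) (hr0 : 0 < r)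
    (hr1 : r < 1) : VanishAllDeriv ∅ (fun z => f (r * z)) := by
  have hopen : IsOpen {z : ℂ | ‖(r : ℂ) * z‖ < 1} := isOpen_lt (by fun_prop) continuous_const
  have han : ∀ z : ℂ, ‖z‖ ≤ 1 → AnalyticAt ℂ (fun z => f (r * z)) z := fun z hz =>
    DifferentiableOn.analyticAt (s := {z : ℂ | ‖(r : ℂ) * z‖ < 1})
      (fun w hw => (hasDerivAt_dilation hd hw).differentiableAt.differentiableWithinAt)
      (hopen.mem_nhds (norm_ofReal_mul_lt hr0 hr1 hz))
  refine ⟨fun z hz => (han z (by simpa using hz)).continuousAt.continuousWithinAt,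
    fun z hz => (han z (by simpa using (mem_ball.1 hz).le)).differentiableAt.differentiableWithinAt,
    fun z hz => hz.elim, fun n => ⟨iteratedDeriv n (fun z => f (r * z)), fun z hz => ?_,
    fun z _ => rfl, fun z hz => hz.elim⟩⟩
  exact (continuousAt_iteratedDeriv (han z (by simpa using hz)) n).continuousWithinAt

end Dilation

lemma VanishAllDeriv.mem_APlus {E : Set ℂ} {f g : ℂ → ℂ} (hg : VanishAllDeriv E g)
    (hd : DifferentiableOn ℂ f (ball 0 1)) (hf : Summable fun n => ‖taylorCoeff f n‖)
    (hfg : Summable fun n => ‖taylorCoeff (f - g) n‖) : g ∈ APlus := by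
  refine mem_APlus_of_summable hg.1 hg.2.1 ((hf.add hfg).of_nonneg_of_le
    (fun _ => norm_nonneg _) fun n => ?_)
  have h : taylorCoeff g n = taylorCoeff f n - taylorCoeff (f - g) n := by
    rw [taylorCoeff_sub hd hg.2.1, sub_sub_cancel]
  rw [h]
  exact norm_sub_le _ _

/-- The weighted derivative criterion for approximation in `A⁺`. -/
lemma mem_J0Plus_of_approx {E : Set ℂ} {f : ℂ → ℂ} {β C : ℝ} (hβ : 1 / 2 < β) (hC : 0 ≤ C)
    (hfA : f ∈ APlus) (hd : DifferentiableOn ℂ f (ball 0 1))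
    (hf' : ∀ z : ℂ, ‖z‖ < 1 → ‖deriv f z‖ ≤ C * (1 - ‖z‖) ^ (β - 1))
    (h : ∀ η > 0, ∃ g, VanishAllDeriv E g ∧
      (∀ z : ℂ, ‖z‖ < 1 → ‖deriv (f - g) z‖ ≤ C * (1 - ‖z‖) ^ (β - 1)) ∧
      ∀ z : ℂ, ‖z‖ = 1 / 2 → ‖f z - g z‖ ≤ η) : f ∈ J0Plus E := by
  refine ⟨hfA, fun ε hε => ?_⟩
  obtain ⟨η, hη, hA⟩ := exists_tsum_taylorCoeff_le hβ hC (half_pos hε)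
  obtain ⟨g, hg, hder, hhalf⟩ := h η hη
  obtain ⟨hs, hle⟩ := hA (f - g) (hd.sub hg.2.1) fun z hz => hder z (by simpa using hz)
  refine ⟨g, hg.mem_APlus hd (hA f hd fun z hz => hf' z (by simpa using hz)).1 hs, hg, ?_⟩
  exact (hle fun z hz => hhalf z hz).trans_lt (half_lt_self hε)

lemma mem_J0Plus_empty {f : ℂ → ℂ} {a C : ℝ} (ha : 1 / 2 < a) (ha1 : a < 1) (hC : 0 ≤ C)
    (hfA : f ∈ APlus) (hc : ContinuousOn f (closedBall 0 1))
    (hd : DifferentiableOn ℂ f (ball 0 1))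
    (hf' : ∀ z : ℂ, ‖z‖ < 1 → ‖deriv f z‖ ≤ C * (1 - ‖z‖) ^ (a - 1)) : f ∈ J0Plus ∅ := by
  have hp : ∀ z : ℂ, ‖z‖ < 1 → 0 ≤ C * (1 - ‖z‖) ^ (a - 1) := fun z hz =>
    mul_nonneg hC (Real.rpow_nonneg (by linarith) _)
  refine mem_J0Plus_of_approx (C := 2 * C) ha (by linarith) hfA hd
    (fun z hz => (hf' z hz).trans (by linarith [hp z hz])) fun η hη => ?_
  obtain ⟨r, hr0, hr1, hr⟩ := exists_dilation_close hc hη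
  refine ⟨fun z => f (r * z), vanishAllDeriv_empty_dilation hd hr0 hr1, fun z hz => ?_,
    fun z hz => hr z (by linarith)⟩
  have h1 : HasDerivAt f (deriv f z) z := ((hd z (by simpa using hz)).differentiableAt
      (isOpen_ball.mem_nhds (by simpa using hz))).hasDerivAt
  rw [(h1.sub (hasDerivAt_dilation hd (norm_ofReal_mul_lt hr0 hr1 hz.le))).deriv]
  refine (norm_sub_le _ _).trans ?_
  linarith [hf' z hz, norm_deriv_dilation_le hC ha1 hr0 hr1 hf' hz]

lemma vanishAllDeriv_zero (E : Set ℂ) : VanishAllDeriv E 0 := by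
  refine ⟨continuousOn_const, differentiableOn_const _, fun _ _ => rfl, fun n =>
    ⟨0, continuousOn_const, fun z _ => ?_, fun _ _ => rfl⟩⟩
  simp [Pi.zero_def]

lemma mem_J0Plus_of_eq_zero {E : Set ℂ} {f : ℂ → ℂ} (hfA : f ∈ APlus)
    (hd : DifferentiableOn ℂ f (ball 0 1)) (h0 : ∀ z : ℂ, ‖z‖ < 1 → f z = 0) : f ∈ J0Plus E := by
  have hder : ∀ z : ℂ, ‖z‖ < 1 → deriv f z = 0 := fun z hz => by
    have : f =ᶠ[𝓝 z] fun _ => 0 := by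
      filter_upwards [isOpen_ball.mem_nhds (show z ∈ ball (0 : ℂ) 1 by simpa using hz)] with w hw
      exact h0 w (by simpa using hw)
    rw [this.deriv_eq, deriv_const]
  refine mem_J0Plus_of_approx (β := 1) (C := 0) (by norm_num) le_rfl hfA hd
    (fun z hz => by rw [hder z hz]; simp) fun η hη => ⟨0, vanishAllDeriv_zero E,
    fun z hz => by rw [sub_zero, hder z hz]; simp, fun z hz => ?_⟩
  rw [h0 z (by linarith)]
  simpa using hη.le

open Classical in
/-- The dilation `z ↦ f (r z)` multiplied by the outer function with logarithmic weight
`-(V + W)`, whose poles are pushed off the circle by the distance to `E`; it is set to `0`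
on `E`. -/
def outerApprox (E : Set ℂ) (V W : ℝ → ℝ) (r : ℝ) (f : ℂ → ℂ) (z : ℂ) : ℂ :=
  if z ∈ E then 0 else
    f (r * z) * (exp (-herg V (arcDist E) z) * exp (-herg W (arcDist E) z))

section OuterApprox

variable {E : Set ℂ} {f : ℂ → ℂ} {V W : ℝ → ℝ} {r : ℝ}

lemma outerApprox_of_notMem {z : ℂ} (hz : z ∉ E) : outerApprox E V W r f z =
    f (r * z) * (exp (-herg V (arcDist E) z) * exp (-herg W (arcDist E) z)) := if_neg hz

lemma hasDerivAt_outerApprox (hE : IsClosed E) (hEs : E ⊆ sphere 0 1) (hne : E.Nonempty)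
    (hV : Integrable V arcMeasure) (hW : Integrable W arcMeasure)
    (hd : DifferentiableOn ℂ f (ball 0 1)) {z : ℂ} (hzE : z ∉ E) (hz : ‖(r : ℂ) * z‖ < 1)
    {m : ℝ} (hm : 0 < m) (h : ∀ t, m ≤ ‖poleDiff (arcDist E t) t z‖) :
    HasDerivAt (outerApprox E V W r f)
      (r * deriv f (r * z) * (exp (-herg V (arcDist E) z) * exp (-herg W (arcDist E) z)) -
        f (r * z) * (exp (-herg V (arcDist E) z) * exp (-herg W (arcDist E) z) *
          (hergDeriv E V z + hergDeriv E W z))) z := by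
  have h1 := (hasDerivAt_hergDeriv hEs hne hV hm h).neg.cexp
  have h2 := (hasDerivAt_hergDeriv hEs hne hW hm h).neg.cexp
  refine HasDerivAt.congr_of_eventuallyEq
    (((hasDerivAt_dilation hd hz).mul (h1.mul h2)).congr_deriv ?_) ?_
  · simp only [Pi.mul_apply, Pi.neg_apply]
    ring
  · filter_upwards [hE.isOpen_compl.mem_nhds hzE] with w hw
    exact outerApprox_of_notMem hw

lemma vanishAllDeriv_outerApprox (hE : IsClosed E) (hEs : E ⊆ sphere 0 1) (hne : E.Nonempty)
    (hnull : ∀ᵐ t ∂arcMeasure, arcDist E t ≠ 0)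
    (hV : Integrable V arcMeasure) (hV0 : ∀ t, 0 ≤ V t)
    (hW : Integrable W arcMeasure) (hW0 : ∀ t, 0 ≤ W t)
    (hWN : ∀ N : ℕ, ∃ B : ℝ, ∀ t, N * arcLog E t - B ≤ W t)
    (hd : DifferentiableOn ℂ f (ball 0 1)) {M : ℝ} (hM : 0 < M)
    (hfM : ∀ z : ℂ, ‖z‖ ≤ 1 → ‖f z‖ ≤ M) (hr0 : 0 < r) (hr1 : r < 1) :
    VanishAllDeriv E (outerApprox E V W r f) := by
  set c := min (1 / 100) ((1 - r) / 4) with hc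
  have hc0 : 0 < c := lt_min (by norm_num) (by linarith)
  have hnear : ∀ z w : ℂ, ‖z‖ ≤ 1 → 0 < infDist z E → ‖w - z‖ ≤ c * infDist z E ^ 2 →
      infDist z E ≤ 2 ∧ ‖w - z‖ ≤ infDist z E ^ 2 / 100 ∧ w ∉ E ∧ ‖(r : ℂ) * w‖ < 1 := by
    intro z w hz hD hw
    have hD2 : infDist z E ≤ 2 := (infDist_le_norm_add_one hEs hne z).trans (by linarith)
    have h1 : c ≤ 1 / 100 := min_le_left _ _
    have h2 : c ≤ (1 - r) / 4 := min_le_right _ _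
    have hw1 : ‖w - z‖ ≤ infDist z E ^ 2 / 100 := by nlinarith [sq_nonneg (infDist z E)]
    refine ⟨hD2, hw1, fun hwE => ?_, ?_⟩
    · have := infDist_le_dist_of_mem (x := z) hwE
      rw [dist_comm, dist_eq_norm] at this
      nlinarith
    · have h3 : infDist z E ^ 2 ≤ 4 := by nlinarith
      have h4 : ‖w‖ ≤ 1 + (1 - r) := by
        have := norm_sub_norm_le w z
        nlinarith [sq_nonneg (infDist z E)]
      rw [norm_mul, norm_real, Real.norm_of_nonneg hr0.le]
      nlinarith [norm_nonneg w, mul_pos (sub_pos.2 hr1) (sub_pos.2 hr1)]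
  refine vanishAllDeriv_of_flat hE hEs hne hc0 (fun z w hz hD hw => ?_) (fun N => ?_)
    fun z hz => if_pos hz
  · obtain ⟨hD2, hw1, hwE, hrw⟩ := hnear z w hz hD hw
    exact (hasDerivAt_outerApprox hE hEs hne hV hW hd hwE hrw
      (show 0 < 12 / 25 * infDist z E by positivity)
      (infDist_div_le_norm_poleDiff hz hD2 hw1)).differentiableAt
  · obtain ⟨C₁, hC₁, h₁⟩ := norm_exp_neg_herg_le hEs hne hnull hV hV0 (N := 0) (B := 0)
      fun t => by simpa using hV0 t
    obtain ⟨B, hB⟩ := hWN (80 * N)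
    obtain ⟨C₂, hC₂, h₂⟩ := norm_exp_neg_herg_le hEs hne hnull hW hW0 hB
    refine ⟨M * (C₁ * C₂), by positivity, fun z w hz hD hw => ?_⟩
    obtain ⟨-, hw1, hwE, hrw⟩ := hnear z w hz hD hw
    rw [outerApprox_of_notMem hwE, norm_mul, norm_mul]
    have e1 := h₁ z w hz hD hw1
    rw [pow_zero, mul_one] at e1
    calc _ ≤ M * (C₁ * (C₂ * infDist z E ^ N)) := by
          gcongr
          · exact hfM _ hrw.le
          · exact h₂ z w hz hD hw1
      _ = _ := by ring

end OuterApprox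

lemma norm_exp_neg_herg_le_one {E : Set ℂ} (hEs : E ⊆ sphere 0 1) (hne : E.Nonempty) {W : ℝ → ℝ}
    (hW : Integrable W arcMeasure) (hW0 : ∀ t, 0 ≤ W t) {z : ℂ} (hz : ‖z‖ < 1) :
    ‖exp (-herg W (arcDist E) z)‖ ≤ 1 := by
  rw [norm_exp, neg_re]
  exact Real.exp_le_one_iff.2 (by linarith [herg_re_nonneg hEs hne hW hW0 hz])

lemma norm_one_sub_exp_mul_exp_le {u v : ℂ} (h : ‖u‖ + ‖v‖ ≤ 1) :
    ‖1 - exp (-u) * exp (-v)‖ ≤ 2 * (‖u‖ + ‖v‖) := by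
  have h1 : ‖-u + -v‖ ≤ ‖u‖ + ‖v‖ := by
    simpa using norm_add_le (-u) (-v)
  rw [← Complex.exp_add, norm_sub_rev]
  exact (norm_exp_sub_one_le (h1.trans h)).trans (by linarith)

section Main

variable {E : Set ℂ} {f : ℂ → ℂ} {a C : ℝ}

lemma mem_J0Plus_of_null (hE : IsClosed E) (hEs : E ⊆ sphere 0 1) (hne : E.Nonempty)
    (hL : Integrable (arcLog E) arcMeasure) (hnull : ∀ᵐ t ∂arcMeasure, arcDist E t ≠ 0)
    (hfA : f ∈ APlus) (hc : ContinuousOn f (closedBall 0 1))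
    (hd : DifferentiableOn ℂ f (ball 0 1)) {β C' M : ℝ} (hβ : 1 / 2 < β) (hβ1 : β < 1)
    (hC : 0 < C) (hC' : 0 < C') (hM : 0 < M) (hfM : ∀ z : ℂ, ‖z‖ ≤ 1 → ‖f z‖ ≤ M)
    (hf' : ∀ z : ℂ, ‖z‖ < 1 → ‖deriv f z‖ ≤ C * (1 - ‖z‖) ^ (β - 1))
    (hmin : ∀ z : ℂ, ‖z‖ < 1 →
      ‖f z‖ * min (1 / (1 - ‖z‖)) (arcEnergy E z) ≤ C' * (1 - ‖z‖) ^ (β - 1)) :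
    f ∈ J0Plus E := by
  have hone : ∀ z : ℂ, ‖z‖ < 1 → 1 ≤ (1 - ‖z‖) ^ (β - 1) := fun z hz =>
    Real.one_le_rpow_of_pos_of_le_one_of_nonpos (by linarith) (by linarith [norm_nonneg z])
      (by linarith)
  refine mem_J0Plus_of_approx (C := 2 * C + 960 * C' + 2) hβ (by positivity) hfA hd
    (fun z hz => (hf' z hz).trans ?_) fun η hη => ?_
  · have := hone z hz
    gcongr
    linarith
  -- the two weights
  have hL0 := arcLog_nonneg hEs hne
  obtain ⟨δ₁, hδ₁, hδ₁h, hδ₁η⟩ : ∃ δ > 0, 11 * δ ≤ 1 / 2 ∧ M * (22 * δ) ≤ η / 4 := by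
    refine ⟨min (1 / 22) (η / (88 * M)), lt_min (by norm_num) (by positivity), ?_, ?_⟩
    · linarith [min_le_left (1 / 22) (η / (88 * M))]
    · calc _ ≤ M * (22 * (η / (88 * M))) := by gcongr; exact min_le_right _ _
        _ = η / 4 := by field_simp; norm_num
  obtain ⟨B, hB0, -, hB⟩ := exists_integral_max_zero_sub_le hL hL0 (δ := δ₁ / 160)
    (by positivity) 0
  set V : ℝ → ℝ := fun t => 160 * max 0 (arcLog E t - B) with hVd
  have hV : Integrable V arcMeasure := (integrable_max_zero_sub hL hL0 hB0).const_mul _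
  have hV0 : ∀ t, 0 ≤ V t := fun t => mul_nonneg (by norm_num) (le_max_left _ _)
  have hVi : ∫ t, V t ∂arcMeasure ≤ δ₁ := by
    rw [integral_const_mul]; linarith
  have hVK : ∀ t, V t ≤ 160 * arcLog E t := fun t =>
    mul_le_mul_of_nonneg_left (max_le (hL0 t) (by linarith)) (by norm_num)
  obtain ⟨A, hA, hVA⟩ := norm_exp_neg_herg_le hEs hne hnull hV hV0 (N := 2) (B := 160 * B)
    fun t => by
      have := le_max_right 0 (arcLog E t - B)
      simp only [hVd]
      push_cast
      linarith
  obtain ⟨δ₂, hδ₂, hδ₂₁, hδ₂A⟩ : ∃ δ > 0, δ ≤ δ₁ ∧ M * (A * (40 * δ)) ≤ 1 := by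
    refine ⟨min δ₁ (1 / (40 * A * M)), lt_min hδ₁ (by positivity), min_le_left _ _, ?_⟩
    calc _ ≤ M * (A * (40 * (1 / (40 * A * M)))) := by gcongr; exact min_le_right _ _
      _ = 1 := by field_simp
  obtain ⟨W, hW, hW0, hWi, hWN⟩ := exists_superlinear hL hL0 hδ₂
  -- the dilation parameter
  obtain ⟨σ, hσ, hση, hσA⟩ : ∃ σ > 0, σ ≤ η / 2 ∧ σ * (A * (40 * (δ₁ + δ₂))) ≤ 1 := by
    refine ⟨min (η / 2) (1 / (A * (40 * (δ₁ + δ₂)))), lt_min (by positivity) (by positivity),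
      min_le_left _ _, ?_⟩
    calc _ ≤ 1 / (A * (40 * (δ₁ + δ₂))) * (A * (40 * (δ₁ + δ₂))) := by
          gcongr; exact min_le_right _ _
      _ = 1 := by field_simp
  obtain ⟨r, hr0, hr1, hr⟩ := exists_dilation_close hc hσ
  have hball : ∀ z : ℂ, ‖z‖ < 1 → z ∉ E := fun z hz hzE => by
    have h1 := hEs hzE
    rw [mem_sphere_zero_iff_norm] at h1
    linarith
  refine ⟨outerApprox E V W r f, vanishAllDeriv_outerApprox hE hEs hne hnull hV hV0 hW hW0 hWN hd
    hM hfM hr0 hr1, fun z hz => ?_, fun z hz => ?_⟩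
  · have hzm : z ∈ ball (0 : ℂ) 1 := by simpa using hz
    have h1 : HasDerivAt f (deriv f z) z :=
      ((hd z hzm).differentiableAt (isOpen_ball.mem_nhds hzm)).hasDerivAt
    have hD : 0 < infDist z E := (hE.notMem_iff_infDist_pos hne).1 (hball z hz)
    have hp : ∀ t, infDist z E / 2 ≤ ‖poleDiff (arcDist E t) t z‖ := fun t => by
      linarith [infDist_le_two_mul_norm_poleDiff (E := E) hz.le t]
    rw [(h1.sub (hasDerivAt_outerApprox hE hEs hne hV hW hd (hball z hz)
      (norm_ofReal_mul_lt hr0 hr1 hz.le) (half_pos hD) hp)).deriv]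
    have hv := norm_hergDeriv_le_of_le hEs hne hV hV0 (half_pos hD) hp
    have hw := norm_hergDeriv_le_of_le hEs hne hW hW0 (half_pos hD) hp
    have hvK := norm_exp_neg_herg_mul_hergDeriv_le hEs hne hL hV (by norm_num) hV0 hVK hz
    have hv1 := norm_exp_neg_herg_le_one hEs hne hV hV0 hz
    have hw1 := norm_exp_neg_herg_le_one hEs hne hW hW0 hz
    have hvA := hVA z z hz.le hD (by rw [sub_self, norm_zero]; positivity)
    have hdil := norm_deriv_dilation_le hC.le hβ1 hr0 hr1 hf' hz
    have hfr := hr z hz.le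
    have hmn := hmin z hz
    have ho := hone z hz
    have hfz := hfM z hz.le
    set v := exp (-herg V (arcDist E) z)
    set w := exp (-herg W (arcDist E) z)
    set v' := hergDeriv E V z
    set w' := hergDeriv E W z
    set R := (1 - ‖z‖) ^ (β - 1)
    set D := infDist z E
    have hvw' : ∀ δ : ℝ, ∀ u' : ℂ, 0 ≤ δ → ‖u'‖ ≤ 10 / (D / 2) ^ 2 * δ →
        ‖v‖ * ‖u'‖ ≤ A * (40 * δ) := fun δ u' hδ hu => by
      calc ‖v‖ * ‖u'‖ ≤ (A * D ^ 2) * (10 / (D / 2) ^ 2 * δ) := by gcongr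
        _ = A * (40 * δ) := by field_simp; ring
    have hw2 : ‖v‖ * ‖w'‖ ≤ A * (40 * δ₂) :=
      hvw' _ _ hδ₂.le (hw.trans (by gcongr))
    have hv2 : ‖v‖ * ‖v'‖ ≤ A * (40 * δ₁) :=
      hvw' _ _ hδ₁.le (hv.trans (by gcongr))
    have e1 : ‖v * w * (v' + w')‖ ≤ ‖v‖ * ‖v'‖ + ‖v‖ * ‖w'‖ := by
      rw [norm_mul, norm_mul, ← mul_add]
      calc ‖v‖ * ‖w‖ * ‖v' + w'‖ ≤ ‖v‖ * 1 * (‖v'‖ + ‖w'‖) := by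
            gcongr
            exact norm_add_le _ _
        _ = _ := by ring
    have e2 : ‖r * deriv f (r * z) * (v * w)‖ ≤ C * R := by
      rw [norm_mul, norm_mul v w]
      calc _ ≤ C * R * (1 * 1) := by gcongr
        _ = _ := by ring
    have e3 : ‖f (r * z) * (v * w * (v' + w'))‖ ≤ 960 * C' * R + 2 := by
      have hsplit : ‖f (r * z)‖ ≤ ‖f z‖ + σ := by
        have := norm_sub_norm_le (f (r * z)) (f z)
        rw [norm_sub_rev] at this
        linarith
      rw [norm_mul]
      calc _ ≤ (‖f z‖ + σ) * (‖v‖ * ‖v'‖ + ‖v‖ * ‖w'‖) := by gcongr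
        _ = ‖f z‖ * (‖v‖ * ‖v'‖) + ‖f z‖ * (‖v‖ * ‖w'‖) +
            σ * (‖v‖ * ‖v'‖ + ‖v‖ * ‖w'‖) := by ring
        _ ≤ ‖f z‖ * (6 * 160 * min (1 / (1 - ‖z‖)) (arcEnergy E z)) + M * (A * (40 * δ₂)) +
            σ * (A * (40 * δ₁) + A * (40 * δ₂)) := by gcongr
        _ = 960 * (‖f z‖ * min (1 / (1 - ‖z‖)) (arcEnergy E z)) + M * (A * (40 * δ₂)) +
            σ * (A * (40 * (δ₁ + δ₂))) := by ring
        _ ≤ 960 * (C' * R) + 1 + 1 := by gcongr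
        _ = _ := by ring
    calc _ ≤ ‖deriv f z‖ + (‖r * deriv f (r * z) * (v * w)‖ +
          ‖f (r * z) * (v * w * (v' + w'))‖) :=
          (norm_sub_le _ _).trans (by gcongr; exact norm_sub_le _ _)
      _ ≤ C * R + (C * R + (960 * C' * R + 2)) := add_le_add (hf' z hz) (add_le_add e2 e3)
      _ ≤ _ := by linarith
  · have hz1 : ‖z‖ < 1 := by linarith
    rw [outerApprox_of_notMem (hball z hz1)]
    have hv := norm_herg_le hEs hne hV hV0 hz.le
    have hw := norm_herg_le hEs hne hW hW0 hz.le
    have hsum : ‖herg V (arcDist E) z‖ + ‖herg W (arcDist E) z‖ ≤ 22 * δ₁ := by linarith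
    have h1 := norm_one_sub_exp_mul_exp_le (hsum.trans (by linarith))
    have hfr := hfM _ (norm_ofReal_mul_lt hr0 hr1 hz1.le).le
    set P := exp (-herg V (arcDist E) z) * exp (-herg W (arcDist E) z)
    have e : f z - f (r * z) * P = (f z - f (r * z)) + f (r * z) * (1 - P) := by ring
    rw [e]
    calc _ ≤ ‖f z - f (r * z)‖ + ‖f (r * z)‖ * ‖1 - P‖ := by
          rw [← norm_mul]; exact norm_add_le _ _
      _ ≤ η / 2 + M * (2 * (22 * δ₁)) := by
          gcongr
          · exact (hr z hz1.le).trans hση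
          · exact h1.trans (by gcongr)
      _ ≤ η := by linarith

end Main

/-- If `E` is a Carleson set, `α > 1/2` and `f ∈ Λ_α(D) ∩ I⁺(E)`,
then `f ∈ J₀⁺(E)`. -/
theorem stmt_6 (E : Set ℂ) (hE : IsCarleson E) (α : ℝ) (hα : 1 / 2 < α)
    (f : ℂ → ℂ) (hf : LittleLip α f) (hfE : f ∈ IPlus E) :
    f ∈ J0Plus E := by
  obtain ⟨hEc, hEs, hEi⟩ := hE
  obtain ⟨hfA, hf0⟩ := hfE
  obtain ⟨a, C, ha, ha1, hC, hsph⟩ := hf.exists_holder hα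
  obtain ⟨hc, hd, -⟩ := hf
  have ha0 : 0 < a := by linarith
  have hhol : ∀ z ζ : ℂ, ‖z‖ ≤ 1 → ‖ζ‖ = 1 → ‖f z - f ζ‖ ≤ C * ‖z - ζ‖ ^ a := fun z ζ =>
    norm_sub_le_of_holder_sphere hc hd ha0 hC hsph
  have hder : ∀ z : ℂ, ‖z‖ < 1 → ‖deriv f z‖ ≤ 4 * C * (1 - ‖z‖) ^ (a - 1) := fun z =>
    norm_deriv_le_of_holder hd ha0 ha1 hC hhol
  rcases E.eq_empty_or_nonempty with rfl | hne
  · exact mem_J0Plus_empty ha ha1 (by positivity) hfA hc hd hder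
  have hL : Integrable (arcLog E) arcMeasure := hEi
  have hfD : ∀ z : ℂ, ‖z‖ ≤ 1 → ‖f z‖ ≤ C * infDist z E ^ a := fun z =>
    norm_le_infDist_rpow hhol hEc hEs hne hf0
  have hreg : ∀ η : ℝ, 0 < η → η ≤ 1 → ∀ z : ℂ, ‖z‖ ≤ 1 → ‖f z‖ ≤
      C * (2 ^ a * Real.exp a) * Real.exp (-(a / 3000 * (regHerg E η z).re)) :=
    fun η hη hη1 z hz => norm_le_exp_neg_regHerg hEs hne ha0 hC hc hd hfD hη hη1 hz
  have hM0 : 0 < C * (2 ^ a * Real.exp a) := by positivity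
  have hc0 : 0 < a / 3000 := by positivity
  by_cases hpos : arcMeasure {t | arcDist E t = 0} = 0
  · have hβ : (a + 1 / 2) / 2 < a := by linarith
    obtain ⟨C', hC', hmin⟩ := norm_mul_min_arcEnergy_le hEs hne hL
      (show 0 < (a + 1 / 2) / 2 by linarith) hβ ha1 hC hM0
      (show 0 < a / 3000 / 4 by positivity) hfD
      (fun z hz => norm_le_exp_neg_arcEnergy hEs hne hc0 hL hreg hM0.le hz) hhol
    obtain ⟨M, hM⟩ := (isCompact_closedBall (0 : ℂ) 1).exists_bound_of_continuousOn hc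
    refine mem_J0Plus_of_null hEc hEs hne hL (ae_iff.2 (by simpa using hpos)) hfA hc hd
      (M := max M 1) (β := (a + 1 / 2) / 2) (C := 4 * C) (by linarith) (by linarith)
      (by positivity) hC' (by positivity)
      (fun z hz => (hM z (by simpa using hz)).trans (le_max_left _ _)) (fun z hz => ?_) hmin
    refine (hder z hz).trans (mul_le_mul_of_nonneg_left ?_ (by positivity))
    exact Real.rpow_le_rpow_of_exponent_ge (by linarith) (by linarith [norm_nonneg z])
      (by linarith)
  · exact mem_J0Plus_of_eq_zero hfA hd fun z hz =>
      eq_zero_of_arcMeasure_ne_zero hEs hne hc0 hreg hM0.le hpos hz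
end
end

section
/- Let I be a closed ideal of A⁺ and let f ∈ I^A ∩ A⁺. Then the division ideal I(f) = {g ∈ A⁺ : fg ∈ I} is closed in the weak-star topology of A⁺. -/
noncomputable section

open Complex MeasureTheory Metric Set Filter

section WeightedSums

variable {ι E F : Type*} [NormedAddCommGroup E] [NormedSpace ℂ E] [NormedAddCommGroup F]
  [NormedSpace ℂ F]

theorem summable_norm_lp_one (x : lp (fun _ : ι => ℂ) 1) : Summable fun i => ‖x i‖ := by
  simpa using (lp.memℓp x).summable (by simp)

theorem norm_lp_one_eq_tsum (x : lp (fun _ : ι => ℂ) 1) : ‖x‖ = ∑' i, ‖x i‖ := by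
  simpa using lp.norm_eq_tsum_rpow (p := 1) (by simp) x

/-- The element of `ℓ¹` with prescribed absolutely summable coordinates. -/
def lpOneOfSummable (a : ι → ℂ) (ha : Summable fun i => ‖a i‖) : lp (fun _ : ι => ℂ) 1 :=
  ⟨a, memℓp_gen (by simpa using ha)⟩

theorem summable_norm_lp_one_smul (x : lp (fun _ : ι => ℂ) 1) {v : ι → E} {C : ℝ}
    (hv : ∀ i, ‖v i‖ ≤ C) : Summable fun i => ‖x i • v i‖ := by
  refine Summable.of_nonneg_of_le (fun _ => norm_nonneg _) (fun i => ?_)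
    ((summable_norm_lp_one x).mul_right C)
  rw [norm_smul]
  exact mul_le_mul_of_nonneg_left (hv i) (norm_nonneg _)

theorem norm_tsum_lp_one_smul_le (x : lp (fun _ : ι => ℂ) 1) {v : ι → E} {C : ℝ}
    (hv : ∀ i, ‖v i‖ ≤ C) : ‖∑' i, x i • v i‖ ≤ C * ‖x‖ := by
  have hs := summable_norm_lp_one_smul x hv
  have hle : ∀ i, ‖x i • v i‖ ≤ C * ‖x i‖ := fun i => by
    rw [norm_smul, mul_comm]
    exact mul_le_mul_of_nonneg_right (hv i) (norm_nonneg _)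
  rw [norm_lp_one_eq_tsum, ← tsum_mul_left]
  exact (norm_tsum_le_tsum_norm hs).trans
    (hs.tsum_le_tsum hle ((summable_norm_lp_one x).mul_left C))

variable [CompleteSpace E]

/-- The bounded operator `x ↦ ∑ i, x i • v i` on `ℓ¹` attached to a bounded family `v`. -/
def lpOneLift (v : ι → E) {C : ℝ} (hv : ∀ i, ‖v i‖ ≤ C) : lp (fun _ : ι => ℂ) 1 →L[ℂ] E :=
  LinearMap.mkContinuous
    { toFun := fun x => ∑' i, x i • v i
      map_add' := fun x y => by
        rw [← (summable_norm_lp_one_smul x hv).of_norm.tsum_add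
          (summable_norm_lp_one_smul y hv).of_norm]
        simp only [lp.coeFn_add, Pi.add_apply, add_smul]
      map_smul' := fun c x => by
        rw [RingHom.id_apply, ← (summable_norm_lp_one_smul x hv).of_norm.tsum_const_smul]
        simp only [lp.coeFn_smul, Pi.smul_apply, smul_eq_mul, mul_smul] }
    C fun x => norm_tsum_lp_one_smul_le x hv

variable {v : ι → E} {C : ℝ} (hv : ∀ i, ‖v i‖ ≤ C)

theorem lpOneLift_apply (x : lp (fun _ : ι => ℂ) 1) : lpOneLift v hv x = ∑' i, x i • v i := rfl

theorem hasSum_lpOneLift (x : lp (fun _ : ι => ℂ) 1) :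
    HasSum (fun i => x i • v i) (lpOneLift v hv x) :=
  (summable_norm_lp_one_smul x hv).of_norm.hasSum

theorem norm_lpOneLift_le (x : lp (fun _ : ι => ℂ) 1) : ‖lpOneLift v hv x‖ ≤ C * ‖x‖ :=
  norm_tsum_lp_one_smul_le x hv

theorem map_lpOneLift (L : E →L[ℂ] F) (x : lp (fun _ : ι => ℂ) 1) :
    L (lpOneLift v hv x) = ∑' i, x i • L (v i) := by
  rw [← ((hasSum_lpOneLift hv x).mapL L).tsum_eq]
  simp

variable [DecidableEq ι]

theorem lpOneLift_single (i : ι) : lpOneLift v hv (lp.single 1 i 1) = v i := by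
  rw [lpOneLift_apply, tsum_eq_single i]
  · simp
  · intro j hj
    simp [hj]

end WeightedSums

section Convolution

variable {G : Type*} [AddCommSemigroup G] [DecidableEq G]

/-- Translation by `n` on `ℓ¹(G)`. -/
def lpOneShift (n : G) : lp (fun _ : G => ℂ) 1 →L[ℂ] lp (fun _ : G => ℂ) 1 :=
  lpOneLift (fun k => lp.single 1 (k + n) 1) (C := 1)
    fun k => by rw [lp.norm_single (by simp)]; simp

theorem norm_lpOneShift_le (n : G) (x : lp (fun _ : G => ℂ) 1) : ‖lpOneShift n x‖ ≤ ‖x‖ :=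
  (norm_lpOneLift_le _ x).trans_eq (one_mul _)

/-- The convolution product on `ℓ¹(G)`. -/
def lpOneConv (x y : lp (fun _ : G => ℂ) 1) : lp (fun _ : G => ℂ) 1 :=
  lpOneLift (fun n => lpOneShift n x) (fun n => norm_lpOneShift_le n x) y

theorem map_lpOneShift {E : Type*} [NormedAddCommGroup E] [NormedSpace ℂ E]
    (L : lp (fun _ : G => ℂ) 1 →L[ℂ] E) (n : G) (x : lp (fun _ : G => ℂ) 1) :
    L (lpOneShift n x) = ∑' k, x k • L (lp.single 1 (k + n) 1) :=
  map_lpOneLift _ L x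

theorem map_lpOneConv {E : Type*} [NormedAddCommGroup E] [NormedSpace ℂ E]
    (L : lp (fun _ : G => ℂ) 1 →L[ℂ] E) (x y : lp (fun _ : G => ℂ) 1) :
    L (lpOneConv x y) = ∑' n, y n • L (lpOneShift n x) :=
  map_lpOneLift _ L y

variable {χ : G → ℂ} (hχ : ∀ i, ‖χ i‖ ≤ 1) (hadd : ∀ i j, χ (i + j) = χ i * χ j)
include hadd

theorem lpOneLift_shift (n : G) (x : lp (fun _ : G => ℂ) 1) :
    lpOneLift χ hχ (lpOneShift n x) = χ n * lpOneLift χ hχ x := by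
  rw [map_lpOneShift, lpOneLift_apply, ← tsum_mul_left]
  congr 1
  ext k
  rw [lpOneLift_single, hadd, smul_eq_mul, smul_eq_mul]
  ring

theorem lpOneLift_conv (x y : lp (fun _ : G => ℂ) 1) :
    lpOneLift χ hχ (lpOneConv x y) = lpOneLift χ hχ x * lpOneLift χ hχ y := by
  rw [map_lpOneConv, lpOneLift_apply (hv := hχ) (x := y), ← tsum_mul_left]
  congr 1
  ext n
  rw [lpOneLift_shift hχ hadd, smul_eq_mul, smul_eq_mul]
  ring

end Convolution

section Coefficients

theorem taylorCoeff_eq_of_hasSum {f : ℂ → ℂ} {a : ℕ → ℂ}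
    (h : ∀ z ∈ Metric.closedBall (0 : ℂ) 1, HasSum (fun n => a n * z ^ n) (f z)) :
    taylorCoeff f = a := by
  have h1 : HasFPowerSeriesAt f (FormalMultilinearSeries.ofScalars ℂ a) 0 := by
    rw [hasFPowerSeriesAt_iff]
    filter_upwards [Metric.closedBall_mem_nhds (0 : ℂ) one_pos] with z hz
    simpa [FormalMultilinearSeries.coeff_ofScalars, mul_comm] using h z hz
  have h2 := h1.analyticAt.hasFPowerSeriesAt.eq_formalMultilinearSeries h1
  ext n
  have := congrArg (fun p => FormalMultilinearSeries.coeff p n) h2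
  simpa [FormalMultilinearSeries.coeff_ofScalars, taylorCoeff] using this

theorem integral_exp_int_mul (k : ℤ) :
    ∫ θ in (0 : ℝ)..(2 * Real.pi), Complex.exp ((k * I) * (θ : ℂ)) =
      if k = 0 then 2 * Real.pi else 0 := by
  split_ifs with hk
  · simp [hk]
  · rw [integral_exp_mul_complex (by simp [hk])]
    have : Complex.exp (k * I * (2 * Real.pi)) = 1 := by
      rw [← Complex.exp_int_mul_two_pi_mul_I k]
      congr 1
      ring
    simp [this]

theorem fcoeff_eq_of_hasSum {f : ℂ → ℂ} {a : ℤ → ℂ} (ha : Summable fun n => ‖a n‖)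
    (h : ∀ z ∈ Metric.sphere (0 : ℂ) 1, HasSum (fun n => a n * z ^ n) (f z)) :
    fcoeff f = a := by
  ext n
  have key : HasSum (fun m : ℤ => ∫ θ in (0 : ℝ)..(2 * Real.pi),
        a m * Complex.exp (((m - n : ℤ) * I) * (θ : ℂ)))
      (∫ θ in (0 : ℝ)..(2 * Real.pi),
        f (Complex.exp ((θ : ℂ) * I)) * Complex.exp (-(n : ℂ) * (θ : ℂ) * I)) := by
    refine intervalIntegral.hasSum_integral_of_dominated_convergence (fun m _ => ‖a m‖)
      (fun m => by fun_prop) (fun m => ?_) ?_ (by simp) ?_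
    · filter_upwards with θ _
      have : ‖Complex.exp (((m - n : ℤ) * I) * (θ : ℂ))‖ = 1 := by
        rw [show ((m - n : ℤ) * I) * (θ : ℂ) = (((m - n : ℤ) * θ : ℝ) : ℂ) * I by push_cast; ring]
        exact Complex.norm_exp_ofReal_mul_I _
      rw [norm_mul, this, mul_one]
    · filter_upwards with θ _ using ha
    · filter_upwards with θ _
      refine ((h (Complex.exp (θ * I)) (by simp)).mul_right _).congr_fun fun m => ?_
      rw [← Complex.exp_int_mul, mul_assoc (a m), ← Complex.exp_add]
      congr 2
      push_cast
      ring
  have h2 : (fun m : ℤ => ∫ θ in (0 : ℝ)..(2 * Real.pi),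
        a m * Complex.exp (((m - n : ℤ) * I) * (θ : ℂ))) =
      fun m => if m = n then a n * (2 * Real.pi) else 0 := by
    ext m
    rw [intervalIntegral.integral_const_mul, integral_exp_int_mul]
    by_cases hm : m = n
    · simp [hm]
    · simp [hm, sub_eq_zero]
  rw [h2] at key
  rw [fcoeff, key.unique (hasSum_ite_eq n _)]
  have : (Real.pi : ℂ) ≠ 0 := by exact_mod_cast Real.pi_ne_zero
  field_simp

end Coefficients

section DiscSums

/-- `f` is, on the closed unit disk, the sum of the power series with coefficients `x`. -/
def IsDiscSum (f : ℂ → ℂ) (x : lp (fun _ : ℕ => ℂ) 1) : Prop :=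
  ∀ z ∈ Metric.closedBall (0 : ℂ) 1, HasSum (fun n => x n * z ^ n) (f z)

theorem mem_APlus_iff_exists_isDiscSum {f : ℂ → ℂ} : f ∈ APlus ↔ ∃ x, IsDiscSum f x :=
  ⟨fun ⟨a, ha, h⟩ => ⟨lpOneOfSummable a ha, h⟩, fun ⟨x, h⟩ => ⟨x, summable_norm_lp_one x, h⟩⟩

theorem norm_pow_le_one_of_mem_closedBall {z : ℂ} (hz : z ∈ Metric.closedBall (0 : ℂ) 1) (n : ℕ) :
    ‖z ^ n‖ ≤ 1 := by
  rw [norm_pow]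
  exact pow_le_one₀ (norm_nonneg _) (by simpa using hz)

theorem isDiscSum_iff {f : ℂ → ℂ} {x : lp (fun _ : ℕ => ℂ) 1} :
    IsDiscSum f x ↔ ∀ z (hz : z ∈ Metric.closedBall (0 : ℂ) 1),
      f z = lpOneLift (fun n => z ^ n) (norm_pow_le_one_of_mem_closedBall hz) x := by
  refine forall₂_congr fun z hz => ?_
  have := hasSum_lpOneLift (norm_pow_le_one_of_mem_closedBall hz) x
  simp only [smul_eq_mul] at this
  exact ⟨fun h => h.unique this, fun h => h ▸ this⟩

theorem isDiscSum_tsum (x : lp (fun _ : ℕ => ℂ) 1) :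
    IsDiscSum (fun z => ∑' n, x n * z ^ n) x :=
  isDiscSum_iff.2 fun _ _ => rfl

namespace IsDiscSum

variable {f g : ℂ → ℂ} {x y : lp (fun _ : ℕ => ℂ) 1}

theorem mem_APlus (hf : IsDiscSum f x) : f ∈ APlus := mem_APlus_iff_exists_isDiscSum.2 ⟨x, hf⟩

theorem taylorCoeff_eq (hf : IsDiscSum f x) : taylorCoeff f = x := taylorCoeff_eq_of_hasSum hf

theorem APlusNorm_eq (hf : IsDiscSum f x) : APlusNorm f = ‖x‖ := by
  rw [APlusNorm, hf.taylorCoeff_eq, norm_lp_one_eq_tsum]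

theorem add (hf : IsDiscSum f x) (hg : IsDiscSum g y) : IsDiscSum (f + g) (x + y) :=
  isDiscSum_iff.2 fun z hz => by
    rw [Pi.add_apply, isDiscSum_iff.1 hf z hz, isDiscSum_iff.1 hg z hz, map_add]

theorem sub (hf : IsDiscSum f x) (hg : IsDiscSum g y) : IsDiscSum (f - g) (x - y) :=
  isDiscSum_iff.2 fun z hz => by
    rw [Pi.sub_apply, isDiscSum_iff.1 hf z hz, isDiscSum_iff.1 hg z hz, map_sub]

theorem const_mul (hf : IsDiscSum f x) (c : ℂ) : IsDiscSum ((fun _ => c) * f) (c • x) :=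
  isDiscSum_iff.2 fun z hz => by
    rw [Pi.mul_apply, isDiscSum_iff.1 hf z hz, map_smul, smul_eq_mul]

theorem mul (hf : IsDiscSum f x) (hg : IsDiscSum g y) : IsDiscSum (f * g) (lpOneConv x y) :=
  isDiscSum_iff.2 fun z hz => by
    rw [Pi.mul_apply, isDiscSum_iff.1 hf z hz, isDiscSum_iff.1 hg z hz,
      lpOneLift_conv _ (pow_add z)]

theorem pow_mul (hf : IsDiscSum f x) (n : ℕ) :
    IsDiscSum ((fun z => z ^ n) * f) (lpOneShift n x) :=
  isDiscSum_iff.2 fun z hz => by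
    rw [Pi.mul_apply, isDiscSum_iff.1 hf z hz, lpOneLift_shift _ (pow_add z)]

end IsDiscSum

theorem const_mem_APlus (c : ℂ) : (fun _ => c) ∈ APlus :=
  (isDiscSum_iff (x := c • lp.single 1 0 1)).2 (fun z hz => by
    rw [map_smul, lpOneLift_single]; simp) |>.mem_APlus

theorem pow_mem_APlus (n : ℕ) : (fun z : ℂ => z ^ n) ∈ APlus :=
  (isDiscSum_iff (x := lp.single 1 n 1)).2 (fun z hz => by rw [lpOneLift_single]) |>.mem_APlus

end DiscSums

section CircleSums

/-- `f` is, on the unit circle, the sum of the trigonometric series with coefficients `x`. -/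
def IsCircleSum (f : ℂ → ℂ) (x : lp (fun _ : ℤ => ℂ) 1) : Prop :=
  ∀ z ∈ Metric.sphere (0 : ℂ) 1, HasSum (fun n => x n * z ^ n) (f z)

theorem norm_zpow_le_one_of_mem_sphere {z : ℂ} (hz : z ∈ Metric.sphere (0 : ℂ) 1) (n : ℤ) :
    ‖z ^ n‖ ≤ 1 := by
  rw [norm_zpow, mem_sphere_zero_iff_norm.1 hz, one_zpow]

theorem isCircleSum_iff {f : ℂ → ℂ} {x : lp (fun _ : ℤ => ℂ) 1} :
    IsCircleSum f x ↔ ∀ z (hz : z ∈ Metric.sphere (0 : ℂ) 1),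
      f z = lpOneLift (fun n => z ^ n) (norm_zpow_le_one_of_mem_sphere hz) x := by
  refine forall₂_congr fun z hz => ?_
  have := hasSum_lpOneLift (norm_zpow_le_one_of_mem_sphere hz) x
  simp only [smul_eq_mul] at this
  exact ⟨fun h => h.unique this, fun h => h ▸ this⟩

namespace IsCircleSum

variable {f g : ℂ → ℂ} {x y : lp (fun _ : ℤ => ℂ) 1}

theorem fcoeff_eq (hf : IsCircleSum f x) : fcoeff f = x :=
  fcoeff_eq_of_hasSum (summable_norm_lp_one x) hf

theorem mem_WienerAlg (hf : IsCircleSum f x) : f ∈ WienerAlg := by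
  refine ⟨?_, fun z hz => ?_⟩ <;> rw [hf.fcoeff_eq]
  exacts [summable_norm_lp_one x, hf z hz]

theorem WienerNorm_eq (hf : IsCircleSum f x) : WienerNorm f = ‖x‖ := by
  rw [WienerNorm, hf.fcoeff_eq, norm_lp_one_eq_tsum]

theorem add (hf : IsCircleSum f x) (hg : IsCircleSum g y) : IsCircleSum (f + g) (x + y) :=
  isCircleSum_iff.2 fun z hz => by
    rw [Pi.add_apply, isCircleSum_iff.1 hf z hz, isCircleSum_iff.1 hg z hz, map_add]

theorem sub (hf : IsCircleSum f x) (hg : IsCircleSum g y) : IsCircleSum (f - g) (x - y) :=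
  isCircleSum_iff.2 fun z hz => by
    rw [Pi.sub_apply, isCircleSum_iff.1 hf z hz, isCircleSum_iff.1 hg z hz, map_sub]

theorem mul (hf : IsCircleSum f x) (hg : IsCircleSum g y) :
    IsCircleSum (f * g) (lpOneConv x y) :=
  isCircleSum_iff.2 fun z hz => by
    have hz0 : z ≠ 0 := ne_zero_of_mem_unit_sphere ⟨z, hz⟩
    rw [Pi.mul_apply, isCircleSum_iff.1 hf z hz, isCircleSum_iff.1 hg z hz,
      lpOneLift_conv _ (zpow_add₀ hz0)]

end IsCircleSum

theorem exists_isCircleSum_of_mem_WienerAlg {f : ℂ → ℂ} (hf : f ∈ WienerAlg) :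
    ∃ x, IsCircleSum f x :=
  ⟨lpOneOfSummable _ hf.1, hf.2⟩

/-- Extension by zero `ℓ¹(ℕ) → ℓ¹(ℤ)`. -/
def lpOneExtend (x : lp (fun _ : ℕ => ℂ) 1) : lp (fun _ : ℤ => ℂ) 1 :=
  lpOneLift (fun n : ℕ => lp.single 1 (n : ℤ) 1) (C := 1)
    (fun k => by rw [lp.norm_single (by simp)]; simp) x

theorem lpOneLift_extend {v : ℤ → ℂ} {C : ℝ} (hv : ∀ i, ‖v i‖ ≤ C)
    (x : lp (fun _ : ℕ => ℂ) 1) :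
    lpOneLift v hv (lpOneExtend x) = ∑' n : ℕ, x n * v n := by
  rw [lpOneExtend, map_lpOneLift]
  simp only [lpOneLift_single, smul_eq_mul]

theorem IsDiscSum.isCircleSum {f : ℂ → ℂ} {x : lp (fun _ : ℕ => ℂ) 1} (hf : IsDiscSum f x) :
    IsCircleSum f (lpOneExtend x) :=
  isCircleSum_iff.2 fun z hz => by
    rw [lpOneLift_extend, ← (hf z (Metric.sphere_subset_closedBall hz)).tsum_eq]
    simp only [zpow_natCast]

end CircleSums

section VanishingCorrelation

variable {d : ℤ → ℂ} {C : ℝ} (hd : ∀ n, ‖d n‖ ≤ C)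

theorem lpOneLift_translate_shift (N n : ℤ) (x : lp (fun _ : ℤ => ℂ) 1) :
    lpOneLift (fun k => d (k + N)) (fun k => hd (k + N)) (lpOneShift n x) =
      lpOneLift (fun k => d (k + (N + n))) (fun k => hd (k + (N + n))) x := by
  rw [map_lpOneShift, lpOneLift_apply]
  congr 1
  ext k
  rw [lpOneLift_single]
  ring_nf

/-- The functions whose Fourier coefficients have correlation with `d` tending to `0`. -/
def vanishingCorrelation : Set (ℂ → ℂ) :=
  {h | ∃ x, IsCircleSum h x ∧
    Tendsto (fun N : ℤ => lpOneLift (fun k => d (k + N)) (fun k => hd (k + N)) x) atTop (nhds 0)}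

theorem isClosedIdealW_vanishingCorrelation : IsClosedIdealW (vanishingCorrelation hd) := by
  have hC : 0 ≤ C := (norm_nonneg _).trans (hd 0)
  refine ⟨?_, ?_, ?_, ?_⟩
  · rintro f ⟨x, hx, -⟩
    exact hx.mem_WienerAlg
  · rintro f ⟨x, hx, hxt⟩ g ⟨y, hy, hyt⟩
    exact ⟨x + y, hx.add hy, by simpa using hxt.add hyt⟩
  · rintro f hf g ⟨y, hy, hyt⟩
    obtain ⟨u, hu⟩ := exists_isCircleSum_of_mem_WienerAlg hf
    refine ⟨lpOneConv y u, mul_comm g f ▸ hy.mul hu, ?_⟩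
    simp only [map_lpOneConv]
    rw [← tsum_zero (α := ℂ) (β := ℤ)]
    refine tendsto_tsum_of_dominated_convergence
      ((summable_norm_lp_one u).mul_right (C * ‖y‖)) (fun n => ?_) (Eventually.of_forall ?_)
    · simp only [lpOneLift_translate_shift hd]
      simpa using (hyt.comp (tendsto_atTop_add_const_right _ n tendsto_id)).const_smul (u n)
    · intro N n
      rw [norm_smul, lpOneLift_translate_shift hd]
      exact mul_le_mul_of_nonneg_left (norm_lpOneLift_le _ y) (norm_nonneg _)
  · intro f hf happ
    obtain ⟨x, hx⟩ := exists_isCircleSum_of_mem_WienerAlg hf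
    refine ⟨x, hx, ?_⟩
    rw [NormedAddGroup.tendsto_nhds_zero]
    intro ε hε
    obtain ⟨g, ⟨y, hy, hyt⟩, hlt⟩ := happ (ε / 2 / (C + 1)) (by positivity)
    rw [(hx.sub hy).WienerNorm_eq, lt_div_iff₀ (by positivity)] at hlt
    filter_upwards [NormedAddGroup.tendsto_nhds_zero.1 hyt (ε / 2) (by positivity)] with N hN
    have h1 := norm_lpOneLift_le (fun k => hd (k + N)) (x - y)
    have h2 := norm_add_le (lpOneLift (fun k => d (k + N)) (fun k => hd (k + N)) (x - y))
      (lpOneLift (fun k => d (k + N)) (fun k => hd (k + N)) y)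
    rw [← map_add, sub_add_cancel] at h2
    nlinarith [norm_nonneg (x - y)]

end VanishingCorrelation

section ClosedIdeals

variable {I : Set (ℂ → ℂ)}

theorem IsClosedIdealAPlus.mem_of_isDiscSum (hI : IsClosedIdealAPlus I) {f g : ℂ → ℂ}
    {x : lp (fun _ : ℕ => ℂ) 1} (hf : IsDiscSum f x) (hg : IsDiscSum g x) (hfI : f ∈ I) :
    g ∈ I :=
  hI.2.2.2 g hg.mem_APlus fun ε hε => ⟨f, hfI, by
    rwa [(hg.sub hf).APlusNorm_eq, sub_self, norm_zero]⟩

/-- The coefficient sequences of the elements of a closed ideal of `A⁺`. -/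
def IsClosedIdealAPlus.coeffs (hI : IsClosedIdealAPlus I) (hne : I.Nonempty) :
    Submodule ℂ (lp (fun _ : ℕ => ℂ) 1) where
  carrier := {x | ∃ f ∈ I, IsDiscSum f x}
  add_mem' := fun ⟨f, hf, hfx⟩ ⟨g, hg, hgy⟩ => ⟨f + g, hI.2.1 f hf g hg, hfx.add hgy⟩
  zero_mem' := by
    obtain ⟨f, hf⟩ := hne
    obtain ⟨x, hx⟩ := mem_APlus_iff_exists_isDiscSum.1 (hI.1 hf)
    exact ⟨_, hI.2.2.1 _ (const_mem_APlus 0) f hf, zero_smul ℂ x ▸ hx.const_mul 0⟩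
  smul_mem' := fun c _ ⟨f, hf, hfx⟩ =>
    ⟨_, hI.2.2.1 _ (const_mem_APlus c) f hf, hfx.const_mul c⟩

theorem IsClosedIdealAPlus.isClosed_coeffs (hI : IsClosedIdealAPlus I) (hne : I.Nonempty) :
    IsClosed (hI.coeffs hne : Set (lp (fun _ : ℕ => ℂ) 1)) := by
  refine isClosed_of_closure_subset fun x hx => ?_
  refine ⟨_, hI.2.2.2 _ (isDiscSum_tsum x).mem_APlus fun ε hε => ?_, isDiscSum_tsum x⟩
  obtain ⟨y, ⟨g, hg, hgy⟩, hlt⟩ := Metric.mem_closure_iff.1 hx ε hε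
  exact ⟨g, hg, by rwa [((isDiscSum_tsum x).sub hgy).APlusNorm_eq, ← dist_eq_norm]⟩

theorem Submodule.exists_dual_ne_zero_of_notMem {E : Type*} [NormedAddCommGroup E]
    [NormedSpace ℂ E] {p : Submodule ℂ E} (hp : IsClosed (p : Set E)) {x : E} (hx : x ∉ p) :
    ∃ φ : E →L[ℂ] ℂ, (∀ y ∈ p, φ y = 0) ∧ φ x ≠ 0 := by
  have : IsClosed (p : Set E) := hp
  obtain ⟨ψ, hψ⟩ := SeparatingDual.exists_ne_zero (R := ℂ)
    (x := p.mkQ x) (by simpa using hx)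
  refine ⟨ψ.comp p.mkQL, fun y hy => ?_, hψ⟩
  exact (congrArg ψ ((Submodule.Quotient.mk_eq_zero p).2 hy)).trans (map_zero ψ)

/-- If `φ` annihilates the closed ideal `I` and `f` lies in the closed ideal of the Wiener algebra
generated by `I`, then the values of `φ` at the translates of `f` tend to `0`. -/
theorem tendsto_shift_of_mem_IdealGenW (hI : IsClosedIdealAPlus I) (hne : I.Nonempty)
    {φ : lp (fun _ : ℕ => ℂ) 1 →L[ℂ] ℂ} (hφ : ∀ y ∈ hI.coeffs hne, φ y = 0) {f : ℂ → ℂ}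
    {x : lp (fun _ : ℕ => ℂ) 1} (hx : IsDiscSum f x) (hf : f ∈ IdealGenW I) :
    Tendsto (fun n : ℕ => φ (lpOneShift n x)) atTop (nhds 0) := by
  let d : ℤ → ℂ := fun k => φ (lp.single 1 k.toNat 1)
  have hd : ∀ k, ‖d k‖ ≤ ‖φ‖ := fun k => by
    refine (φ.le_opNorm _).trans_eq ?_
    rw [lp.norm_single (by simp), norm_one, mul_one]
  have key : ∀ (N : ℕ) (y : lp (fun _ : ℕ => ℂ) 1),
      lpOneLift (fun k => d (k + N)) (fun k => hd (k + N)) (lpOneExtend y) =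
        φ (lpOneShift N y) := fun N y => by
    rw [lpOneLift_extend, map_lpOneShift]
    congr 1
  have hmem : f ∈ vanishingCorrelation hd := by
    refine Set.mem_sInter.1 hf _ ⟨isClosedIdealW_vanishingCorrelation hd, fun g hg => ?_⟩
    obtain ⟨y, hy⟩ := mem_APlus_iff_exists_isDiscSum.1 (hI.1 hg)
    refine ⟨_, hy.isCircleSum, tendsto_const_nhds.congr' ?_⟩
    filter_upwards [eventually_ge_atTop 0] with N hN
    lift N to ℕ using hN
    rw [key]
    exact (hφ _ ⟨_, hI.2.2.1 _ (pow_mem_APlus N) g hg, hy.pow_mul N⟩).symm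
  obtain ⟨x', hx', ht⟩ := hmem
  have hxx : x' = lpOneExtend x := by
    ext1
    rw [← hx'.fcoeff_eq, hx.isCircleSum.fcoeff_eq]
  subst hxx
  exact (ht.comp tendsto_natCast_atTop_atTop).congr fun N => key N x

end ClosedIdeals

/-- If `I` is a closed ideal of `A⁺` and `f ∈ I^A ∩ A⁺`, then the division
ideal `I(f)` is weak-star closed in `A⁺`. -/
theorem stmt_7 (I : Set (ℂ → ℂ)) (hI : IsClosedIdealAPlus I)
    (f : ℂ → ℂ) (hf : f ∈ APlus) (hfA : f ∈ IdealGenW I) :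
    WStarClosed (Idiv I f) := by
  refine ⟨fun g hg => hg.1, fun g hg happ => ⟨hg, ?_⟩⟩
  obtain ⟨g₀, hg₀, -⟩ := happ 0 (fun i => i.elim0) (fun i => i.elim0) 1 one_pos
  have hne : I.Nonempty := ⟨_, hg₀.2⟩
  obtain ⟨x, hx⟩ := mem_APlus_iff_exists_isDiscSum.1 hf
  obtain ⟨y, hy⟩ := mem_APlus_iff_exists_isDiscSum.1 hg
  by_contra hfg
  have hnot : lpOneConv x y ∉ hI.coeffs hne := fun ⟨_, hk, hkx⟩ =>
    hfg (hI.mem_of_isDiscSum hkx (hx.mul hy) hk)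
  obtain ⟨φ, hφ, hφne⟩ := Submodule.exists_dual_ne_zero_of_notMem (hI.isClosed_coeffs hne) hnot
  have hpair : ∀ {h : ℂ → ℂ} {w : lp (fun _ : ℕ => ℂ) 1}, IsDiscSum h w →
      pairing h (fun n => φ (lpOneShift n x)) = φ (lpOneConv x w) := fun hw => by
    rw [pairing, hw.taylorCoeff_eq, map_lpOneConv]
    rfl
  obtain ⟨k, hk, hlt⟩ := happ 1 (fun _ n => φ (lpOneShift n x))
    (fun _ => tendsto_shift_of_mem_IdealGenW hI hne hφ hx hfA) _ (norm_pos_iff.2 hφne)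
  obtain ⟨w, hw⟩ := mem_APlus_iff_exists_isDiscSum.1 hk.1
  have h0 := hlt 0
  rw [hpair hy, hpair hw, hφ _ ⟨_, hk.2, hx.mul hw⟩, sub_zero] at h0
  exact h0.false
end
end
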